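/- arXiv:2401.10803 — 9 statements merged into one kernel-verified Lean document; each statement's English description precedes it below -/
import Mathlib

section
/- There exists γ > 0 such that for every δ > 0 there exists N such that for all n ≥ N and every p with 0 ≤ p ≤ 1.1/n the following holds: the G(n,p)-probability of the set of simple graphs G on Fin n such that for every subset V' ⊆ Fin n with |V'| ≥ γ·log n the induced subgraph G[V'] is not globally rigid in ℝ is at least 1 − δ. -/
/-- A graph `G` is globally rigid in `ℝ` if any two injective embeddings of its
vertices into `ℝ` which agree on the distances along edges agree on all pairwise
distances. -/
def GloballyRigid {V : Type*} (G : SimpleGraph V) : Prop :=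
  ∀ f g : V → ℝ, Function.Injective f → Function.Injective g →
    (∀ x y : V, G.Adj x y → |f x - f y| = |g x - g y|) →
    ∀ x y : V, |f x - f y| = |g x - g y|

open Classical in
/-- The probability, under the Erdős–Rényi measure `G(n,p)`, of the set of simple
graphs on `Fin n` satisfying the predicate `P`. -/
noncomputable def erProb (n : ℕ) (p : ℝ) (P : SimpleGraph (Fin n) → Prop) : ℝ :=
  ∑ G : SimpleGraph (Fin n),
    if P G then p ^ G.edgeSet.ncard * (1 - p) ^ (n * (n - 1) / 2 - G.edgeSet.ncard) else 0

open Finset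

section Rigidity

variable {V : Type*}

/-- A placement of the vertices at distinct points of a grid such that every edge lies in a
row or in a column, and two vertices share neither, contradicts global rigidity. -/
theorem not_globallyRigid_of_grid (H : SimpleGraph V) (r c : V → ℕ) (hr : ∀ v, r v < 5)
    (hinj : ∀ x y, r x = r y → c x = c y → x = y)
    (hadj : ∀ x y, H.Adj x y → r x = r y ∨ c x = c y)
    (hne : ∃ x y, r x ≠ r y ∧ c x ≠ c y) : ¬ GloballyRigid H := by
  intro h
  have key := h (fun v => ((10 * c v + r v : ℤ) : ℝ)) (fun v => ((10 * c v - r v : ℤ) : ℝ))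
    ?_ ?_ ?_
  · obtain ⟨x, y, h1, h2⟩ := hne
    have hxy := key x y
    rw [← Int.cast_sub, ← Int.cast_sub, ← Int.cast_abs, ← Int.cast_abs, Int.cast_inj,
      abs_eq_abs] at hxy
    omega
  · intro x y hxy
    simp only [Int.cast_inj] at hxy
    have h1 := hr x
    have h2 := hr y
    exact hinj x y (by omega) (by omega)
  · intro x y hxy
    simp only [Int.cast_inj] at hxy
    have h1 := hr x
    have h2 := hr y
    exact hinj x y (by omega) (by omega)
  · intro x y hxy
    rw [← Int.cast_sub, ← Int.cast_sub, ← Int.cast_abs, ← Int.cast_abs, Int.cast_inj,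
      abs_eq_abs]
    rcases hadj x y hxy with h1 | h1
    · left; rw [h1]; ring
    · right; rw [h1]; ring

variable [Fintype V]

/-- A graph with at least three vertices that admits a cut whose edges form a matching is not
globally rigid. -/
theorem not_globallyRigid_of_matching_cut (H : SimpleGraph V) (S : Finset V) (hS : S.Nonempty)
    (hT : ∃ t, t ∉ S)
    (h1 : ∀ x ∈ S, ∀ t ∉ S, ∀ t' ∉ S, H.Adj x t → H.Adj x t' → t = t')
    (h2 : ∀ t ∉ S, ∀ x ∈ S, ∀ x' ∈ S, H.Adj x t → H.Adj x' t → x = x')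
    (hV : 3 ≤ Fintype.card V) : ¬ GloballyRigid H := by
  classical
  let e := Fintype.equivFin V
  let m : V → V := fun x => if h : x ∈ S ∧ ∃ t, t ∉ S ∧ H.Adj x t then h.2.choose else x
  have hm1 : ∀ x ∈ S, ∀ t ∉ S, H.Adj x t → m x = t := by
    intro x hx t ht hxt
    have h : x ∈ S ∧ ∃ t, t ∉ S ∧ H.Adj x t := ⟨hx, t, ht, hxt⟩
    simp only [m, dif_pos h]
    exact h1 x hx _ h.2.choose_spec.1 t ht h.2.choose_spec.2 hxt
  have hm2 : ∀ x, m x = x ∨ (x ∈ S ∧ m x ∉ S ∧ H.Adj x (m x)) := by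
    intro x
    by_cases h : x ∈ S ∧ ∃ t, t ∉ S ∧ H.Adj x t
    · right
      simp only [m, dif_pos h]
      exact ⟨h.1, h.2.choose_spec⟩
    · left; simp only [m, dif_neg h]
  have hinj : ∀ x y, (x ∈ S ↔ y ∈ S) → m x = m y → x = y := by
    intro x y hxy hmm
    rcases hm2 x with hx | ⟨hx, hx', hx''⟩ <;> rcases hm2 y with hy | ⟨hy, hy', hy''⟩
    · rw [← hx, hmm, hy]
    · rw [← hmm, hx] at hy'; tauto
    · rw [hmm, hy] at hx'; tauto
    · rw [← hmm] at hy''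
      exact h2 _ hx' x hx y hy hx'' hy''
  refine not_globallyRigid_of_grid H (fun v => if v ∈ S then 1 else 0) (fun v => (e (m v) : ℕ))
    ?_ ?_ ?_ ?_
  · intro v; split_ifs <;> norm_num
  · intro x y hr hc
    apply hinj x y
    · by_cases hx : x ∈ S <;> by_cases hy : y ∈ S <;> simp_all
    · exact e.injective (Fin.ext hc)
  · intro x y hxy
    by_cases hx : x ∈ S <;> by_cases hy : y ∈ S
    · left; simp [hx, hy]
    · right
      have : m y = y := by rcases hm2 y with h | h; exact h; exact absurd h.1 hy
      simp only [hm1 x hx y hy hxy, this]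
    · right
      have : m x = x := by rcases hm2 x with h | h; exact h; exact absurd h.1 hx
      simp only [hm1 y hy x hx hxy.symm, this]
    · left; simp [hx, hy]
  · by_contra! hcon
    obtain ⟨s, hs⟩ := hS
    obtain ⟨t, ht⟩ := hT
    have hst : ∀ x ∈ S, ∀ y ∉ S, m x = m y := by
      intro x hx y hy
      apply e.injective
      apply Fin.ext
      apply hcon x y
      simp [hx, hy]
    have hconst : ∀ x, m x = m s := by
      intro x
      by_cases hx : x ∈ S
      · rw [hst x hx t ht, hst s hs t ht]
      · rw [hst s hs x hx]
    have hinj' : Function.Injective (fun x : V => decide (x ∈ S)) := by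
      intro x y hxy
      apply hinj x y
      · simpa using hxy
      · rw [hconst, hconst y]
    have := Fintype.card_le_of_injective _ hinj'
    simp at this
    omega

open Classical in
/-- The number of neighbours of a vertex. -/
noncomputable def deg (H : SimpleGraph V) (v : V) : ℕ := #{w | H.Adj v w}

theorem two_le_deg_of_globallyRigid (H : SimpleGraph V) (hV : 3 ≤ Fintype.card V)
    (hH : GloballyRigid H) (v : V) : 2 ≤ deg H v := by
  classical
  by_contra! hd
  have hle : #{w | H.Adj v w} ≤ 1 := by unfold deg at hd; convert Nat.le_of_lt_succ hd
  refine not_globallyRigid_of_matching_cut H {v} ⟨v, by simp⟩ ?_ ?_ ?_ hV hH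
  · have : ({v} : Finset V) ≠ univ := by
      intro h
      have := congrArg Finset.card h
      simp at this
      omega
    by_contra! hc
    exact this (Finset.eq_univ_iff_forall.2 hc)
  · intro x hx t _ t' _ h1 h2
    rw [mem_singleton] at hx
    subst hx
    exact Finset.card_le_one.1 hle t (by simpa using h1) t' (by simpa using h2)
  · intro t _ x hx x' hx' _ _
    rw [mem_singleton] at hx hx'
    rw [hx, hx']

theorem exists_mem_pair_of_deg_eq_two (H : SimpleGraph V) {x y : V} (hxy : H.Adj x y)
    (hx : deg H x = 2) : ∃ x', x' ≠ x ∧ x' ≠ y ∧ ∀ w, H.Adj x w ↔ w = y ∨ w = x' := by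
  classical
  unfold deg at hx
  have hy : y ∈ ({w | H.Adj x w} : Finset V) := by simpa using hxy
  obtain ⟨a, b, hab, heq⟩ := Finset.card_eq_two.1 hx
  have hmem : ∀ w, H.Adj x w ↔ w = a ∨ w = b := by
    intro w
    have := congrArg (fun s => w ∈ s) heq
    simpa using this
  rcases (hmem y).1 hxy with h | h
  · refine ⟨b, ?_, ?_, ?_⟩
    · rintro rfl; exact H.irrefl ((hmem b).2 (Or.inr rfl))
    · rw [h]; exact hab.symm
    · rw [h]; exact hmem
  · refine ⟨a, ?_, ?_, ?_⟩
    · rintro rfl; exact H.irrefl ((hmem a).2 (Or.inl rfl))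
    · rw [h]; exact hab
    · intro w; rw [h, hmem w, or_comm]

/-- In a globally rigid graph on at least four vertices no two vertices of degree two are
adjacent. -/
theorem not_adj_of_deg_eq_two (H : SimpleGraph V) (hV : 4 ≤ Fintype.card V)
    (hH : GloballyRigid H) {x y : V} (hx : deg H x = 2) (hy : deg H y = 2) : ¬ H.Adj x y := by
  classical
  intro hxy
  obtain ⟨x', hx'x, hx'y, hNx⟩ := exists_mem_pair_of_deg_eq_two H hxy hx
  obtain ⟨y', hy'y, hy'x, hNy⟩ := exists_mem_pair_of_deg_eq_two H hxy.symm hy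
  have hne := hxy.ne
  have hex : ∀ s : Finset V, #s ≤ 3 → ∃ t, t ∉ s := by
    intro s hs
    by_contra! hc
    have := Finset.eq_univ_iff_forall.2 hc
    rw [this, Finset.card_univ] at hs
    omega
  by_cases hd : x' = y'
  · subst hd
    let e := Fintype.equivFin V
    obtain ⟨t, ht⟩ := hex {x, y, x'} Finset.card_le_three
    simp only [mem_insert, mem_singleton, not_or] at ht
    let m : V → V := fun v => if v = x ∨ v = y then x' else v
    have e1 : ∀ a b : V, ((e a : ℕ) = (e b : ℕ)) → a = b :=
      fun a b h => e.injective (Fin.ext h)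
    refine not_globallyRigid_of_grid H (fun v => if v = x then 1 else if v = y then 2 else 0)
      (fun v => (e (m v) : ℕ)) ?_ ?_ ?_ ?_ hH
    · intro v; split_ifs <;> norm_num
    · intro a b hr hc
      have hc := e1 _ _ hc
      clear hNx hNy ht hxy hH hV hex hx hy
      simp only [m] at hr hc
      split_ifs at hr hc <;> simp_all
    · intro a b hab
      by_cases ha : a = x
      · right
        subst ha
        rcases (hNx b).1 hab with rfl | rfl <;> simp [m]
      by_cases ha' : a = y
      · right
        subst ha'
        rcases (hNy b).1 hab with rfl | rfl <;> simp [m]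
      by_cases hb : b = x
      · right
        subst hb
        rcases (hNx a).1 hab.symm with rfl | rfl <;> simp [m]
      by_cases hb' : b = y
      · right
        subst hb'
        rcases (hNy a).1 hab.symm with rfl | rfl <;> simp [m]
      · left; simp [ha, ha', hb, hb']
    · refine ⟨x, t, ?_, ?_⟩
      · simp [ht.1, ht.2.1]
      · intro h
        have := e1 _ _ h
        simp only [m, ht.1, ht.2.1, true_or, or_self, if_true, if_false] at this
        exact ht.2.2 this.symm
  · refine not_globallyRigid_of_matching_cut H {x, y} ⟨x, by simp⟩
      (hex _ ((Finset.card_le_two).trans (by norm_num))) ?_ ?_ (by omega) hH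
    · intro a ha t ht t' ht' h1 h2
      simp only [mem_insert, mem_singleton, not_or] at ha ht ht'
      rcases ha with rfl | rfl
      · rw [((hNx t).1 h1).resolve_left ht.2, ((hNx t').1 h2).resolve_left ht'.2]
      · rw [((hNy t).1 h1).resolve_left ht.1, ((hNy t').1 h2).resolve_left ht'.1]
    · intro t ht a ha b hb h1 h2
      simp only [mem_insert, mem_singleton, not_or] at ha ht hb
      rcases ha with rfl | rfl <;> rcases hb with rfl | rfl
      · rfl
      · exact absurd ((((hNx t).1 h1).resolve_left ht.2).symm.trans
          (((hNy t).1 h2).resolve_left ht.1)) hd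
      · exact absurd ((((hNx t).1 h2).resolve_left ht.2).symm.trans
          (((hNy t).1 h1).resolve_left ht.1)) hd
      · rfl

theorem card_mul_le_sum_deg_of_globallyRigid (H : SimpleGraph V) (hV : 4 ≤ Fintype.card V)
    (hH : GloballyRigid H) : 12 * Fintype.card V ≤ 5 * ∑ v, deg H v := by
  classical
  let A : Finset V := {v | deg H v = 2}
  have hA : ∀ v, v ∈ A ↔ deg H v = 2 := by simp [A]
  have h1 : ∑ v ∈ A, deg H v = 2 * #A := by
    rw [Finset.sum_congr rfl (fun v hv => (hA v).1 hv), Finset.sum_const, smul_eq_mul, mul_comm]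
  have h2 : 3 * #Aᶜ ≤ ∑ v ∈ Aᶜ, deg H v := by
    rw [mul_comm, ← smul_eq_mul]
    apply Finset.card_nsmul_le_sum
    intro v hv
    have := two_le_deg_of_globallyRigid H (by omega) hH v
    have h' : deg H v ≠ 2 := fun h => Finset.mem_compl.1 hv ((hA v).2 h)
    omega
  have h3 : ∑ v ∈ A, deg H v ≤ ∑ v ∈ Aᶜ, deg H v := by
    calc ∑ v ∈ A, deg H v = ∑ v ∈ A, #{w ∈ Aᶜ | H.Adj v w} := by
          apply Finset.sum_congr rfl
          intro v hv
          unfold deg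
          congr 1
          ext w
          simp only [mem_filter, mem_univ, true_and, mem_compl]
          refine ⟨fun h => ⟨fun hw => ?_, h⟩, fun h => h.2⟩
          exact not_adj_of_deg_eq_two H hV hH ((hA v).1 hv) ((hA w).1 hw) h
      _ = ∑ w ∈ Aᶜ, #{v ∈ A | H.Adj v w} :=
          Finset.sum_card_bipartiteAbove_eq_sum_card_bipartiteBelow _
      _ ≤ ∑ v ∈ Aᶜ, deg H v := by
          apply Finset.sum_le_sum
          intro w _
          apply Finset.card_le_card
          intro v hv
          simp only [mem_filter, mem_univ, true_and] at hv ⊢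
          exact hv.2.symm
  have h4 : ∑ v, deg H v = ∑ v ∈ A, deg H v + ∑ v ∈ Aᶜ, deg H v :=
    (Finset.sum_add_sum_compl A _).symm
  have h5 : Fintype.card V = #A + #Aᶜ := (Finset.card_add_card_compl A).symm
  omega

end Rigidity

section Density

variable {V : Type*}

open Classical in
/-- The sum of the degrees of the subgraph induced on `X`, that is, twice its number of edges. -/
noncomputable def degSum (H : SimpleGraph V) (X : Finset V) : ℕ :=
  ∑ x ∈ X, #{y ∈ X | H.Adj x y}

open Classical in
theorem degSum_insert (H : SimpleGraph V) {x : V} {P : Finset V} (hx : x ∉ P) :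
    degSum H (insert x P) = degSum H P + 2 * #{y ∈ P | H.Adj x y} := by
  unfold degSum
  have h1 : ∀ a ∈ P, #{y ∈ insert x P | H.Adj a y} =
      #{y ∈ P | H.Adj a y} + if H.Adj x a then 1 else 0 := by
    intro a _
    rw [Finset.filter_insert]
    by_cases h : H.Adj a x
    · rw [if_pos h, if_pos h.symm, Finset.card_insert_of_notMem (by simp [hx])]
    · rw [if_neg h, if_neg (fun h' => h h'.symm), add_zero]
  rw [Finset.sum_insert hx, Finset.sum_congr rfl h1, Finset.sum_add_distrib,
    ← Finset.card_filter, Finset.filter_insert, if_neg (H.irrefl)]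
  ring

/-- A vertex is `M`-cyclic if it lies in a set of at most `M` vertices spanning at least as many
edges as it has vertices. -/
def IsCyclicVertex (H : SimpleGraph V) (M : ℕ) (v : V) : Prop :=
  ∃ X : Finset V, v ∈ X ∧ #X ≤ M ∧ 2 * #X ≤ degSum H X

open Classical in
theorem degSum_union_support (H : SimpleGraph V) {u x : V} (w : H.Walk u x) :
    ∀ P : Finset V, u ∈ P → 2 * #P ≤ degSum H P + 2 →
      2 * #(P ∪ w.support.toFinset) ≤ degSum H (P ∪ w.support.toFinset) + 2 := by
  induction w with
  | nil =>
    intro P hu hP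
    rw [SimpleGraph.Walk.support_nil, List.toFinset_cons, List.toFinset_nil,
      insert_empty_eq, Finset.union_eq_left.2 (Finset.singleton_subset_iff.2 hu)]
    exact hP
  | @cons a b c hab w ih =>
    intro P hu hP
    have hset : P ∪ (SimpleGraph.Walk.cons hab w).support.toFinset =
        insert b P ∪ w.support.toFinset := by
      ext z
      have := w.start_mem_support
      simp only [SimpleGraph.Walk.support_cons, List.toFinset_cons, mem_union, mem_insert,
        List.mem_toFinset]
      constructor
      · rintro (h | rfl | h) <;> tauto
      · rintro ((rfl | h) | h) <;> tauto
    rw [hset]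
    apply ih
    · simp
    · by_cases hb : b ∈ P
      · rw [Finset.insert_eq_of_mem hb]; exact hP
      · rw [Finset.card_insert_of_notMem hb, degSum_insert H hb]
        have : 0 < #{y ∈ P | H.Adj b y} :=
          Finset.card_pos.2 ⟨a, by simp [hu, hab.symm]⟩
        omega

theorem isCyclicVertex_of_walks (H : SimpleGraph V) {v s s' x : V} (w : H.Walk v s)
    (w' : H.Walk v s') (hs : s ≠ s') (hx : x ∉ w.support) (hx' : x ∉ w'.support)
    (hxs : H.Adj x s) (hxs' : H.Adj x s') {l : ℕ} (hl : w.length ≤ l) (hl' : w'.length ≤ l) :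
    IsCyclicVertex H (2 * l + 4) v := by
  classical
  let P : Finset V := ({v} ∪ w.support.toFinset) ∪ w'.support.toFinset
  have hP : 2 * #P ≤ degSum H P + 2 := by
    apply degSum_union_support
    · simp
    · apply degSum_union_support
      · simp
      · simp
  have hxP : x ∉ P := by simp [P, hx, hx']
  have hcard : #P ≤ 1 + (l + 1) + (l + 1) := by
    refine (Finset.card_union_le _ _).trans (add_le_add ((Finset.card_union_le _ _).trans
      (add_le_add (by simp) ?_)) ?_)
    · exact (List.toFinset_card_le _).trans (by rw [SimpleGraph.Walk.length_support]; omega)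
    · exact (List.toFinset_card_le _).trans (by rw [SimpleGraph.Walk.length_support]; omega)
  refine ⟨insert x P, by simp [P], ?_, ?_⟩
  · rw [Finset.card_insert_of_notMem hxP]; omega
  · rw [Finset.card_insert_of_notMem hxP, degSum_insert H hxP]
    have : 2 ≤ #{y ∈ P | H.Adj x y} := by
      rw [← Finset.card_pair hs]
      apply Finset.card_le_card
      intro z hz
      simp only [mem_insert, mem_singleton] at hz
      rcases hz with rfl | rfl <;> simp [P, hxs, hxs']
    omega

variable [Fintype V]

open Classical in
/-- The directed edges along which the exploration, which may skip one neighbour of each vertex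
it reaches, does not terminate within `t` steps. -/
def Unbounded (H : SimpleGraph V) : ℕ → V → V → Prop
  | 0 => fun u v => H.Adj u v
  | t + 1 => fun u v => H.Adj u v ∧ 2 ≤ #{w | w ≠ u ∧ Unbounded H t v w}

theorem Unbounded.adj {H : SimpleGraph V} {t : ℕ} {u v : V} (h : Unbounded H t u v) :
    H.Adj u v := by
  cases t with
  | zero => exact h
  | succ t => exact h.1

/-- `S` contains `v`, every vertex of `S` is at distance at most `t` from `v` within `S`, and has
at most one neighbour outside `S ∪ {u}`. -/
structure IsBlock (H : SimpleGraph V) (t : ℕ) (u v : V) (S : Finset V) : Prop where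
  mem : v ∈ S
  unique : ∀ x ∈ S, ∀ y ∉ S, ∀ y' ∉ S, y ≠ u → y' ≠ u → H.Adj x y → H.Adj x y' → y = y'
  walk : ∀ x ∈ S, ∃ w : H.Walk v x, (∀ z ∈ w.support, z ∈ S) ∧ w.length ≤ t

open Classical in
theorem exists_isBlock_succ (H : SimpleGraph V) (t : ℕ) (u v : V)
    (hv : #{w | w ≠ u ∧ Unbounded H t v w} ≤ 1)
    (ih : ∀ w, H.Adj v w → ¬ Unbounded H t v w → ∃ S, IsBlock H t v w S) :
    ∃ S, IsBlock H (t + 1) u v S := by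
  have ih' : ∀ w, ∃ S, H.Adj v w → ¬ Unbounded H t v w → IsBlock H t v w S := by
    intro w
    by_cases h : H.Adj v w ∧ ¬ Unbounded H t v w
    · obtain ⟨S, hS⟩ := ih w h.1 h.2
      exact ⟨S, fun _ _ => hS⟩
    · exact ⟨∅, fun h1 h2 => absurd ⟨h1, h2⟩ h⟩
  choose F hF using ih'
  let N : Finset V := {w | w ≠ u ∧ H.Adj v w ∧ ¬ Unbounded H t v w}
  have hN : ∀ w, w ∈ N ↔ w ≠ u ∧ H.Adj v w ∧ ¬ Unbounded H t v w := by simp [N]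
  have hmem : ∀ x, x ∈ insert v (N.biUnion F) ↔ x = v ∨ ∃ w ∈ N, x ∈ F w := by simp
  refine ⟨insert v (N.biUnion F), by simp, ?_, ?_⟩
  · intro x hx y hy y' hy' hyu hyu' hxy hxy'
    rw [hmem] at hx hy hy'
    push Not at hy hy'
    rcases hx with rfl | ⟨w, hw, hx⟩
    · have key : ∀ y, y ≠ u → H.Adj x y → (∀ w ∈ N, y ∉ F w) → Unbounded H t x y := by
        intro y hyu hxy hy
        by_contra hcon
        exact hy y ((hN y).2 ⟨hyu, hxy, hcon⟩) (hF y hxy hcon).mem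
      exact Finset.card_le_one.1 hv y (by simp [hyu, key y hyu hxy hy.2]) y'
        (by simp [hyu', key y' hyu' hxy' hy'.2])
    · have hB := hF w ((hN w).1 hw).2.1 ((hN w).1 hw).2.2
      exact hB.unique x hx y (hy.2 w hw) y' (hy'.2 w hw) hy.1 hy'.1 hxy hxy'
  · intro x hx
    rcases (hmem x).1 hx with rfl | ⟨w, hw, hx⟩
    · exact ⟨SimpleGraph.Walk.nil, by simp, by simp⟩
    · have hvw := ((hN w).1 hw).2.1
      have hB := hF w hvw ((hN w).1 hw).2.2
      obtain ⟨W, hW, hl⟩ := hB.walk x hx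
      refine ⟨SimpleGraph.Walk.cons hvw W, ?_, ?_⟩
      · intro z hz
        rw [SimpleGraph.Walk.support_cons, List.mem_cons] at hz
        rw [hmem]
        rcases hz with h | h
        · exact Or.inl h
        · exact Or.inr ⟨w, hw, hW z h⟩
      · rw [SimpleGraph.Walk.length_cons]; omega

theorem exists_isBlock (H : SimpleGraph V) (t : ℕ) : ∀ u v, H.Adj u v → ¬ Unbounded H t u v →
    ∃ S, IsBlock H t u v S := by
  induction t with
  | zero => intro u v h h'; exact absurd h h'
  | succ t ih =>
    intro u v h h'
    apply exists_isBlock_succ H t u v _ (ih v)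
    by_contra! hc
    exact h' ⟨h, hc⟩

open Classical in
theorem not_globallyRigid_of_card_unbounded_le_one (H : SimpleGraph V) (t : ℕ) (v : V)
    (hV : 3 ≤ Fintype.card V) (hv : #{w | Unbounded H t v w} ≤ 1)
    (hc : ¬ IsCyclicVertex H (2 * t + 6) v) : ¬ GloballyRigid H := by
  intro hH
  obtain ⟨S, hS⟩ := exists_isBlock_succ H t v v
    ((Finset.card_le_card (by intro w; simp)).trans hv) (exists_isBlock H t v)
  have hcyc : ∀ {s s' x : V} (w : H.Walk v s) (w' : H.Walk v s'), s ≠ s' → x ∉ w.support →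
      x ∉ w'.support → H.Adj x s → H.Adj x s' → w.length ≤ t + 1 → w'.length ≤ t + 1 → False :=
    fun w w' h1 h2 h3 h4 h5 h6 h7 => hc (isCyclicVertex_of_walks H w w' h1 h2 h3 h4 h5 h6 h7)
  by_cases hall : ∃ x, x ∉ S
  · refine not_globallyRigid_of_matching_cut H S ⟨v, hS.mem⟩ hall ?_ ?_ hV hH
    · intro x hx y hy y' hy' h1 h2
      exact hS.unique x hx y hy y' hy' (fun h => hy (h ▸ hS.mem)) (fun h => hy' (h ▸ hS.mem))
        h1 h2
    · intro y hy x hx x' hx' h1 h2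
      by_contra hne
      obtain ⟨w, hw, hl⟩ := hS.walk x hx
      obtain ⟨w', hw', hl'⟩ := hS.walk x' hx'
      exact hcyc w w' hne (fun h => hy (hw y h)) (fun h => hy (hw' y h)) h1.symm h2.symm hl hl'
  · push Not at hall
    have hreach : ∀ x, H.Reachable v x := fun x => (hS.walk x (hall x)).choose.reachable
    have hdist : ∀ x, H.dist v x ≤ t + 1 := by
      intro x
      obtain ⟨w, _, hl⟩ := hS.walk x (hall x)
      exact (SimpleGraph.dist_le w).trans hl
    obtain ⟨x, -, hx⟩ := Finset.exists_max_image univ (fun x => H.dist v x) ⟨v, mem_univ v⟩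
    have h2 : 1 < #{w | H.Adj x w} := by
      have := two_le_deg_of_globallyRigid H hV hH x
      unfold deg at this
      convert Nat.lt_of_succ_le this
    obtain ⟨s, hs, s', hs', hne⟩ := Finset.one_lt_card.1 h2
    simp only [mem_filter, mem_univ, true_and] at hs hs'
    have key : ∀ s, H.Adj x s → ∃ w : H.Walk v s, x ∉ w.support ∧ w.length ≤ t + 1 := by
      intro s hs
      obtain ⟨w, hw⟩ := (hreach s).exists_walk_length_eq_dist
      refine ⟨w, fun hmem => ?_, hw ▸ hdist s⟩
      have h3 := SimpleGraph.Walk.length_takeUntil_lt_length hmem hs.ne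
      have h4 := SimpleGraph.dist_le (w.takeUntil x hmem)
      have h5 := hx s (mem_univ s)
      omega
    obtain ⟨w, hw, hl⟩ := key s hs
    obtain ⟨w', hw', hl'⟩ := key s' hs'
    exact hcyc w w' hne hw hw' hs hs' hl hl'

open Classical in
theorem card_unbounded_step (H : SimpleGraph V) (t : ℕ) (v : V) :
    3 + #{u | Unbounded H (t + 1) u v} ≤
      #{w | Unbounded H t v w} + deg H v + if #{w | Unbounded H t v w} ≤ 1 then 3 else 0 := by
  have hd : #{u | Unbounded H (t + 1) u v} ≤ deg H v := by
    unfold deg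
    apply Finset.card_le_card
    intro u hu
    simp only [mem_filter, mem_univ, true_and] at hu ⊢
    exact hu.adj.symm
  split_ifs with h
  · omega
  · by_cases h2 : #{w | Unbounded H t v w} = 2
    · have : #{u | Unbounded H (t + 1) u v} + #{w | Unbounded H t v w} ≤ deg H v := by
        rw [← Finset.card_union_of_disjoint]
        · unfold deg
          apply Finset.card_le_card
          intro u hu
          simp only [mem_union, mem_filter, mem_univ, true_and] at hu ⊢
          rcases hu with hu | hu
          · exact hu.adj.symm
          · exact hu.adj
        · rw [Finset.disjoint_left]
          intro u hu hu'
          simp only [mem_filter, mem_univ, true_and] at hu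
          have h3 : ({w | w ≠ u ∧ Unbounded H t v w} : Finset V) =
              ({w | Unbounded H t v w} : Finset V).erase u := by
            ext w; simp
          have h4 := hu.2
          rw [h3, Finset.card_erase_of_mem hu', h2] at h4
          omega
      omega
    · omega

/-- If only the vertices of `D` lie close to a short cycle, a globally rigid graph has average
degree not much smaller than three. -/
theorem sum_deg_lower_bound (H : SimpleGraph V) (hV : 3 ≤ Fintype.card V)
    (hH : GloballyRigid H) (T : ℕ) (D : Finset V)
    (hD : ∀ v ∉ D, ¬ IsCyclicVertex H (2 * T + 6) v) :
    3 * Fintype.card V * T ≤ ∑ v, deg H v + T * (∑ v, deg H v + 3 * #D) := by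
  classical
  let B : ℕ → ℕ := fun t => ∑ v, #{w | Unbounded H t v w}
  have hB0 : B 0 = ∑ v, deg H v := by
    apply Finset.sum_congr rfl
    intro v _
    unfold deg
    congr 1
  have hstep : ∀ t < T, 3 * Fintype.card V + B (t + 1) ≤ B t + (∑ v, deg H v + 3 * #D) := by
    intro t ht
    have h1 : B (t + 1) = ∑ v, #{u | Unbounded H (t + 1) u v} :=
      Finset.sum_card_bipartiteAbove_eq_sum_card_bipartiteBelow (s := univ) (t := univ) _
    have h2 : ∑ v : V, (if #{w | Unbounded H t v w} ≤ 1 then 3 else 0) ≤ 3 * #D := by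
      rw [← Finset.sum_filter, Finset.sum_const, smul_eq_mul, mul_comm]
      apply Nat.mul_le_mul_left
      apply Finset.card_le_card
      intro v hv
      simp only [mem_filter, mem_univ, true_and] at hv
      by_contra hvD
      refine not_globallyRigid_of_card_unbounded_le_one H t v hV hv ?_ hH
      rintro ⟨X, h1, h2, h3⟩
      exact hD v hvD ⟨X, h1, h2.trans (by omega), h3⟩
    have h3 := Finset.sum_le_sum (fun v (_ : v ∈ univ) => card_unbounded_step H t v)
    simp only [Finset.sum_add_distrib, Finset.sum_const, Finset.card_univ, smul_eq_mul] at h3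
    rw [h1]
    simp only [B]
    linarith
  have hind : ∀ t ≤ T, 3 * Fintype.card V * t + B t ≤
      B 0 + t * (∑ v, deg H v + 3 * #D) := by
    intro t
    induction t with
    | zero => intro _; simp
    | succ t ih =>
      intro ht
      have := ih (by omega)
      have := hstep t (by omega)
      linarith
  have := hind T le_rfl
  rw [hB0] at this
  omega

end Density

section Induced

variable {W : Type*}

open Classical in
theorem degSum_induce (G : SimpleGraph W) (V' : Finset W)
    (X : Finset ((V' : Set W) : Type _)) :
    degSum (G.induce (V' : Set W)) X = degSum G (X.map (Function.Embedding.subtype _)) := by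
  unfold degSum
  rw [Finset.sum_map]
  apply Finset.sum_congr rfl
  intro x _
  rw [Finset.filter_map, Finset.card_map]
  rfl

theorem sum_deg_induce (G : SimpleGraph W) (V' : Finset W) :
    ∑ v, deg (G.induce (V' : Set W)) v = degSum G V' := by
  classical
  have h1 : ∑ v, deg (G.induce (V' : Set W)) v =
      degSum (G.induce (V' : Set W)) univ := by
    unfold deg degSum
    rfl
  rw [h1, degSum_induce]
  congr 1
  ext x
  simp

theorem card_mul_le_degSum (G : SimpleGraph W) (V' : Finset W) (hV : 4 ≤ #V')
    (h : GloballyRigid (G.induce (V' : Set W))) : 12 * #V' ≤ 5 * degSum G V' := by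
  have := card_mul_le_sum_deg_of_globallyRigid _ (by simpa using hV) h
  rw [sum_deg_induce] at this
  simpa using this

theorem degSum_lower_bound (G : SimpleGraph W) (V' : Finset W) (hV : 4 ≤ #V')
    (h : GloballyRigid (G.induce (V' : Set W))) (T : ℕ) (D : Finset W)
    (hD : ∀ v ∉ D, ¬ IsCyclicVertex G (2 * T + 6) v) :
    3 * #V' * T ≤ degSum G V' + T * (degSum G V' + 3 * #D) := by
  classical
  let D' : Finset ((V' : Set W) : Type _) := {v | v.1 ∈ D}
  have h1 := sum_deg_lower_bound (G.induce (V' : Set W)) (by simp; omega) h T D' ?_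
  · have h2 : #D' ≤ #D := by
      apply Finset.card_le_card_of_injOn Subtype.val
      · intro v hv
        simpa [D'] using hv
      · exact Subtype.val_injective.injOn
    rw [sum_deg_induce] at h1
    simp only [Finset.coe_sort_coe, Fintype.card_coe] at h1
    refine h1.trans ?_
    gcongr
  · rintro v hv ⟨X, hvX, hX, hd⟩
    refine hD v.1 (by simpa [D'] using hv) ⟨X.map (Function.Embedding.subtype _), ?_, ?_, ?_⟩
    · exact Finset.mem_map_of_mem _ hvX
    · rwa [Finset.card_map]
    · rwa [Finset.card_map, ← degSum_induce]

theorem degSum_le_sum_deg_sub_two [Fintype W] (G : SimpleGraph W) (X : Finset W) :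
    degSum G X ≤ 2 * #X + ∑ v, (deg G v - 2) := by
  classical
  unfold degSum
  calc ∑ x ∈ X, #{y ∈ X | G.Adj x y} ≤ ∑ x ∈ X, (2 + (deg G x - 2)) := by
        apply Finset.sum_le_sum
        intro x _
        have : #{y ∈ X | G.Adj x y} ≤ deg G x := by
          unfold deg
          apply Finset.card_le_card
          intro y
          simp only [mem_filter, mem_univ, true_and]
          exact fun h => h.2
        omega
    _ = 2 * #X + ∑ x ∈ X, (deg G x - 2) := by
        rw [Finset.sum_add_distrib, Finset.sum_const, smul_eq_mul, mul_comm]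
    _ ≤ _ := by
        gcongr
        exact Finset.subset_univ X

variable [DecidableEq W]

/-- The possible edges with both ends in `X`. -/
def edgesIn (X : Finset W) : Finset (Sym2 W) := {e ∈ X.sym2 | ¬ e.IsDiag}

theorem mk_mem_edgesIn {X : Finset W} {x y : W} :
    s(x, y) ∈ edgesIn X ↔ x ∈ X ∧ y ∈ X ∧ x ≠ y := by
  simp [edgesIn, and_assoc]

theorem edgesIn_subset_edgesIn {X Y : Finset W} (h : X ⊆ Y) : edgesIn X ⊆ edgesIn Y :=
  Finset.filter_subset_filter _ (Finset.sym2_mono h)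

theorem card_edgesIn (X : Finset W) : #(edgesIn X) = (#X).choose 2 := by
  rw [← Sym2.card_image_offDiag]
  congr 1
  ext e
  induction e with | _ x y
  rw [mk_mem_edgesIn]
  simp only [Finset.mem_image, Finset.mem_offDiag, Prod.exists, Function.uncurry_apply_pair,
    Sym2.eq_iff]
  constructor
  · exact fun h => ⟨x, y, h, Or.inl ⟨rfl, rfl⟩⟩
  · rintro ⟨a, b, ⟨ha, hb, hab⟩, ⟨rfl, rfl⟩ | ⟨rfl, rfl⟩⟩
    · exact ⟨ha, hb, hab⟩
    · exact ⟨hb, ha, hab.symm⟩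

theorem card_filter_adj_fromEdgeSet (S : Finset (Sym2 W))
    {X : Finset W} {x : W} {_ : DecidablePred ((SimpleGraph.fromEdgeSet (S : Set (Sym2 W))).Adj x)}
    (hx : x ∈ X) :
    #{y ∈ X | (SimpleGraph.fromEdgeSet (S : Set (Sym2 W))).Adj x y} =
      #{e ∈ S ∩ edgesIn X | x ∈ e} := by
  apply Finset.card_bij (fun y _ => s(x, y))
  · intro y hy
    simp only [mem_filter, SimpleGraph.fromEdgeSet_adj, Finset.mem_coe] at hy
    simp only [mem_filter, mem_inter, mk_mem_edgesIn, Sym2.mem_iff, true_or, and_true]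
    exact ⟨hy.2.1, hx, hy.1, hy.2.2⟩
  · intro a _ b _ hab
    exact Sym2.congr_right.1 hab
  · intro e he
    simp only [mem_filter, mem_inter] at he
    obtain ⟨y, rfl⟩ := Sym2.mem_iff_exists.1 he.2
    have h := mk_mem_edgesIn.1 he.1.2
    exact ⟨y, by simpa using ⟨h.2.1, he.1.1, h.2.2⟩, rfl⟩

theorem degSum_fromEdgeSet (S : Finset (Sym2 W)) (X : Finset W) :
    degSum (SimpleGraph.fromEdgeSet (S : Set (Sym2 W))) X = 2 * #(S ∩ edgesIn X) := by
  classical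
  unfold degSum
  refine (Finset.sum_congr rfl fun x hx => card_filter_adj_fromEdgeSet S hx).trans ?_
  refine (Finset.sum_card_bipartiteAbove_eq_sum_card_bipartiteBelow (fun x e => x ∈ e)).trans ?_
  rw [mul_comm, ← smul_eq_mul, ← Finset.sum_const]
  apply Finset.sum_congr rfl
  intro e he
  induction e with | _ x y
  have h := mk_mem_edgesIn.1 (mem_inter.1 he).2
  rw [Finset.bipartiteBelow, ← Finset.card_pair h.2.2]
  congr 1
  ext z
  simp only [mem_filter, Sym2.mem_iff, mem_insert, mem_singleton, and_iff_right_iff_imp]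
  rintro (rfl | rfl)
  exacts [h.1, h.2.1]

/-- The possible edges at `v`. -/
def edgesAt [Fintype W] (v : W) : Finset (Sym2 W) := {e ∈ edgesIn univ | v ∈ e}

theorem deg_fromEdgeSet [Fintype W] (S : Finset (Sym2 W)) (v : W) :
    deg (SimpleGraph.fromEdgeSet (S : Set (Sym2 W))) v = #(S ∩ edgesAt v) := by
  classical
  unfold deg edgesAt
  rw [card_filter_adj_fromEdgeSet S (mem_univ v), Finset.inter_filter]

theorem card_edgesAt [Fintype W] (v : W) : #(edgesAt v) = Fintype.card W - 1 := by
  classical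
  have h := deg_fromEdgeSet univ v
  rw [Finset.univ_inter] at h
  rw [← h, deg, ← Finset.card_univ, ← Finset.card_erase_of_mem (mem_univ v)]
  congr 1
  ext w
  simp [eq_comm]

end Induced

section Expectation

variable {ι : Type*}

/-- The expectation of `f` over the random subset of `E` that contains each element
independently with probability `p`. -/
noncomputable def bernoulliMean (E : Finset ι) (p : ℝ) (f : Finset ι → ℝ) : ℝ :=
  ∑ S ∈ E.powerset, p ^ #S * (1 - p) ^ (#E - #S) * f S

theorem bernoulliMean_add (E : Finset ι) (p : ℝ) (f g : Finset ι → ℝ) :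
    bernoulliMean E p (fun S => f S + g S) = bernoulliMean E p f + bernoulliMean E p g := by
  simp only [bernoulliMean, mul_add, Finset.sum_add_distrib]

theorem bernoulliMean_sub (E : Finset ι) (p : ℝ) (f g : Finset ι → ℝ) :
    bernoulliMean E p (fun S => f S - g S) = bernoulliMean E p f - bernoulliMean E p g := by
  simp only [bernoulliMean, mul_sub, Finset.sum_sub_distrib]

theorem bernoulliMean_const_mul (E : Finset ι) (p c : ℝ) (f : Finset ι → ℝ) :
    bernoulliMean E p (fun S => c * f S) = c * bernoulliMean E p f := by
  simp only [bernoulliMean, Finset.mul_sum]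
  exact Finset.sum_congr rfl fun S _ => by ring

theorem bernoulliMean_sum {κ : Type*} (E : Finset ι) (p : ℝ) (K : Finset κ)
    (f : κ → Finset ι → ℝ) :
    bernoulliMean E p (fun S => ∑ k ∈ K, f k S) = ∑ k ∈ K, bernoulliMean E p (f k) := by
  simp only [bernoulliMean, Finset.mul_sum]
  exact Finset.sum_comm

theorem bernoulliMean_mono (E : Finset ι) {p : ℝ} (hp : 0 ≤ p) (hp1 : p ≤ 1) {f g : Finset ι → ℝ}
    (h : ∀ S ⊆ E, f S ≤ g S) : bernoulliMean E p f ≤ bernoulliMean E p g := by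
  apply Finset.sum_le_sum
  intro S hS
  have : 0 ≤ 1 - p := by linarith
  exact mul_le_mul_of_nonneg_left (h S (Finset.mem_powerset.1 hS)) (by positivity)

theorem bernoulliMean_const (E : Finset ι) (p c : ℝ) : bernoulliMean E p (fun _ => c) = c := by
  simp only [bernoulliMean]
  rw [← Finset.sum_mul, Finset.sum_pow_mul_eq_add_pow]
  simp

variable [DecidableEq ι]

/-- The generating function of the number of chosen elements of `F`. -/
theorem bernoulliMean_pow (E F : Finset ι) (hF : F ⊆ E) (p y : ℝ) :
    bernoulliMean E p (fun S => y ^ #(S ∩ F)) = (1 - p + p * y) ^ #F := by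
  have h := Finset.prod_add (fun e => p * if e ∈ F then y else 1) (fun _ => 1 - p) E
  have h1 : ∏ e ∈ E, ((p * if e ∈ F then y else 1) + (1 - p)) = (1 - p + p * y) ^ #F := by
    rw [← Finset.prod_sdiff hF, Finset.prod_eq_one, one_mul]
    · rw [Finset.prod_congr rfl (g := fun _ => 1 - p + p * y), Finset.prod_const]
      intro e he
      rw [if_pos he, add_comm]
    · intro e he
      rw [if_neg (Finset.mem_sdiff.1 he).2]
      ring
  rw [← h1, h]
  apply Finset.sum_congr rfl
  intro S hS
  rw [Finset.prod_mul_distrib, Finset.prod_const, Finset.prod_const,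
    Finset.card_sdiff_of_subset (Finset.mem_powerset.1 hS), Finset.prod_ite, Finset.prod_const,
    Finset.prod_const_one, mul_one, Finset.filter_mem_eq_inter]
  ring

theorem bernoulliMean_insert (E : Finset ι) (p : ℝ) {e : ι} (he : e ∉ E) (f : Finset ι → ℝ) :
    bernoulliMean (insert e E) p f =
      (1 - p) * bernoulliMean E p f + p * bernoulliMean E p (fun S => f (insert e S)) := by
  unfold bernoulliMean
  rw [Finset.sum_powerset_insert he, Finset.mul_sum, Finset.mul_sum,
    Finset.card_insert_of_notMem he]
  congr 1
  · apply Finset.sum_congr rfl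
    intro S hS
    have := Finset.card_le_card (Finset.mem_powerset.1 hS)
    rw [Nat.sub_add_comm this, pow_succ]
    ring
  · apply Finset.sum_congr rfl
    intro S hS
    have heS : e ∉ S := fun h => he (Finset.mem_powerset.1 hS h)
    rw [Finset.card_insert_of_notMem heS, Nat.add_sub_add_right, pow_succ]
    ring

/-- An Efron–Stein type inequality for functions with bounded differences. -/
theorem bernoulliMean_sq_le (p L : ℝ) (hp : 0 ≤ p) (hp1 : p ≤ 1) (E : Finset ι) :
    ∀ f : Finset ι → ℝ, (∀ e ∈ E, ∀ S ⊆ E, e ∉ S → |f (insert e S) - f S| ≤ L) →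
      bernoulliMean E p (fun S => f S ^ 2) ≤ bernoulliMean E p f ^ 2 + #E * (p * L ^ 2) := by
  induction E using Finset.induction_on with
  | empty => intro f _; simp [bernoulliMean]
  | insert e E he ih =>
    intro f hf
    rw [bernoulliMean_insert E p he, bernoulliMean_insert E p he, Finset.card_insert_of_notMem he]
    have h0 := ih f (fun a ha S hS haS => hf a (Finset.mem_insert_of_mem ha) S
      (hS.trans (Finset.subset_insert _ _)) haS)
    have h1 := ih (fun S => f (insert e S)) (fun a ha S hS haS => by
      rw [Finset.insert_comm]
      refine hf a (Finset.mem_insert_of_mem ha) _ (Finset.insert_subset_insert _ hS) ?_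
      rw [Finset.mem_insert, not_or]
      exact ⟨fun h => he (h ▸ ha), haS⟩)
    have h2 : ∀ S ⊆ E, |f (insert e S) - f S| ≤ L := fun S hS =>
      hf e (Finset.mem_insert_self _ _) S (hS.trans (Finset.subset_insert _ _))
        (fun h => he (hS h))
    have h3 : (bernoulliMean E p (fun S => f (insert e S)) - bernoulliMean E p f) ^ 2 ≤ L ^ 2 := by
      rw [← bernoulliMean_sub]
      apply sq_le_sq'
      · rw [← bernoulliMean_const E p (-L)]
        exact bernoulliMean_mono E hp hp1 fun S hS => (abs_le.1 (h2 S hS)).1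
      · rw [← bernoulliMean_const E p L]
        exact bernoulliMean_mono E hp hp1 fun S hS => (abs_le.1 (h2 S hS)).2
    push_cast
    set A := bernoulliMean E p f
    set B := bernoulliMean E p (fun S => f (insert e S))
    have h4 : p * (1 - p) * (B - A) ^ 2 ≤ p * L ^ 2 := by
      have : p * (1 - p) ≤ p := by nlinarith
      exact mul_le_mul this h3 (sq_nonneg _) hp
    have h5 := mul_le_mul_of_nonneg_left h0 (sub_nonneg.2 hp1)
    have h6 := mul_le_mul_of_nonneg_left h1 hp
    nlinarith

end Expectation

theorem erProb_eq_bernoulliMean (n : ℕ) (p : ℝ) (P : SimpleGraph (Fin n) → Prop) [DecidablePred P] :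
    erProb n p P = bernoulliMean (edgesIn (univ : Finset (Fin n))) p
      (fun S => if P (SimpleGraph.fromEdgeSet (S : Set (Sym2 (Fin n)))) then 1 else 0) := by
  classical
  unfold erProb bernoulliMean
  refine Finset.sum_bij' (fun G _ => G.edgeFinset)
    (fun S _ => SimpleGraph.fromEdgeSet (S : Set (Sym2 (Fin n)))) ?_ ?_ ?_ ?_ ?_
  · intro G _
    rw [Finset.mem_powerset]
    intro e he
    simp only [edgesIn, mem_filter, Finset.mem_sym2_iff, mem_univ, implies_true, true_and]
    exact G.not_isDiag_of_mem_edgeSet (SimpleGraph.mem_edgeFinset.1 he)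
  · intro S _; exact mem_univ _
  · intro G _; simp
  · intro S hS
    rw [Finset.mem_powerset] at hS
    ext e
    simp only [SimpleGraph.mem_edgeFinset, SimpleGraph.edgeSet_fromEdgeSet, Set.mem_sdiff,
      Finset.mem_coe]
    refine ⟨fun h => h.1, fun h => ⟨h, ?_⟩⟩
    have := hS h
    simp only [edgesIn, mem_filter] at this
    exact this.2
  · intro G _
    simp only [SimpleGraph.coe_edgeFinset, SimpleGraph.fromEdgeSet_edgeSet, card_edgesIn,
      Finset.card_univ, Fintype.card_fin, Nat.choose_two_right, mul_ite, mul_one, mul_zero,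
      Set.ncard_eq_toFinset_card']
    rfl

theorem card_sub_two_eq {W : Type*} [DecidableEq W] (A F : Finset W) (hA : A ⊆ F) :
    ((#A - 2 : ℕ) : ℝ) = #A - 2 + (2 - #F) * 0 ^ #A + ∑ e ∈ F, (0 : ℝ) ^ #(A.erase e) := by
  rcases Nat.lt_or_ge (#A) 2 with h | h
  · interval_cases h' : #A
    · rw [Finset.card_eq_zero] at h'
      subst h'
      simp
      ring
    · obtain ⟨a, rfl⟩ := Finset.card_eq_one.1 h'
      rw [Finset.sum_eq_single_of_mem a (hA (mem_singleton_self a))]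
      · norm_num
      · intro b _ hb
        rw [Finset.erase_eq_of_notMem (by simpa using hb)]
        simp
  · rw [Finset.sum_eq_zero, Nat.cast_sub h, zero_pow (by omega)]
    · push_cast; ring
    · intro e _
      apply zero_pow
      have := Finset.pred_card_le_card_erase (s := A) (a := e)
      omega

theorem bernoulliMean_card_sub_two {ι : Type*} [DecidableEq ι] (E F : Finset ι)
    (hF : F ⊆ E) (p : ℝ) :
    bernoulliMean E p (fun S => ((#(S ∩ F) - 2 : ℕ) : ℝ)) =
      #F * p - 2 + 2 * (1 - p) ^ #F + #F * p * (1 - p) ^ (#F - 1) := by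
  have h1 : (fun S : Finset ι => ((#(S ∩ F) - 2 : ℕ) : ℝ)) = fun S =>
      (∑ e ∈ F, (1 - (0 : ℝ) ^ #(S ∩ {e})) + (-2 + (2 - #F) * 0 ^ #(S ∩ F))) +
        ∑ e ∈ F, (0 : ℝ) ^ #(S ∩ F.erase e) := by
    funext S
    rw [card_sub_two_eq _ F Finset.inter_subset_right]
    have h2 : ∑ e ∈ F, (1 - (0 : ℝ) ^ #(S ∩ {e})) = #(S ∩ F) := by
      rw [Finset.inter_comm, ← Finset.filter_mem_eq_inter, ← Finset.sum_boole]
      apply Finset.sum_congr rfl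
      intro e _
      by_cases he : e ∈ S <;> simp [he]
    rw [h2]
    simp only [Finset.inter_erase]
    ring
  rw [h1, bernoulliMean_add, bernoulliMean_add, bernoulliMean_add, bernoulliMean_sum,
    bernoulliMean_sum, bernoulliMean_const, bernoulliMean_const_mul, bernoulliMean_pow E F hF]
  have h3 : ∀ e ∈ F, bernoulliMean E p (fun S => (1 - (0 : ℝ) ^ #(S ∩ {e}))) = p := by
    intro e he
    rw [bernoulliMean_sub, bernoulliMean_const, bernoulliMean_pow E _
      (Finset.singleton_subset_iff.2 (hF he))]
    simp
  have h4 : ∀ e ∈ F, bernoulliMean E p (fun S => (0 : ℝ) ^ #(S ∩ F.erase e)) =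
      (1 - p) ^ (#F - 1) := by
    intro e he
    rw [bernoulliMean_pow E _ ((Finset.erase_subset _ _).trans hF), Finset.card_erase_of_mem he]
    simp
  rw [Finset.sum_congr rfl h3, Finset.sum_congr rfl h4, Finset.sum_const, Finset.sum_const,
    nsmul_eq_mul, nsmul_eq_mul]
  rcases Nat.eq_zero_or_pos (#F) with h | h
  · simp [h]
  · obtain ⟨m, hm⟩ : ∃ m, #F = m + 1 := ⟨#F - 1, by omega⟩
    rw [hm, Nat.add_sub_cancel]
    ring

/-- The limiting mean excess of a degree, as a function of the mean degree. -/
theorem sub_two_add_mul_exp_neg_le {x : ℝ} (hx1 : x ≤ 1.1) :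
    x - 2 + (2 + x) * Real.exp (-x) ≤ 0.1325 := by
  have hd : ∀ x : ℝ, HasDerivAt (fun x : ℝ => x - 2 + (2 + x) * Real.exp (-x))
      (1 - (1 + x) * Real.exp (-x)) x := by
    intro x
    have h1 := ((hasDerivAt_id x).sub_const 2).add
      (((hasDerivAt_id x).const_add 2).mul (hasDerivAt_neg x).exp)
    refine h1.congr_deriv ?_
    simp only [id]
    ring
  have hmono : Monotone (fun x : ℝ => x - 2 + (2 + x) * Real.exp (-x)) := by
    apply monotone_of_deriv_nonneg (fun x => (hd x).differentiableAt)
    intro x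
    rw [(hd x).deriv, Real.exp_neg, sub_nonneg, ← div_eq_mul_inv, div_le_one (Real.exp_pos _)]
    linarith [Real.add_one_le_exp x]
  refine (hmono hx1).trans ?_
  have he : (3.004 : ℝ) ≤ Real.exp 1.1 := by
    refine le_trans ?_ (Real.sum_le_exp_of_nonneg (by norm_num) 8)
    norm_num [Finset.sum_range_succ, Nat.factorial]
  have : Real.exp (-1.1) ≤ 1 / 3.004 := by
    rw [Real.exp_neg, ← one_div]
    exact one_div_le_one_div_of_le (by norm_num) he
  norm_num at this ⊢
  linarith

theorem degree_excess_le {m : ℕ} {p : ℝ} (hp : 0 ≤ p) (hp1 : p ≤ 1) (hm : m * p ≤ 1.1) :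
    m * p - 2 + 2 * (1 - p) ^ m + m * p * (1 - p) ^ (m - 1) ≤ 0.1325 + 2.2 * p := by
  have h0 : 0 ≤ 1 - p := by linarith
  have hq : 1 - p ≤ Real.exp (-p) := by linarith [Real.add_one_le_exp (-p)]
  have h1 : (1 - p) ^ m ≤ Real.exp (-(m * p)) := by
    refine (pow_le_pow_left₀ h0 hq m).trans_eq ?_
    rw [← Real.exp_nat_mul]
    ring_nf
  have hmp : 0 ≤ m * p := by positivity
  have h2 : m * p * (1 - p) ^ (m - 1) ≤ m * p * (Real.exp (-(m * p)) * Real.exp p) := by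
    rcases Nat.eq_zero_or_pos m with rfl | h
    · simp
    apply mul_le_mul_of_nonneg_left _ hmp
    refine (pow_le_pow_left₀ h0 hq (m - 1)).trans_eq ?_
    rw [← Real.exp_nat_mul, ← Real.exp_add, Nat.cast_sub h]
    push_cast
    ring_nf
  have h3 := sub_two_add_mul_exp_neg_le hm
  have h4 : Real.exp p ≤ 1 + 2 * p := by
    have := Real.abs_exp_sub_one_le (x := p) (by rwa [abs_of_nonneg hp])
    rw [abs_of_nonneg hp] at this
    linarith [(abs_le.1 this).2]
  have h5 : Real.exp (-(m * p)) ≤ 1 := Real.exp_le_one_iff.2 (by linarith)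
  have h6 : m * p * (Real.exp (-(m * p)) * Real.exp p) ≤
      m * p * Real.exp (-(m * p)) + 1.1 * (2 * p) := by
    have : m * p * (Real.exp (-(m * p)) * Real.exp p) ≤
        m * p * (Real.exp (-(m * p)) * (1 + 2 * p)) := by gcongr
    have h7 : (m * p) * Real.exp (-(m * p)) ≤ 1.1 * 1 :=
      mul_le_mul hm h5 (Real.exp_pos _).le (by norm_num)
    nlinarith
  linarith

theorem two_nine_eight_mul_card_le_degSum {W : Type*} (G : SimpleGraph W) (V' : Finset W)
    (hV : 4 ≤ #V') (h : GloballyRigid (G.induce (V' : Set W))) (D : Finset W)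
    (hD : ∀ v ∉ D, ¬ IsCyclicVertex G 1206 v) (hDV : 200 * #D ≤ #V') :
    298 * #V' ≤ 100 * degSum G V' := by
  have := degSum_lower_bound G V' hV h 600 D hD
  omega

section Excess

variable {W : Type*} [Fintype W] [DecidableEq W]

/-- The total excess of the degrees over two in the graph with edge set `S`. -/
noncomputable def excess (S : Finset (Sym2 W)) : ℝ :=
  ∑ v : W, ((#(S ∩ edgesAt v) - 2 : ℕ) : ℝ)

theorem degSum_le_excess (S : Finset (Sym2 W)) (X : Finset W) :
    (degSum (SimpleGraph.fromEdgeSet (S : Set (Sym2 W))) X : ℝ) ≤ 2 * #X + excess S := by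
  have h := degSum_le_sum_deg_sub_two (SimpleGraph.fromEdgeSet (S : Set (Sym2 W))) X
  simp only [deg_fromEdgeSet] at h
  unfold excess
  exact_mod_cast h

theorem abs_excess_insert_sub_le (S : Finset (Sym2 W)) (e : Sym2 W) :
    |excess (insert e S) - excess S| ≤ 2 := by
  unfold excess
  rw [← Finset.sum_sub_distrib]
  have key : ∀ v : W, |((#(insert e S ∩ edgesAt v) - 2 : ℕ) : ℝ) -
      ((#(S ∩ edgesAt v) - 2 : ℕ) : ℝ)| ≤ if v ∈ e then 1 else 0 := by
    intro v
    by_cases hv : v ∈ e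
    · rw [if_pos hv]
      have h1 : #(S ∩ edgesAt v) ≤ #(insert e S ∩ edgesAt v) :=
        Finset.card_le_card (Finset.inter_subset_inter_right (Finset.subset_insert _ _))
      have h2 : #(insert e S ∩ edgesAt v) ≤ #(S ∩ edgesAt v) + 1 := by
        refine le_trans (Finset.card_le_card ?_) (Finset.card_insert_le e _)
        intro x hx
        simp only [mem_inter, mem_insert] at hx ⊢
        tauto
      rw [abs_le]
      constructor
      · have : #(S ∩ edgesAt v) - 2 ≤ (#(insert e S ∩ edgesAt v) - 2) + 1 := by omega
        have : ((#(S ∩ edgesAt v) - 2 : ℕ) : ℝ) ≤ ((#(insert e S ∩ edgesAt v) - 2 : ℕ) : ℝ) + 1 :=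
          by exact_mod_cast this
        linarith
      · have : #(insert e S ∩ edgesAt v) - 2 ≤ (#(S ∩ edgesAt v) - 2) + 1 := by omega
        have : ((#(insert e S ∩ edgesAt v) - 2 : ℕ) : ℝ) ≤ ((#(S ∩ edgesAt v) - 2 : ℕ) : ℝ) + 1 :=
          by exact_mod_cast this
        linarith
    · rw [if_neg hv, Finset.insert_inter_of_notMem]
      · simp
      · simp [edgesAt, hv]
  refine (Finset.abs_sum_le_sum_abs _ _).trans ((Finset.sum_le_sum fun v _ => key v).trans ?_)
  rw [Finset.sum_boole]
  induction e with | _ x y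
  have : #{v : W | v ∈ s(x, y)} ≤ #({x, y} : Finset W) := by
    apply Finset.card_le_card
    intro v
    simp
  have := this.trans Finset.card_le_two
  exact_mod_cast this

theorem bernoulliMean_excess_le {n : ℕ} {p : ℝ} (hp : 0 ≤ p) (hp1 : p ≤ 1)
    (hnp : n * p ≤ 1.1) :
    bernoulliMean (edgesIn (univ : Finset (Fin n))) p excess ≤ n * (0.1325 + 2.2 * p) := by
  have hm : ((n - 1 : ℕ) : ℝ) * p ≤ 1.1 := by
    refine le_trans ?_ hnp
    gcongr
    omega
  have h1 : bernoulliMean (edgesIn (univ : Finset (Fin n))) p excess = ∑ v : Fin n,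
      bernoulliMean (edgesIn (univ : Finset (Fin n))) p
        (fun S => ((#(S ∩ edgesAt v) - 2 : ℕ) : ℝ)) := bernoulliMean_sum _ _ _ _
  rw [h1]
  refine (Finset.sum_le_card_nsmul univ _ (0.1325 + 2.2 * p) fun v _ => ?_).trans_eq ?_
  · rw [bernoulliMean_card_sub_two _ (edgesAt v) (Finset.filter_subset _ _), card_edgesAt,
      Fintype.card_fin]
    exact degree_excess_le hp hp1 hm
  · simp only [Finset.card_univ, Fintype.card_fin, nsmul_eq_mul]

end Excess

section FirstMoment

theorem one_sub_add_mul_pow_choose_le {n : ℕ} {p y : ℝ} (hn : 0 < n) (hp : 0 ≤ p)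
    (hnp : n * p ≤ 1.1) (hy : 1 ≤ y) (k : ℕ) :
    (1 - p + p * y) ^ k.choose 2 ≤ Real.exp (0.55 * (y - 1) * k ^ 2 / n) := by
  have hn' : (0 : ℝ) < n := by exact_mod_cast hn
  have h0 : 0 ≤ 1 - p + p * y := by nlinarith
  have h1 : 1 - p + p * y ≤ Real.exp (p * (y - 1)) := by
    linarith [Real.add_one_le_exp (p * (y - 1))]
  refine (pow_le_pow_left₀ h0 h1 _).trans ?_
  rw [← Real.exp_nat_mul, Real.exp_le_exp, le_div_iff₀ hn']
  have h2 : ((k.choose 2 : ℕ) : ℝ) ≤ k ^ 2 / 2 := by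
    rw [Nat.cast_choose_two]
    nlinarith [(Nat.cast_nonneg k : (0 : ℝ) ≤ k)]
  have hy' : 0 ≤ y - 1 := by linarith
  calc (k.choose 2 : ℝ) * (p * (y - 1)) * n = (k.choose 2 : ℝ) * ((y - 1) * (n * p)) := by ring
    _ ≤ (k ^ 2 / 2) * ((y - 1) * 1.1) := by gcongr
    _ = 0.55 * (y - 1) * k ^ 2 := by ring

theorem choose_le_exp {n k : ℕ} (hn : 0 < n) (hk : 0 < k) :
    (n.choose k : ℝ) ≤ Real.exp (k * (1 + Real.log (n / k))) := by
  have hn' : (0 : ℝ) < n := by exact_mod_cast hn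
  have hk' : (0 : ℝ) < k := by exact_mod_cast hk
  have h1 : Real.exp (k * (1 + Real.log (n / k))) = Real.exp k * (n / k) ^ k := by
    rw [mul_add, mul_one, Real.exp_add, Real.exp_nat_mul, Real.exp_log (by positivity)]
  rw [h1]
  refine (Nat.choose_le_pow_div k n).trans ?_
  calc (n : ℝ) ^ k / k.factorial = (k : ℝ) ^ k / k.factorial * (n / k) ^ k := by
        rw [div_pow]
        field_simp
    _ ≤ _ := by
        gcongr
        exact Real.pow_div_factorial_le_exp _ hk'.le k

/-- The exponentially weighted number of `k`-sets of vertices, where the weight exceeds one as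
soon as the set spans at least `r * k` edges. -/
noncomputable def denseCount {W : Type*} [Fintype W] [DecidableEq W] (r : ℝ) (k : ℕ)
    (S : Finset (Sym2 W)) : ℝ :=
  ∑ X ∈ powersetCard k (univ : Finset W),
    Real.exp ((1 + Real.log (Fintype.card W / k)) * (#(S ∩ edgesIn X) - r * k))

theorem denseCount_nonneg {W : Type*} [Fintype W] [DecidableEq W] (r : ℝ) (k : ℕ)
    (S : Finset (Sym2 W)) :
    0 ≤ denseCount r k S := Finset.sum_nonneg fun _ _ => (Real.exp_pos _).le

theorem one_le_denseCount {W : Type*} [Fintype W] [DecidableEq W] {r : ℝ} {S : Finset (Sym2 W)}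
    {X : Finset W} (hX : 0 < #X) (h : r * #X ≤ #(S ∩ edgesIn X)) :
    1 ≤ denseCount r (#X) S := by
  have hX' : (0 : ℝ) < #X := by exact_mod_cast hX
  have h1 : 0 ≤ Real.log (Fintype.card W / #X) := by
    apply Real.log_nonneg
    rw [one_le_div hX']
    exact_mod_cast Finset.card_le_univ X
  refine le_trans ?_ (Finset.single_le_sum (fun _ _ => (Real.exp_pos _).le)
    (mem_powersetCard.2 ⟨subset_univ X, rfl⟩))
  rw [Real.one_le_exp_iff]
  apply mul_nonneg (by linarith)
  exact sub_nonneg.2 h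

theorem bernoulliMean_denseCount_le {n k : ℕ} {p : ℝ} (r : ℝ) (hk : 0 < k) (hkn : k ≤ n)
    (hp : 0 ≤ p) (hnp : n * p ≤ 1.1) :
    bernoulliMean (edgesIn (univ : Finset (Fin n))) p (denseCount r k) ≤
      Real.exp (k * (1 + Real.log (n / k) + 0.55 * (Real.exp 1 - k / n) -
        r * (1 + Real.log (n / k)))) := by
  have hn : 0 < n := by omega
  have hn' : (0 : ℝ) < n := by exact_mod_cast hn
  have hk' : (0 : ℝ) < k := by exact_mod_cast hk
  set L := Real.log (n / k) with hL
  have hL0 : 0 ≤ L := by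
    apply Real.log_nonneg
    rw [one_le_div hk']
    exact_mod_cast hkn
  have hyL : Real.exp (1 + L) = Real.exp 1 * (n / k) := by
    rw [Real.exp_add, Real.exp_log (by positivity)]
  have h1 : denseCount (W := Fin n) r k = fun S => ∑ X ∈ powersetCard k (univ : Finset (Fin n)),
      Real.exp (-(r * k * (1 + L))) * Real.exp (1 + L) ^ #(S ∩ edgesIn X) := by
    funext S
    unfold denseCount
    apply Finset.sum_congr rfl
    intro X _
    rw [Fintype.card_fin, ← Real.exp_nat_mul, ← Real.exp_add]
    congr 1
    ring
  rw [h1, bernoulliMean_sum]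
  have h2 : ∀ X ∈ powersetCard k (univ : Finset (Fin n)),
      bernoulliMean (edgesIn (univ : Finset (Fin n))) p
        (fun S => Real.exp (-(r * k * (1 + L))) * Real.exp (1 + L) ^ #(S ∩ edgesIn X)) ≤
      Real.exp (-(r * k * (1 + L))) * Real.exp (0.55 * (Real.exp (1 + L) - 1) * k ^ 2 / n) := by
    intro X hX
    rw [bernoulliMean_const_mul, bernoulliMean_pow _ _ (edgesIn_subset_edgesIn (subset_univ X)),
      card_edgesIn, (mem_powersetCard.1 hX).2]
    gcongr
    exact one_sub_add_mul_pow_choose_le hn hp hnp (Real.one_le_exp (by linarith)) k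
  refine (Finset.sum_le_card_nsmul _ _ _ h2).trans ?_
  rw [card_powersetCard, Finset.card_univ, Fintype.card_fin, nsmul_eq_mul]
  refine (mul_le_mul_of_nonneg_right (choose_le_exp hn hk) (by positivity)).trans_eq ?_
  rw [← Real.exp_add, ← Real.exp_add, hyL]
  congr 1
  field_simp
  ring

theorem log_fifty_div_seven_ge : (1.96 : ℝ) ≤ Real.log (50 / 7) := by
  have h : Real.exp 49 ≤ (50 / 7 : ℝ) ^ 25 := by
    have : Real.exp 49 = Real.exp 1 ^ 49 := by
      rw [← Real.exp_nat_mul]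
      norm_num
    rw [this]
    refine (pow_le_pow_left₀ (Real.exp_pos _).le Real.exp_one_lt_d9.le 49).trans ?_
    norm_num
  have h2 := (Real.le_log_iff_exp_le (by positivity)).2 h
  rw [Real.log_pow] at h2
  push_cast at h2
  linarith

theorem bernoulliMean_denseCount_small {n k : ℕ} {p : ℝ} (hk : 0 < k) (hkn : k ≤ n)
    (hp : 0 ≤ p) (hnp : n * p ≤ 1.1) (hk2 : (k : ℝ) ≤ Real.exp (-12) * n) :
    bernoulliMean (edgesIn (univ : Finset (Fin n))) p (denseCount 1.2 k) ≤ Real.exp (-k) := by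
  refine (bernoulliMean_denseCount_le 1.2 hk hkn hp hnp).trans (Real.exp_le_exp.2 ?_)
  have hn' : (0 : ℝ) < n := by exact_mod_cast (by omega : 0 < n)
  have hk' : (0 : ℝ) < k := by exact_mod_cast hk
  have hL : 12 ≤ Real.log (n / k) := by
    rw [Real.le_log_iff_exp_le (by positivity), le_div_iff₀ hk']
    calc Real.exp 12 * k ≤ Real.exp 12 * (Real.exp (-12) * n) := by gcongr
      _ = n := by rw [← mul_assoc, ← Real.exp_add]; simp
  have he := Real.exp_one_lt_d9
  have : 0 ≤ (k : ℝ) / n := by positivity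
  rw [← mul_neg_one]
  gcongr
  linarith

theorem bernoulliMean_denseCount_large {n k : ℕ} {p : ℝ} (hk : 0 < k) (hkn : k ≤ n)
    (hp : 0 ≤ p) (hnp : n * p ≤ 1.1) (hk2 : (k : ℝ) ≤ 0.14 * n) :
    bernoulliMean (edgesIn (univ : Finset (Fin n))) p (denseCount 1.49 k) ≤
      Real.exp (-(0.03 * k)) := by
  refine (bernoulliMean_denseCount_le 1.49 hk hkn hp hnp).trans (Real.exp_le_exp.2 ?_)
  have hn' : (0 : ℝ) < n := by exact_mod_cast (by omega : 0 < n)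
  have hk' : (0 : ℝ) < k := by exact_mod_cast hk
  have hx : (k : ℝ) / n ≤ 0.14 := by rwa [div_le_iff₀ hn']
  have hL : 1.96 + 1 - (k / n) * (50 / 7) ≤ Real.log (n / k) := by
    have h1 := Real.log_le_sub_one_of_pos (x := (k / n : ℝ) * (50 / 7)) (by positivity)
    rw [Real.log_mul (by positivity) (by positivity)] at h1
    have h2 : Real.log (n / k) = -Real.log (k / n) := by rw [← Real.log_inv, inv_div]
    rw [h2]
    have := log_fifty_div_seven_ge
    linarith
  have he := Real.exp_one_lt_d9
  have : -(0.03 * (k : ℝ)) = k * (-0.03) := by ring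
  rw [this]
  gcongr
  linarith

end FirstMoment

section Combination

/-- The weighted number of vertices, counted with the sets of at most `M` vertices that contain
them and span at least as many edges as vertices. -/
noncomputable def cyclicCount {W : Type*} [Fintype W] [DecidableEq W] (M : ℕ)
    (S : Finset (Sym2 W)) : ℝ :=
  ∑ m ∈ Icc 1 M, ∑ X ∈ powersetCard m (univ : Finset W),
    m / (Fintype.card W : ℝ) ^ m * (Fintype.card W : ℝ) ^ #(S ∩ edgesIn X)

theorem cyclicCount_nonneg {W : Type*} [Fintype W] [DecidableEq W] (M : ℕ)
    (S : Finset (Sym2 W)) : 0 ≤ cyclicCount M S :=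
  Finset.sum_nonneg fun _ _ => Finset.sum_nonneg fun _ _ => by positivity

theorem exists_card_le_cyclicCount {W : Type*} [Fintype W] [DecidableEq W] (M : ℕ)
    (S : Finset (Sym2 W)) : ∃ D : Finset W, (#D : ℝ) ≤ cyclicCount M S ∧
      ∀ v ∉ D, ¬ IsCyclicVertex (SimpleGraph.fromEdgeSet (S : Set (Sym2 W))) M v := by
  refine ⟨(Icc 1 M).biUnion fun m =>
    {X ∈ powersetCard m (univ : Finset W) | m ≤ #(S ∩ edgesIn X)}.biUnion id, ?_, ?_⟩
  · have h1 : ∀ m ∈ Icc 1 M,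
        (#({X ∈ powersetCard m (univ : Finset W) | m ≤ #(S ∩ edgesIn X)}.biUnion id) : ℝ) ≤
        ∑ X ∈ powersetCard m (univ : Finset W),
          m / (Fintype.card W : ℝ) ^ m * (Fintype.card W : ℝ) ^ #(S ∩ edgesIn X) := by
      intro m hm
      have h2 : #({X ∈ powersetCard m (univ : Finset W) | m ≤ #(S ∩ edgesIn X)}.biUnion id) ≤
          ∑ X ∈ {X ∈ powersetCard m (univ : Finset W) | m ≤ #(S ∩ edgesIn X)}, #X :=
        Finset.card_biUnion_le
      have h3 : (#({X ∈ powersetCard m (univ : Finset W) |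
          m ≤ #(S ∩ edgesIn X)}.biUnion id) : ℝ) ≤
          ∑ X ∈ {X ∈ powersetCard m (univ : Finset W) | m ≤ #(S ∩ edgesIn X)}, (#X : ℝ) := by
        exact_mod_cast h2
      refine h3.trans ?_
      rw [Finset.sum_filter]
      apply Finset.sum_le_sum
      intro X hX
      have hXm := (mem_powersetCard.1 hX).2
      split_ifs with hd
      · have hm1 := (mem_Icc.1 hm).1
        have hW : (1 : ℝ) ≤ Fintype.card W := by
          have := Finset.card_le_univ X
          exact_mod_cast (by omega : 1 ≤ Fintype.card W)
        rw [hXm, div_mul_eq_mul_div, le_div_iff₀ (by positivity)]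
        gcongr
      · positivity
    refine le_trans ?_ (Finset.sum_le_sum h1)
    exact_mod_cast Finset.card_biUnion_le
  · rintro v hv ⟨X, hvX, hXM, hd⟩
    rw [degSum_fromEdgeSet] at hd
    apply hv
    simp only [mem_biUnion, mem_Icc, mem_filter, mem_powersetCard_univ, id]
    exact ⟨#X, ⟨Finset.card_pos.2 ⟨v, hvX⟩, hXM⟩, X, ⟨rfl, by omega⟩, hvX⟩

theorem bernoulliMean_cyclicCount_le {n : ℕ} {p : ℝ} (hn : 0 < n) (hp : 0 ≤ p)
    (hnp : n * p ≤ 1.1) (M : ℕ) :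
    bernoulliMean (edgesIn (univ : Finset (Fin n))) p (cyclicCount M) ≤
      ∑ m ∈ Icc 1 M, m * Real.exp (0.55 * m ^ 2) := by
  have hn' : (1 : ℝ) ≤ n := by exact_mod_cast hn
  have h1 : cyclicCount (W := Fin n) M = fun S => ∑ m ∈ Icc 1 M,
      ∑ X ∈ powersetCard m (univ : Finset (Fin n)),
        m / (n : ℝ) ^ m * (n : ℝ) ^ #(S ∩ edgesIn X) := by
    funext S
    simp only [cyclicCount, Fintype.card_fin]
  rw [h1, bernoulliMean_sum]
  apply Finset.sum_le_sum
  intro m _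
  rw [bernoulliMean_sum]
  have h2 : ∀ X ∈ powersetCard m (univ : Finset (Fin n)),
      bernoulliMean (edgesIn (univ : Finset (Fin n))) p
        (fun S => m / (n : ℝ) ^ m * (n : ℝ) ^ #(S ∩ edgesIn X)) ≤
      m / (n : ℝ) ^ m * Real.exp (0.55 * m ^ 2) := by
    intro X hX
    rw [bernoulliMean_const_mul, bernoulliMean_pow _ _ (edgesIn_subset_edgesIn (subset_univ X)),
      card_edgesIn, (mem_powersetCard.1 hX).2]
    gcongr
    refine (one_sub_add_mul_pow_choose_le hn hp hnp hn' m).trans (Real.exp_le_exp.2 ?_)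
    rw [div_le_iff₀ (by linarith)]
    nlinarith [sq_nonneg (m : ℝ)]
  refine (Finset.sum_le_card_nsmul _ _ _ h2).trans ?_
  rw [card_powersetCard, Finset.card_univ, Fintype.card_fin, nsmul_eq_mul]
  have h3 : (n.choose m : ℝ) ≤ (n : ℝ) ^ m := by exact_mod_cast Nat.choose_le_pow n m
  calc (n.choose m : ℝ) * (m / (n : ℝ) ^ m * Real.exp (0.55 * m ^ 2))
      ≤ (n : ℝ) ^ m * (m / (n : ℝ) ^ m * Real.exp (0.55 * m ^ 2)) := by gcongr
    _ = m * Real.exp (0.55 * m ^ 2) := by field_simp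

/-- The relevant sizes of a rigid set of vertices. -/
noncomputable def sizes (n : ℕ) : Finset ℕ :=
  {k ∈ range (n + 1) | 2 * Real.log n ≤ k ∧ (k : ℝ) ≤ 0.14 * n}

/-- The number of edges per vertex forced by rigidity in a set of `k` vertices. -/
noncomputable def edgeRatio (n k : ℕ) : ℝ := if (k : ℝ) ≤ Real.exp (-12) * n then 1.2 else 1.49

open Classical in
theorem one_le_sum_bad_events {n : ℕ} (hn : 4 ≤ 2 * Real.log n) {μ : ℝ} (hμ : μ ≤ 0.133 * n)
    (S : Finset (Sym2 (Fin n))) :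
    1 ≤ (if ∀ V' : Finset (Fin n), 2 * Real.log n ≤ V'.card →
          ¬ GloballyRigid ((SimpleGraph.fromEdgeSet (S : Set (Sym2 (Fin n)))).induce
            (V' : Set (Fin n))) then (1 : ℝ) else 0) +
      ∑ k ∈ sizes n, denseCount (edgeRatio n k) k S +
      1 / (0.004 * n) ^ 2 * (excess S - μ) ^ 2 +
      1 / (0.005 * Real.exp (-12) * n) * cyclicCount 1206 S := by
  set G := SimpleGraph.fromEdgeSet (S : Set (Sym2 (Fin n))) with hG
  have hn0 : 0 < n := by
    rcases Nat.eq_zero_or_pos n with rfl | h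
    · norm_num at hn
    · exact h
  have hn' : (0 : ℝ) < n := by exact_mod_cast hn0
  have he : (0 : ℝ) < Real.exp (-12) := Real.exp_pos _
  have he2 : Real.exp (-12) ≤ 0.14 := by
    rw [Real.exp_neg, inv_le_comm₀ (Real.exp_pos _) (by norm_num)]
    linarith [Real.add_one_le_exp (12 : ℝ)]
  have hA : 0 ≤ ∑ k ∈ sizes n, denseCount (edgeRatio n k) k S :=
    Finset.sum_nonneg fun _ _ => denseCount_nonneg _ _ _
  have hB : 0 ≤ 1 / (0.004 * (n : ℝ)) ^ 2 * (excess S - μ) ^ 2 := by positivity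
  have hC : 0 ≤ 1 / (0.005 * Real.exp (-12) * n) * cyclicCount 1206 S :=
    mul_nonneg (by positivity) (cyclicCount_nonneg _ _)
  split_ifs with hP
  · linarith
  push Not at hP
  obtain ⟨V', hV, hrig⟩ := hP
  have hk4 : 4 ≤ #V' := by exact_mod_cast hn.trans hV
  have hcard : #V' ≤ n := by simpa using Finset.card_le_univ V'
  rcases le_or_gt (0.005 * Real.exp (-12) * n) (cyclicCount 1206 S) with hc | hc
  · have : 1 ≤ 1 / (0.005 * Real.exp (-12) * n) * cyclicCount 1206 S := by
      rw [one_div, ← div_eq_inv_mul, one_le_div (by positivity)]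
      exact hc
    linarith
  rcases le_or_gt (0.004 * (n : ℝ)) (excess S - μ) with hq | hq
  · have : 1 ≤ 1 / (0.004 * (n : ℝ)) ^ 2 * (excess S - μ) ^ 2 := by
      rw [one_div, ← div_eq_inv_mul, one_le_div (by positivity)]
      gcongr
    linarith
  have hsuff : (#V' : ℝ) ≤ 0.14 * n → edgeRatio n (#V') * #V' ≤ #(S ∩ edgesIn V') →
      1 ≤ ∑ k ∈ sizes n, denseCount (edgeRatio n k) k S := by
    intro h1 h2
    refine (one_le_denseCount (by omega) h2).trans (Finset.single_le_sum (f := fun k =>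
      denseCount (edgeRatio n k) k S) (fun _ _ => denseCount_nonneg _ _ _) ?_)
    simp only [sizes, mem_filter, mem_range]
    exact ⟨by omega, hV, h1⟩
  suffices h : 1 ≤ ∑ k ∈ sizes n, denseCount (edgeRatio n k) k S by linarith
  rcases le_or_gt (#V' : ℝ) (Real.exp (-12) * n) with hk | hk
  · apply hsuff
    · refine hk.trans ?_
      gcongr
    · have h1 := card_mul_le_degSum G V' hk4 hrig
      rw [hG, degSum_fromEdgeSet] at h1
      have h2 : (12 * #V' : ℝ) ≤ 5 * (2 * #(S ∩ edgesIn V')) := by exact_mod_cast h1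
      rw [edgeRatio, if_pos hk]
      linarith
  · obtain ⟨D, hD, hDv⟩ := exists_card_le_cyclicCount 1206 S
    have h200 : 200 * #D ≤ #V' := by
      have : (200 * #D : ℝ) ≤ #V' := by linarith
      exact_mod_cast this
    have h1 := two_nine_eight_mul_card_le_degSum G V' hk4 hrig D hDv h200
    have h2 := degSum_le_excess S V'
    rw [hG] at h1
    have h3 : (298 * #V' : ℝ) ≤
      100 * (degSum (SimpleGraph.fromEdgeSet (S : Set (Sym2 (Fin n)))) V' : ℝ) := by
      exact_mod_cast h1
    apply hsuff
    · linarith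
    · rw [degSum_fromEdgeSet] at h3
      push_cast at h3
      rw [edgeRatio, if_neg hk.not_ge]
      linarith

/-- The error term of the probability bound. -/
noncomputable def errorTerm (C : ℝ) (n : ℕ) : ℝ :=
  (n + 1) * (1 / (n : ℝ) ^ 2 + Real.exp (-(0.03 * Real.exp (-12) * n))) +
    1 / (0.004 * n) ^ 2 * (2.2 * n) + 1 / (0.005 * Real.exp (-12) * n) * C

theorem sum_bernoulliMean_denseCount_le {n : ℕ} {p : ℝ} (hn : 4 ≤ 2 * Real.log n) (hp : 0 ≤ p)
    (hnp : n * p ≤ 1.1) :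
    ∑ k ∈ sizes n, bernoulliMean (edgesIn (univ : Finset (Fin n))) p
        (denseCount (edgeRatio n k) k) ≤
      (n + 1) * (1 / (n : ℝ) ^ 2 + Real.exp (-(0.03 * Real.exp (-12) * n))) := by
  have hn0 : 0 < n := by
    rcases Nat.eq_zero_or_pos n with rfl | h
    · norm_num at hn
    · exact h
  have hn' : (0 : ℝ) < n := by exact_mod_cast hn0
  have h : ∀ k ∈ sizes n, bernoulliMean (edgesIn (univ : Finset (Fin n))) p
      (denseCount (edgeRatio n k) k) ≤
      1 / (n : ℝ) ^ 2 + Real.exp (-(0.03 * Real.exp (-12) * n)) := by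
    intro k hk
    simp only [sizes, mem_filter, mem_range] at hk
    obtain ⟨hkn, hk1, hk2⟩ := hk
    have hk0 : 0 < k := by
      have : (4 : ℝ) ≤ k := hn.trans hk1
      have : 4 ≤ k := by exact_mod_cast this
      omega
    unfold edgeRatio
    split_ifs with hs
    · refine (bernoulliMean_denseCount_small hk0 (by omega) hp hnp hs).trans ?_
      refine le_trans ?_ (le_add_of_nonneg_right (Real.exp_pos _).le)
      have h2 : 1 / (n : ℝ) ^ 2 = Real.exp (-(2 * Real.log n)) := by
        rw [Real.exp_neg, mul_comm, Real.exp_mul, Real.exp_log hn', one_div]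
        norm_cast
      rw [h2]
      gcongr
    · refine (bernoulliMean_denseCount_large hk0 (by omega) hp hnp hk2).trans ?_
      refine le_trans ?_ (le_add_of_nonneg_left (by positivity))
      rw [mul_assoc]
      gcongr
      exact (not_le.1 hs).le
  refine (Finset.sum_le_card_nsmul _ _ _ h).trans ?_
  rw [nsmul_eq_mul]
  gcongr
  have : #(sizes n) ≤ n + 1 := (Finset.card_filter_le _ _).trans_eq (card_range _)
  exact_mod_cast this

theorem one_sub_errorTerm_le_erProb {n : ℕ} {p : ℝ} (hn : 4 ≤ 2 * Real.log n) (hn2 : 4840 ≤ n)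
    (hp : 0 ≤ p) (hnp : n * p ≤ 1.1) :
    1 - errorTerm (∑ m ∈ Icc (1 : ℕ) 1206, m * Real.exp (0.55 * m ^ 2)) n ≤
      erProb n p (fun G => ∀ V' : Finset (Fin n), 2 * Real.log n ≤ V'.card →
          ¬ GloballyRigid (G.induce (V' : Set (Fin n)))) := by
  classical
  rw [erProb_eq_bernoulliMean]
  have hn' : (4840 : ℝ) ≤ n := by exact_mod_cast hn2
  have hp2 : 2.2 * p ≤ 0.0005 := by nlinarith
  have hp1 : p ≤ 1 := by linarith
  set E := edgesIn (univ : Finset (Fin n))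
  set μ := bernoulliMean E p excess
  have hμ : μ ≤ 0.133 * n := by
    refine (bernoulliMean_excess_le hp hp1 hnp).trans ?_
    rw [mul_comm]
    gcongr
    linarith
  have key := bernoulliMean_mono E hp hp1 fun S _ => one_le_sum_bad_events hn hμ S
  rw [bernoulliMean_const, bernoulliMean_add, bernoulliMean_add, bernoulliMean_add,
    bernoulliMean_sum, bernoulliMean_const_mul, bernoulliMean_const_mul] at key
  have h1 := sum_bernoulliMean_denseCount_le hn hp hnp
  have h2 : bernoulliMean E p (fun S => (excess S - μ) ^ 2) ≤ 2.2 * n := by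
    refine (bernoulliMean_sq_le p 2 hp hp1 E (fun S => excess S - μ) ?_).trans ?_
    · intro e _ S _ _
      rw [sub_sub_sub_cancel_right]
      exact abs_excess_insert_sub_le S e
    · have h3 : bernoulliMean E p (fun S => excess S - μ) = 0 := by
        rw [bernoulliMean_sub, bernoulliMean_const, sub_self]
      rw [h3, card_edgesIn, Finset.card_univ, Fintype.card_fin, Nat.cast_choose_two]
      have h4 : n * (n * p) ≤ n * 1.1 := by gcongr
      nlinarith
  have h3 := bernoulliMean_cyclicCount_le (by omega) hp hnp 1206
  have h4 : 1 / (0.004 * (n : ℝ)) ^ 2 * bernoulliMean E p (fun S => (excess S - μ) ^ 2) ≤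
      1 / (0.004 * (n : ℝ)) ^ 2 * (2.2 * n) := by gcongr
  have h5 : 1 / (0.005 * Real.exp (-12) * n) * bernoulliMean E p (cyclicCount 1206) ≤
      1 / (0.005 * Real.exp (-12) * n) * ∑ m ∈ Icc (1 : ℕ) 1206, m * Real.exp (0.55 * m ^ 2) := by
    gcongr
  unfold errorTerm
  linarith

theorem tendsto_errorTerm (C : ℝ) :
    Filter.Tendsto (errorTerm C) Filter.atTop (nhds 0) := by
  have hc : (0 : ℝ) < Real.exp (-12) := Real.exp_pos _
  set c := 0.03 * Real.exp (-12) with hcd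
  have hc : 0 < c := by positivity
  have h0 : Filter.Tendsto (fun n : ℕ => (n : ℝ)) Filter.atTop Filter.atTop :=
    tendsto_natCast_atTop_atTop
  have hinv : Filter.Tendsto (fun n : ℕ => ((n : ℝ))⁻¹) Filter.atTop (nhds 0) :=
    tendsto_inv_atTop_zero.comp h0
  have he : Filter.Tendsto (fun n : ℕ => Real.exp (-(c * n))) Filter.atTop (nhds 0) :=
    Real.tendsto_exp_neg_atTop_nhds_zero.comp (h0.const_mul_atTop hc)
  have hne : Filter.Tendsto (fun n : ℕ => c * n * Real.exp (-(c * n))) Filter.atTop (nhds 0) := by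
    have := (Real.tendsto_pow_mul_exp_neg_atTop_nhds_zero 1).comp (h0.const_mul_atTop hc)
    simpa [Function.comp_def] using this
  have hlim := ((((hinv.add (hinv.mul hinv)).add (hne.const_mul c⁻¹)).add he).add
    (hinv.const_mul 137500)).add (hinv.const_mul (C / (0.005 * Real.exp (-12))))
  simp only [mul_zero, add_zero] at hlim
  refine hlim.congr' ?_
  filter_upwards [Filter.eventually_gt_atTop 0] with n hn
  have hn' : (0 : ℝ) < n := by exact_mod_cast hn
  unfold errorTerm
  rw [← hcd]
  field_simp
  ring

end Combination

theorem stmt4 : ∃ γ : ℝ, 0 < γ ∧ ∀ δ : ℝ, 0 < δ → ∃ N : ℕ,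
    ∀ n : ℕ, N ≤ n → ∀ p : ℝ, 0 ≤ p → p ≤ 1.1 / n →
      1 - δ ≤ erProb n p (fun G =>
        ∀ V' : Finset (Fin n), γ * Real.log n ≤ V'.card →
          ¬ GloballyRigid (G.induce (V' : Set (Fin n)))) := by
  refine ⟨2, by norm_num, fun δ hδ => ?_⟩
  have h1 := (tendsto_errorTerm
    (∑ m ∈ Icc (1 : ℕ) 1206, m * Real.exp (0.55 * m ^ 2))).eventually_lt_const hδ
  have h2 := (Real.tendsto_log_atTop.comp tendsto_natCast_atTop_atTop).eventually_ge_atTop 2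
  obtain ⟨N, hN⟩ := Filter.eventually_atTop.1
    (h1.and (h2.and (Filter.eventually_ge_atTop 4840)))
  refine ⟨N, fun n hn p hp hpn => ?_⟩
  obtain ⟨hδn, hlog, hn2⟩ := hN n hn
  have hn' : (0 : ℝ) < n := by exact_mod_cast (by omega : 0 < n)
  rw [le_div_iff₀ hn', mul_comm] at hpn
  have hlog' : 2 ≤ Real.log n := hlog
  have := one_sub_errorTerm_le_erProb (by linarith) hn2 hp hpn
  linarith
end

section
/- For every ε > 0 there exists C > 0 such that for every δ > 0 there exists N such that for all n ≥ N and every integer m with C·n ≤ m ≤ n(n−1)/2: among all simple graphs on Fin n with exactly m edges, the number of graphs G satisfying property (P3) — namely, for every pair of disjoint sets X, Y ⊆ Fin n with |X| ≥ ε·n and |Y| ≥ ε·n there exist x ∈ X and y ∈ Y adjacent in G — is at least (1 − δ) times the total number of simple graphs on Fin n with exactly m edges. -/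
open Classical in
/-- Graphs with `m` edges none of which lies in `F` are `m`-subsets of the remaining pairs. -/
theorem SimpleGraph.card_edgeFinset_disjoint {V : Type*} [Fintype V] [DecidableEq V] (F : Finset (Sym2 V))
    (hF : F ⊆ (⊤ : SimpleGraph V).edgeFinset) (m : ℕ) :
    (Finset.univ.filter fun G : SimpleGraph V =>
      G.edgeSet.ncard = m ∧ Disjoint G.edgeFinset F).card =
      ((Fintype.card V).choose 2 - F.card).choose m := by
  rw [← SimpleGraph.card_edgeFinset_top_eq_card_choose_two, ← Finset.card_sdiff_of_subset hF,
    ← Finset.card_powersetCard]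
  refine Finset.card_bij (fun G _ => G.edgeFinset) ?_ ?_ ?_
  · intro G hG
    obtain ⟨-, hm, hd⟩ := Finset.mem_filter.1 hG
    rw [← SimpleGraph.coe_edgeFinset, Set.ncard_coe_finset] at hm
    exact Finset.mem_powersetCard.2 ⟨Finset.subset_sdiff.2
      ⟨SimpleGraph.edgeFinset_mono le_top, hd⟩, hm⟩
  · intro G _ H _ h
    exact SimpleGraph.edgeFinset_inj.1 h
  · intro s hs
    obtain ⟨hs, hm⟩ := Finset.mem_powersetCard.1 hs
    obtain ⟨hs, hd⟩ := Finset.subset_sdiff.1 hs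
    obtain ⟨G, he⟩ : ∃ G : SimpleGraph V, G.edgeSet = s := by
      refine ⟨SimpleGraph.fromEdgeSet s, ?_⟩
      rw [SimpleGraph.edgeSet_fromEdgeSet]
      ext e
      simp only [Set.mem_sdiff, Finset.mem_coe]
      refine ⟨fun h => h.1, fun h => ⟨h, ?_⟩⟩
      have := SimpleGraph.not_isDiag_of_mem_edgeFinset (hs h)
      simpa using this
    have he' : G.edgeFinset = s := by
      apply Finset.coe_injective
      rw [SimpleGraph.coe_edgeFinset, he]
    refine ⟨G, ?_, he'⟩
    rw [Finset.mem_filter, he', he, Set.ncard_coe_finset]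
    exact ⟨Finset.mem_univ _, hm, hd⟩

theorem Nat.descFactorial_mul_pow_le {K M : ℕ} (h : K ≤ M) (m : ℕ) :
    K.descFactorial m * M ^ m ≤ M.descFactorial m * K ^ m := by
  induction m with
  | zero => simp
  | succ m ih =>
    rw [Nat.descFactorial_succ, Nat.descFactorial_succ, pow_succ, pow_succ]
    have h1 : (K - m) * M ≤ (M - m) * K := by
      rw [Nat.sub_mul, Nat.sub_mul, Nat.mul_comm M K]
      exact Nat.sub_le_sub_left (Nat.mul_le_mul_left m h) _
    calc (K - m) * K.descFactorial m * (M ^ m * M)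
        = (K - m) * M * (K.descFactorial m * M ^ m) := by ring
      _ ≤ (M - m) * K * (M.descFactorial m * K ^ m) := Nat.mul_le_mul h1 ih
      _ = _ := by ring

theorem Nat.choose_mul_pow_le {K M : ℕ} (h : K ≤ M) (m : ℕ) :
    K.choose m * M ^ m ≤ M.choose m * K ^ m := by
  have := Nat.descFactorial_mul_pow_le h m
  rw [Nat.descFactorial_eq_factorial_mul_choose, Nat.descFactorial_eq_factorial_mul_choose,
    mul_assoc, mul_assoc] at this
  exact Nat.le_of_mul_le_mul_left this m.factorial_pos

/-- Removing `k` of `M` elements shrinks the number of `m`-subsets by a factor `exp (-k m / M)`. -/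
theorem Nat.choose_sub_le_exp_mul {M k : ℕ} (hM : 0 < M) (hk : k ≤ M) (m : ℕ) :
    ((M - k).choose m : ℝ) ≤ Real.exp (-(k * m / M)) * M.choose m := by
  have hM' : (0 : ℝ) < M := by exact_mod_cast hM
  have h : ((M - k).choose m : ℝ) * (M : ℝ) ^ m ≤ M.choose m * ((M : ℝ) - k) ^ m := by
    rw [← Nat.cast_sub hk]
    exact_mod_cast Nat.choose_mul_pow_le (Nat.sub_le M k) m
  have h2 : ((M : ℝ) - k) ^ m ≤ Real.exp (-(k * m / M)) * (M : ℝ) ^ m := by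
    have h3 : (M : ℝ) - k ≤ Real.exp (-(k / M)) * M := by
      have := Real.add_one_le_exp (-((k : ℝ) / M))
      calc (M : ℝ) - k = (-((k : ℝ) / M) + 1) * M := by field_simp; ring
        _ ≤ _ := by gcongr
    have h4 : (0 : ℝ) ≤ M - k := sub_nonneg.2 (by exact_mod_cast hk)
    calc ((M : ℝ) - k) ^ m ≤ (Real.exp (-(k / M)) * M) ^ m := by gcongr
      _ = _ := by
        rw [mul_pow, ← Real.exp_nat_mul]
        congr 2
        ring
  refine le_of_mul_le_mul_right (h.trans ?_) (pow_pos hM' m)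
  calc (M.choose m : ℝ) * ((M : ℝ) - k) ^ m
      ≤ M.choose m * (Real.exp (-(k * m / M)) * (M : ℝ) ^ m) := by gcongr
    _ = _ := by ring

open Classical in
theorem SimpleGraph.card_no_edge_between_le {V : Type*} [Fintype V] [DecidableEq V] (hV : 2 ≤ Fintype.card V)
    (X Y : Finset V) (hXY : Disjoint X Y) (m : ℕ) :
    ((Finset.univ.filter fun G : SimpleGraph V =>
      G.edgeSet.ncard = m ∧ ∀ x ∈ X, ∀ y ∈ Y, ¬ G.Adj x y).card : ℝ) ≤
      Real.exp (-(X.card * Y.card * m / (Fintype.card V).choose 2)) *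
        ((Fintype.card V).choose 2).choose m := by
  set F : Finset (Sym2 V) := (X ×ˢ Y).image fun p => s(p.1, p.2) with hFdef
  have hne : ∀ x ∈ X, ∀ y ∈ Y, x ≠ y := fun x hx y hy => Finset.disjoint_iff_ne.1 hXY x hx y hy
  have hcard : F.card = X.card * Y.card := by
    rw [hFdef, Finset.card_image_of_injOn, Finset.card_product]
    rintro ⟨a, b⟩ hab ⟨c, d⟩ hcd h
    simp only [Finset.coe_product, Set.mem_prod, Finset.mem_coe] at hab hcd
    rcases Sym2.eq_iff.1 h with ⟨rfl, rfl⟩ | ⟨rfl, rfl⟩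
    · rfl
    · exact absurd rfl (hne _ hab.1 _ hcd.2)
  have hF : F ⊆ (⊤ : SimpleGraph V).edgeFinset := by
    intro e he
    obtain ⟨⟨a, b⟩, hab, rfl⟩ := Finset.mem_image.1 he
    rw [Finset.mem_product] at hab
    simpa using hne _ hab.1 _ hab.2
  have hle := Finset.card_le_card hF
  rw [SimpleGraph.card_edgeFinset_top_eq_card_choose_two] at hle
  have hsub : (Finset.univ.filter fun G : SimpleGraph V =>
      G.edgeSet.ncard = m ∧ ∀ x ∈ X, ∀ y ∈ Y, ¬ G.Adj x y) ⊆
      Finset.univ.filter fun G : SimpleGraph V =>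
        G.edgeSet.ncard = m ∧ Disjoint G.edgeFinset F := by
    intro G hG
    obtain ⟨-, hm, hG⟩ := Finset.mem_filter.1 hG
    refine Finset.mem_filter.2 ⟨Finset.mem_univ _, hm, Finset.disjoint_right.2 fun e he => ?_⟩
    obtain ⟨⟨a, b⟩, hab, rfl⟩ := Finset.mem_image.1 he
    rw [Finset.mem_product] at hab
    simpa using hG _ hab.1 _ hab.2
  have h1 := Finset.card_le_card hsub
  rw [SimpleGraph.card_edgeFinset_disjoint F hF] at h1
  refine (Nat.cast_le.2 h1).trans ?_
  have := Nat.choose_sub_le_exp_mul (Nat.choose_pos hV) hle m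
  rwa [hcard, Nat.cast_mul, ← hcard] at this

theorem stmt5 : ∀ ε : ℝ, 0 < ε → ∃ C : ℝ, 0 < C ∧ ∀ δ : ℝ, 0 < δ → ∃ N : ℕ,
    ∀ n : ℕ, N ≤ n → ∀ m : ℕ, C * n ≤ (m : ℝ) → m ≤ n * (n - 1) / 2 →
      (1 - δ) * (Nat.card {G : SimpleGraph (Fin n) // G.edgeSet.ncard = m} : ℝ) ≤
        (Nat.card {G : SimpleGraph (Fin n) // G.edgeSet.ncard = m ∧
          ∀ X Y : Finset (Fin n), Disjoint X Y →
            ε * n ≤ X.card → ε * n ≤ Y.card →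
            ∃ x ∈ X, ∃ y ∈ Y, G.Adj x y} : ℝ) := by
  classical
  intro ε hε
  refine ⟨1 / ε ^ 2, by positivity, fun δ hδ => ?_⟩
  have hr : 4 * Real.exp (-2) < 1 := by
    rw [Real.exp_neg, ← div_eq_mul_inv, div_lt_one (Real.exp_pos 2)]
    have h1 := Real.exp_one_gt_d9
    have h2 : Real.exp 2 = Real.exp 1 * Real.exp 1 := by rw [← Real.exp_add]; norm_num
    nlinarith
  obtain ⟨N, hN⟩ := exists_pow_lt_of_lt_one hδ hr
  refine ⟨max N 2, fun n hn m hm _ => ?_⟩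
  have hn2 : 2 ≤ n := (le_max_right _ _).trans hn
  have hn0 : (0 : ℝ) < n := by exact_mod_cast (by omega : 0 < n)
  have hrn : (4 * Real.exp (-2)) ^ n ≤ δ :=
    (pow_le_pow_of_le_one (by positivity) hr.le ((le_max_left _ _).trans hn)).trans hN.le
  rw [Nat.card_eq_fintype_card, Nat.card_eq_fintype_card, Fintype.card_subtype,
    Fintype.card_subtype]
  set T := Finset.univ.filter fun G : SimpleGraph (Fin n) => G.edgeSet.ncard = m with hT
  set A := Finset.univ.filter fun G : SimpleGraph (Fin n) => G.edgeSet.ncard = m ∧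
          ∀ X Y : Finset (Fin n), Disjoint X Y →
            ε * n ≤ X.card → ε * n ≤ Y.card →
            ∃ x ∈ X, ∃ y ∈ Y, G.Adj x y with hA
  have hTcard : T.card = (n.choose 2).choose m := by
    have := SimpleGraph.card_edgeFinset_disjoint (V := Fin n) ∅ (by simp) m
    simpa [hT] using this
  let P := Finset.univ.filter fun p : Finset (Fin n) × Finset (Fin n) =>
    Disjoint p.1 p.2 ∧ ε * n ≤ p.1.card ∧ ε * n ≤ p.2.card
  let B : Finset (Fin n) × Finset (Fin n) → Finset (SimpleGraph (Fin n)) := fun p =>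
    Finset.univ.filter fun G : SimpleGraph (Fin n) =>
      G.edgeSet.ncard = m ∧ ∀ x ∈ p.1, ∀ y ∈ p.2, ¬ G.Adj x y
  have hB : ∀ p ∈ P, ((B p).card : ℝ) ≤ Real.exp (-2) ^ n * T.card := by
    intro p hp
    obtain ⟨-, hd, hX, hY⟩ := Finset.mem_filter.1 hp
    have h := SimpleGraph.card_no_edge_between_le (V := Fin n) (by simpa using hn2) p.1 p.2 hd m
    rw [Fintype.card_fin] at h
    refine le_trans (le_of_eq ?_) (h.trans ?_)
    · simp only [B]
      congr!
    rw [hTcard, ← Real.exp_nat_mul]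
    gcongr
    have hM : (0 : ℝ) < n.choose 2 := by exact_mod_cast Nat.choose_pos hn2
    have hM2 : (n.choose 2 : ℝ) ≤ n ^ 2 / 2 := by
      rw [Nat.cast_choose_two]
      nlinarith
    have hprod : (ε * n) * (ε * n) * (1 / ε ^ 2 * n) ≤ p.1.card * p.2.card * m := by gcongr
    have : (n : ℝ) * 2 ≤ p.1.card * p.2.card * m / n.choose 2 := by
      rw [le_div_iff₀ hM]
      refine le_trans ?_ hprod
      calc (n : ℝ) * 2 * n.choose 2 ≤ n * 2 * (n ^ 2 / 2) := by gcongr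
        _ = _ := by field_simp
    linarith
  have hcover : T ⊆ A ∪ P.biUnion B := by
    intro G hG
    have hG : G.edgeSet.ncard = m := (Finset.mem_filter.1 hG).2
    by_cases h : G ∈ A
    · exact Finset.mem_union_left _ h
    · simp only [hA, Finset.mem_filter, Finset.mem_univ, true_and, hG] at h
      push Not at h
      obtain ⟨X, Y, hd, hX, hY, h⟩ := h
      exact Finset.mem_union_right _ (Finset.mem_biUnion.2 ⟨(X, Y),
        Finset.mem_filter.2 ⟨Finset.mem_univ _, hd, hX, hY⟩,
        Finset.mem_filter.2 ⟨Finset.mem_univ _, hG, h⟩⟩)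
  have hPcard : (P.card : ℝ) ≤ 4 ^ n := by
    have : P.card ≤ 4 ^ n := by
      refine (Finset.card_le_univ P).trans_eq ?_
      rw [Fintype.card_prod, Fintype.card_finset, Fintype.card_fin, ← mul_pow]
      norm_num
    exact_mod_cast this
  have hbad : ((P.biUnion B).card : ℝ) ≤ δ * T.card := by
    calc ((P.biUnion B).card : ℝ) ≤ ∑ p ∈ P, ((B p).card : ℝ) := by
          exact_mod_cast Finset.card_biUnion_le
      _ ≤ P.card * (Real.exp (-2) ^ n * T.card) := by
          rw [← nsmul_eq_mul]
          exact Finset.sum_le_card_nsmul _ _ _ hB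
      _ ≤ 4 ^ n * (Real.exp (-2) ^ n * T.card) := by gcongr
      _ = (4 * Real.exp (-2)) ^ n * T.card := by rw [mul_pow]; ring
      _ ≤ δ * T.card := by gcongr
  have hsum : (T.card : ℝ) ≤ A.card + (P.biUnion B).card := by
    exact_mod_cast (Finset.card_le_card hcover).trans (Finset.card_union_le _ _)
  linarith
end

section
/- For every δ > 0 there exists N such that for all n ≥ N and every p with 0 ≤ p ≤ 1.1/n the following holds: the G(n,p)-probability of the set of simple graphs G on Fin n such that for every vertex v ∈ Fin n there exists a set A_v ⊆ Fin n with v ∈ A_v, |A_v| ≤ 6000·log n, every vertex of A_v has at most one neighbor in Fin n ∖ A_v, and every vertex of Fin n ∖ A_v has at most one neighbor in A_v, is at least 1 − δ. -/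
open Finset in
/-- The sum of `f F` over the subsets `F` of `D`, weighted by the probability that `F` is the random
subset of `D` which contains each element independently with probability `p`. -/
noncomputable def bernoulliSum {α : Type*} (p : ℝ) (D : Finset α) (f : Finset α → ℝ) : ℝ :=
  ∑ F ∈ D.powerset, p ^ #F * (1 - p) ^ (#D - #F) * f F

section BernoulliSum

open Finset

variable {α β : Type*} {p : ℝ} {D : Finset α} {f g : Finset α → ℝ}

lemma bernoulliSum_mono (hp0 : 0 ≤ p) (hp1 : p ≤ 1) (h : ∀ F ⊆ D, f F ≤ g F) :
    bernoulliSum p D f ≤ bernoulliSum p D g := by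
  have : 0 ≤ 1 - p := by linarith
  refine sum_le_sum fun F hF => ?_
  have := h F (mem_powerset.1 hF)
  gcongr

lemma bernoulliSum_add :
    bernoulliSum p D (fun F => f F + g F) = bernoulliSum p D f + bernoulliSum p D g := by
  simp [bernoulliSum, mul_add, sum_add_distrib]

lemma bernoulliSum_const_mul (c : ℝ) :
    bernoulliSum p D (fun F => c * f F) = c * bernoulliSum p D f := by
  rw [bernoulliSum, bernoulliSum, mul_sum]
  exact sum_congr rfl fun F _ => by ring

lemma bernoulliSum_sum {ι : Type*} (s : Finset ι) (f : ι → Finset α → ℝ) :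
    bernoulliSum p D (fun F => ∑ i ∈ s, f i F) = ∑ i ∈ s, bernoulliSum p D (f i) := by
  simp only [bernoulliSum, mul_sum]
  exact sum_comm

lemma bernoulliSum_prod [DecidableEq α] (c : α → ℝ) :
    bernoulliSum p D (fun F => ∏ x ∈ F, c x) = ∏ x ∈ D, (p * c x + (1 - p)) := by
  rw [prod_add]
  refine sum_congr rfl fun F hF => ?_
  rw [prod_mul_distrib, prod_const, prod_const, card_sdiff_of_subset (mem_powerset.1 hF)]
  ring

lemma bernoulliSum_one : bernoulliSum p D (fun _ => 1) = 1 := by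
  classical
  simpa using bernoulliSum_prod (p := p) (D := D) (fun _ => (1 : ℝ))

lemma bernoulliSum_union [DecidableEq α] {D₁ D₂ : Finset α} (h : Disjoint D₁ D₂)
    (f : Finset α → ℝ) :
    bernoulliSum p (D₁ ∪ D₂) f =
      bernoulliSum p D₂ fun F₂ => bernoulliSum p D₁ fun F₁ => f (F₁ ∪ F₂) := by
  simp only [bernoulliSum, mul_sum]
  rw [← sum_product']
  refine sum_nbij' (fun F => (F ∩ D₂, F ∩ D₁)) (fun F => F.2 ∪ F.1) ?_ ?_ ?_ ?_ ?_
  · intro F _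
    simp [inter_subset_right]
  · intro F hF
    simp only [mem_product, mem_powerset] at hF ⊢
    exact union_subset_union hF.2 hF.1
  · intro F hF
    rw [← inter_union_distrib_left]
    exact inter_eq_left.2 (mem_powerset.1 hF)
  · rintro ⟨F₂, F₁⟩ hF
    simp only [mem_product, mem_powerset] at hF
    have h₁ : F₁ ∩ D₂ = ∅ := disjoint_iff_inter_eq_empty.1 (h.mono_left hF.2)
    have h₂ : F₂ ∩ D₁ = ∅ := disjoint_iff_inter_eq_empty.1 (h.symm.mono_left hF.1)
    simp [union_inter_distrib_right, h₁, h₂, inter_eq_left.2 hF.1, inter_eq_left.2 hF.2]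
  · intro F hF
    have hF' : F ∩ D₁ ∪ F ∩ D₂ = F := by
      rw [← inter_union_distrib_left]
      exact inter_eq_left.2 (mem_powerset.1 hF)
    have hc : #F = #(F ∩ D₁) + #(F ∩ D₂) := by
      rw [← card_union_of_disjoint (h.mono inter_subset_right inter_subset_right), hF']
    have h₁ : #(F ∩ D₁) ≤ #D₁ := card_le_card inter_subset_right
    have h₂ : #(F ∩ D₂) ≤ #D₂ := card_le_card inter_subset_right
    have hs : #(D₁ ∪ D₂) - #F = (#D₁ - #(F ∩ D₁)) + (#D₂ - #(F ∩ D₂)) := by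
      rw [card_union_of_disjoint h]
      omega
    rw [hs, hc, hF', pow_add, pow_add]
    ring

lemma bernoulliSum_map (e : α ↪ β) (f : Finset β → ℝ) :
    bernoulliSum p (D.map e) f = bernoulliSum p D fun F => f (F.map e) := by
  classical
  have h : (D.map e).powerset = D.powerset.map (mapEmbedding e).toEmbedding := by
    ext F
    simp [subset_map_iff, eq_comm]
  simp [bernoulliSum, h]

end BernoulliSum

section MatchingCut

open Finset

variable {V : Type*}

/-- The embedding sending a vertex `x` to the pair `s(a, x)`. -/
def pairEmbedding (a : V) : V ↪ Sym2 V := ⟨fun x => s(a, x), fun _ _ h => Sym2.congr_right.1 h⟩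

@[simp]
lemma mk_mem_map_pairEmbedding {S : Finset V} {a x y : V} :
    s(x, y) ∈ S.map (pairEmbedding a) ↔ (x = a ∧ y ∈ S) ∨ (y = a ∧ x ∈ S) := by
  have : ∀ z, pairEmbedding a z = s(x, y) ↔ (a = x ∧ z = y) ∨ (a = y ∧ z = x) := fun z =>
    Sym2.eq_iff
  simp only [mem_map, this]
  grind

variable [DecidableEq V]

/-- The unordered pairs of distinct elements of `W`. -/
def distinctPairs (W : Finset V) : Finset (Sym2 V) := {e ∈ W.sym2 | ¬ e.IsDiag}

@[simp]
lemma mk_mem_distinctPairs {W : Finset V} {x y : V} :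
    s(x, y) ∈ distinctPairs W ↔ (x ∈ W ∧ y ∈ W) ∧ x ≠ y := by
  simp [distinctPairs]

lemma distinctPairs_insert {W : Finset V} {a : V} (ha : a ∉ W) :
    distinctPairs (insert a W) = distinctPairs W ∪ W.map (pairEmbedding a) := by
  ext e
  induction e with
  | _ x y =>
    simp only [mem_union, mk_mem_distinctPairs, mk_mem_map_pairEmbedding, mem_insert]
    grind

lemma disjoint_distinctPairs_map {W : Finset V} {a : V} (ha : a ∉ W) :
    Disjoint (distinctPairs W) (W.map (pairEmbedding a)) := by
  rw [disjoint_left]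
  intro e
  induction e with
  | _ x y =>
    simp only [mk_mem_distinctPairs, mk_mem_map_pairEmbedding]
    grind

/-- In the graph on `W` with edge set `F` there is a set `A ⊇ Q` of at most `k` vertices such that
the edges between `A` and `W \ A` form a matching which avoids `B`. -/
def HasMatchingCut (F : Finset (Sym2 V)) (W Q B : Finset V) (k : ℕ) : Prop :=
  ∃ A, Q ⊆ A ∧ A ⊆ W ∧ #A ≤ k ∧ (∀ a ∈ A, #{b ∈ W \ A | s(a, b) ∈ F} ≤ 1) ∧
    (∀ b ∈ W \ A, #{a ∈ A | s(b, a) ∈ F} ≤ 1) ∧ ∀ b ∈ W \ A, b ∈ B → ∀ a ∈ A, s(b, a) ∉ F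

lemma hasMatchingCut_empty (F : Finset (Sym2 V)) (W B : Finset V) (k : ℕ) :
    HasMatchingCut F W ∅ B k :=
  ⟨∅, by simp⟩

/-- Exposing the neighborhood `S` of a vertex `a`: all vertices of `S` outside `T`
are put on the side of `a`, and the at most one vertex of `T` is put on the other side, if no
further edge forbids it. -/
lemma HasMatchingCut.insert_vertex {F : Finset (Sym2 V)} {W Q B S T : Finset V} {a : V} {k : ℕ}
    (hF : F ⊆ distinctPairs W) (ha : a ∉ W) (hT : T ⊆ S \ (Q ∪ B)) (hT1 : #T ≤ 1)
    (h : HasMatchingCut F W ((Q ∪ S) \ T) (B ∪ T) k) :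
    HasMatchingCut (F ∪ S.map (pairEmbedding a)) (insert a W) (insert a Q) B (k + 1) := by
  obtain ⟨A, hQA, hAW, hAk, hA, hW, hB⟩ := h
  have haA : a ∉ A := fun h => ha (hAW h)
  have hFW : ∀ x y, s(x, y) ∈ F → x ∈ W ∧ y ∈ W := fun x y h =>
    (mk_mem_distinctPairs.1 (hF h)).1
  have hsd : insert a W \ insert a A = W \ A := by
    ext x
    simp only [mem_sdiff, mem_insert]
    grind
  have hST : ∀ x ∈ S, x ∉ A → x ∈ T := fun x hx hxA => by
    by_contra hxT
    exact hxA (hQA (by simp [hx, hxT]))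
  refine ⟨insert a A, ?_, insert_subset_insert _ hAW, ?_, ?_, ?_, ?_⟩
  · refine insert_subset_insert _ fun x hx => hQA ?_
    have : x ∉ T := fun h => by simpa [hx] using hT h
    simp [hx, this]
  · rw [card_insert_of_notMem haA]
    omega
  · rw [hsd]
    intro x hx
    rcases eq_or_ne x a with rfl | hxa
    · refine (card_le_card fun y hy => ?_).trans hT1
      simp only [mem_filter, mem_sdiff, mem_union, mk_mem_map_pairEmbedding] at hy
      grind
    · refine (card_le_card fun y hy => ?_).trans (hA x (by grind))
      simp only [mem_filter, mem_sdiff, mem_union, mk_mem_map_pairEmbedding] at hy ⊢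
      grind
  · rw [hsd]
    intro b hb
    have hbW := mem_sdiff.1 hb
    by_cases hbS : b ∈ S
    · refine (card_le_card (t := {a}) fun y hy => ?_).trans (card_singleton a).le
      simp only [mem_filter, mem_insert, mem_union, mk_mem_map_pairEmbedding] at hy
      have := hB b hb (mem_union_right _ (hST b hbS hbW.2))
      grind
    · refine (card_le_card fun y hy => ?_).trans (hW b hb)
      simp only [mem_filter, mem_insert, mem_union, mk_mem_map_pairEmbedding] at hy ⊢
      grind
  · rw [hsd]
    intro b hb hbB y hy hyF
    have hbW := mem_sdiff.1 hb
    have hbS : b ∉ S := fun hbS => by simpa [hbB] using hT (hST b hbS hbW.2)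
    have := hB b hb (mem_union_left _ hbB)
    simp only [mem_insert, mem_union, mk_mem_map_pairEmbedding] at hy hyF
    grind

open Classical in
/-- The probability that the random graph on `W` with edge density `p` has no matching cut as in
`HasMatchingCut`. -/
noncomputable def noCutProb (p : ℝ) (W Q B : Finset V) (k : ℕ) : ℝ :=
  bernoulliSum p (distinctPairs W) fun F => if HasMatchingCut F W Q B k then 0 else 1

lemma noCutProb_insert_le {p : ℝ} (hp0 : 0 ≤ p) (hp1 : p ≤ 1) {W Q B : Finset V} {a : V} {k : ℕ}
    (ha : a ∉ W) (T : Finset V → Finset V) (hT : ∀ S, T S ⊆ S \ (Q ∪ B)) (hT1 : ∀ S, #(T S) ≤ 1) :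
    noCutProb p (insert a W) (insert a Q) B (k + 1) ≤
      bernoulliSum p W fun S => noCutProb p W ((Q ∪ S) \ T S) (B ∪ T S) k := by
  rw [noCutProb, distinctPairs_insert ha, bernoulliSum_union (disjoint_distinctPairs_map ha),
    bernoulliSum_map]
  refine bernoulliSum_mono hp0 hp1 fun S _ => bernoulliSum_mono hp0 hp1 fun F hF => ?_
  have := HasMatchingCut.insert_vertex (k := k) hF ha (hT S) (hT1 S)
  split_ifs <;> simp_all

lemma two_pow_card_le {Q B S T : Finset V} (hT : T ⊆ S \ (Q ∪ B))
    (hT1 : #T = min 1 #(S \ (Q ∪ B))) :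
    (2 : ℝ) ^ #((Q ∪ S) \ T) ≤ 2 ^ #Q / 2 * ((∏ x ∈ S, if x ∈ Q then (1 : ℝ) else 2) +
      ∏ x ∈ S, if x ∈ Q then (1 : ℝ) else if x ∈ B then 2 else 0) := by
  have hprod : (∏ x ∈ S, if x ∈ Q then (1 : ℝ) else 2) = 2 ^ #(S \ Q) := by
    rw [prod_ite, prod_const_one, prod_const, one_mul, filter_notMem_eq_sdiff]
  have hTS : T ⊆ Q ∪ S := (hT.trans sdiff_subset).trans subset_union_right
  have hcard : #((Q ∪ S) \ T) + #T = #Q + #(S \ Q) := by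
    rw [card_sdiff_add_card_eq_card hTS, add_comm #Q, card_sdiff_add_card, union_comm]
  rw [hprod]
  rcases (S \ (Q ∪ B)).eq_empty_or_nonempty with h | h
  · have h2 : (∏ x ∈ S, if x ∈ Q then (1 : ℝ) else if x ∈ B then 2 else 0) = 2 ^ #(S \ Q) := by
      rw [← hprod]
      refine prod_congr rfl fun x hx => ?_
      have : x ∈ Q ∪ B := by
        by_contra hx'
        simpa [h] using mem_sdiff.2 ⟨hx, hx'⟩
      grind
    rw [h2]
    rw [h, card_empty, Nat.min_zero] at hT1
    rw [show #((Q ∪ S) \ T) = #Q + #(S \ Q) by omega, pow_add]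
    exact le_of_eq (by ring)
  · have h2 : 0 ≤ ∏ x ∈ S, if x ∈ Q then (1 : ℝ) else if x ∈ B then 2 else 0 :=
      prod_nonneg fun x _ => by split_ifs <;> norm_num
    rw [min_eq_left h.card_pos] at hT1
    have h3 : (2 : ℝ) ^ #((Q ∪ S) \ T) = 2 ^ #Q / 2 * 2 ^ #(S \ Q) := by
      have : (2 : ℝ) ^ (#((Q ∪ S) \ T) + 1) = 2 ^ #Q * 2 ^ #(S \ Q) := by
        rw [← pow_add, ← hcard, hT1]
      rw [pow_succ] at this
      linarith
    rw [h3]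
    gcongr
    linarith

lemma prod_ite_ite_const (W Q B : Finset V) (x y : ℝ) :
    (∏ v ∈ W, if v ∈ Q then 1 else if v ∈ B then x else y) =
      x ^ #((W \ Q) ∩ B) * y ^ #((W \ Q) \ B) := by
  rw [prod_ite, prod_const_one, one_mul, filter_notMem_eq_sdiff, prod_ite, prod_const, prod_const,
    filter_notMem_eq_sdiff, filter_mem_eq_inter]

lemma noCutProb_le {p r : ℝ} {K n : ℕ} (hp0 : 0 ≤ p) (hp1 : p ≤ 1) (hr0 : 0 ≤ r)
    (hr : ∀ b u : ℕ, b ≤ K → u ≤ n → (1 + p) ^ b * ((1 + p) ^ u + (1 - p) ^ u) ≤ 4 * r) (k : ℕ) :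
    ∀ W Q B : Finset V, Q ⊆ W → #W ≤ n → #B + k ≤ K → noCutProb p W Q B k ≤ 2 ^ #Q * r ^ k := by
  have hle : ∀ (W Q B : Finset V) k, noCutProb p W Q B k ≤ 1 := fun W Q B k => by
    rw [← bernoulliSum_one (p := p) (D := distinctPairs W)]
    exact bernoulliSum_mono hp0 hp1 fun F _ => by split_ifs <;> norm_num
  induction k with
  | zero =>
    intro W Q B _ _ _
    refine (hle W Q B 0).trans ?_
    simpa using one_le_pow₀ (M₀ := ℝ) one_le_two
  | succ k ih =>
    intro W Q B hQ hW hK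
    rcases Q.eq_empty_or_nonempty with rfl | ⟨a, haQ⟩
    · have : noCutProb p W ∅ B (k + 1) = 0 := by
        simp [noCutProb, hasMatchingCut_empty, bernoulliSum]
      rw [this]
      positivity
    obtain ⟨Q, haQ', rfl⟩ : ∃ Q', a ∉ Q' ∧ insert a Q' = Q :=
      ⟨Q.erase a, notMem_erase a Q, insert_erase haQ⟩
    obtain ⟨W, haW, rfl⟩ : ∃ W', a ∉ W' ∧ insert a W' = W :=
      ⟨W.erase a, notMem_erase a W, insert_erase (hQ haQ)⟩
    have hQW : Q ⊆ W := (insert_subset_insert_iff haQ').1 hQ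
    rw [card_insert_of_notMem haW] at hW
    rw [card_insert_of_notMem haQ']
    choose T hT hT1 using fun S : Finset V =>
      exists_subset_card_eq (s := S \ (Q ∪ B)) (n := min 1 #(S \ (Q ∪ B))) (min_le_right _ _)
    have hT1' : ∀ S, #(T S) ≤ 1 := fun S => (hT1 S).trans_le (min_le_left _ _)
    calc _ ≤ bernoulliSum p W fun S => noCutProb p W ((Q ∪ S) \ T S) (B ∪ T S) k :=
          noCutProb_insert_le hp0 hp1 haW T hT hT1'
      _ ≤ bernoulliSum p W fun S => r ^ k * (2 ^ #Q / 2) *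
            ((∏ x ∈ S, if x ∈ Q then (1 : ℝ) else 2) +
              ∏ x ∈ S, if x ∈ Q then (1 : ℝ) else if x ∈ B then 2 else 0) := by
        refine bernoulliSum_mono hp0 hp1 fun S hS => ?_
        refine (ih _ _ _ (sdiff_subset.trans (union_subset hQW hS)) (by omega) ?_).trans ?_
        · have := card_union_le B (T S)
          have := hT1' S
          omega
        · rw [mul_comm, mul_assoc]
          gcongr
          exact two_pow_card_le (hT S) (hT1 S)
      _ = r ^ k * (2 ^ #Q / 2) * ((1 + p) ^ #((W \ Q) ∩ B) *
            ((1 + p) ^ #((W \ Q) \ B) + (1 - p) ^ #((W \ Q) \ B))) := by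
        rw [bernoulliSum_const_mul, bernoulliSum_add, bernoulliSum_prod, bernoulliSum_prod,
          mul_add ((1 + p) ^ _), ← prod_ite_ite_const, ← prod_ite_ite_const]
        congr 2 <;> refine prod_congr rfl fun x _ => ?_ <;> split_ifs <;> ring
      _ ≤ r ^ k * (2 ^ #Q / 2) * (4 * r) := by
        refine mul_le_mul_of_nonneg_left ?_ (by positivity)
        have h₁ : #((W \ Q) ∩ B) ≤ #B := card_le_card inter_subset_right
        have h₂ : #((W \ Q) \ B) ≤ #W := card_le_card (sdiff_subset.trans sdiff_subset)
        exact hr _ _ (by omega) (by omega)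
      _ = 2 ^ (#Q + 1) * r ^ (k + 1) := by ring

end MatchingCut

open Finset in
/-- The Erdős–Rényi probability as a sum over edge sets. -/
lemma erProb_eq_bernoulliSum (n : ℕ) (p : ℝ) (P : SimpleGraph (Fin n) → Prop) [DecidablePred P] :
    erProb n p P = bernoulliSum p (distinctPairs (univ : Finset (Fin n))) fun F =>
      if P (SimpleGraph.fromEdgeSet (F : Set (Sym2 (Fin n)))) then 1 else 0 := by
  classical
  have hcard : #(distinctPairs (univ : Finset (Fin n))) = n * (n - 1) / 2 := by
    rw [show distinctPairs (univ : Finset (Fin n)) = (⊤ : SimpleGraph (Fin n)).edgeFinset by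
      ext e
      induction e with
      | _ x y => simp, SimpleGraph.card_edgeFinset_top_eq_card_choose_two, Fintype.card_fin,
      Nat.choose_two_right]
  rw [erProb, bernoulliSum, hcard]
  refine sum_bij' (fun G _ => G.edgeFinset)
    (fun F _ => SimpleGraph.fromEdgeSet (F : Set (Sym2 (Fin n)))) ?_ ?_ ?_ ?_ ?_
  · intro G _
    rw [mem_powerset]
    intro e
    induction e with
    | _ x y =>
      simp only [SimpleGraph.mem_edgeFinset, SimpleGraph.mem_edgeSet, mk_mem_distinctPairs, mem_univ,
        true_and]
      exact SimpleGraph.Adj.ne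
  · simp
  · intro G _
    simp
  · intro F hF
    ext e
    have := @mem_powerset.1 hF e
    induction e with
    | _ x y => simp_all
  · intro G _
    simp only [SimpleGraph.coe_edgeFinset, SimpleGraph.fromEdgeSet_edgeSet, mul_ite, mul_one,
      mul_zero, ← Set.ncard_coe_finset]
    congr

lemma exp_le_fifteen_eighths : Real.exp (31 / 50) ≤ 15 / 8 := by
  have h : Real.exp (31 / 50) ^ 50 = Real.exp 1 ^ 31 := by
    rw [← Real.exp_nat_mul, ← Real.exp_nat_mul]
    norm_num
  have h1 : Real.exp 1 ^ 31 ≤ 2.71829 ^ 31 := by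
    have := Real.exp_one_lt_d9
    gcongr
    linarith
  refine le_of_pow_le_pow_left₀ (n := 50) (by norm_num) (by norm_num) ?_
  rw [h]
  exact h1.trans (by norm_num)

lemma mul_add_pow_le {p : ℝ} {n K b u : ℕ} (hp0 : 0 ≤ p) (hp1 : p ≤ 1) (hn : n * p ≤ 1.1)
    (hK : K * p ≤ 0.015) (hb : b ≤ K) (hu : u ≤ n) :
    (1 + p) ^ b * ((1 + p) ^ u + (1 - p) ^ u) ≤ 4 * (15 / 16) := by
  have hup : u * p ≤ 1.1 := by
    refine le_trans ?_ hn
    gcongr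
  have hup0 : 0 ≤ u * p := by positivity
  have h1 : ∀ m : ℕ, (1 + p) ^ m ≤ Real.exp (m * p) := fun m => by
    rw [Real.exp_nat_mul]
    gcongr
    linarith [Real.add_one_le_exp p]
  have h2 : (1 - p) ^ u ≤ Real.exp (-(u * p)) := by
    rw [← mul_neg, Real.exp_nat_mul]
    have := Real.one_sub_le_exp_neg p
    have : 0 ≤ 1 - p := by linarith
    gcongr
  calc (1 + p) ^ b * ((1 + p) ^ u + (1 - p) ^ u)
      ≤ Real.exp 0.015 * (2 * Real.cosh (u * p)) := by
        rw [Real.cosh_eq]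
        have : 0 ≤ 1 - p := by linarith
        gcongr
        · refine (h1 b).trans (Real.exp_le_exp.2 (le_trans ?_ hK))
          gcongr
        · linarith [h1 u]
    _ ≤ Real.exp 0.015 * (2 * Real.exp (0.605)) := by
        gcongr
        refine (Real.cosh_le_exp_half_sq _).trans (Real.exp_le_exp.2 ?_)
        nlinarith
    _ = 2 * Real.exp (31 / 50) := by
        rw [show (31 / 50 : ℝ) = 0.015 + 0.605 by norm_num, Real.exp_add]
        ring
    _ ≤ 4 * (15 / 16) := by linarith [exp_le_fifteen_eighths]

lemma eventually_log_bounds {δ : ℝ} (hδ : 0 < δ) :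
    ∀ᶠ n : ℕ in Filter.atTop, 1 ≤ Real.log n ∧ Real.log n ≤ 1 / 2420 * n ∧ 2 ≤ δ * n ∧ 2 ≤ n := by
  have hcast := tendsto_natCast_atTop_atTop (R := ℝ)
  have h1 := (Real.tendsto_log_atTop.comp hcast).eventually_ge_atTop 1
  have h2 := hcast.eventually (Real.isLittleO_log_id_atTop.bound (c := 1 / 2420) (by norm_num))
  have h3 := (hcast.const_mul_atTop hδ).eventually_ge_atTop 2
  filter_upwards [h1, h2, h3, Filter.eventually_ge_atTop 2] with n h1 h2 h3 h4
  refine ⟨h1, (le_abs_self _).trans ?_, h3, h4⟩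
  simpa using h2

theorem stmt6 : ∀ δ : ℝ, 0 < δ → ∃ N : ℕ,
    ∀ n : ℕ, N ≤ n → ∀ p : ℝ, 0 ≤ p → p ≤ 1.1 / n →
      1 - δ ≤ erProb n p (fun G =>
        ∀ v : Fin n, ∃ A : Finset (Fin n), v ∈ A ∧
          (A.card : ℝ) ≤ 6000 * Real.log n ∧
          (∀ a ∈ A, {b : Fin n | b ∉ A ∧ G.Adj a b}.ncard ≤ 1) ∧
          (∀ b : Fin n, b ∉ A → {a : Fin n | a ∈ A ∧ G.Adj b a}.ncard ≤ 1)) := by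
  classical
  intro δ hδ
  obtain ⟨N, hN⟩ := Filter.eventually_atTop.1 (eventually_log_bounds hδ)
  refine ⟨N, fun n hn p hp0 hp => ?_⟩
  obtain ⟨hlog, hlogn, hδn, hn2⟩ := hN n hn
  have hn2' : (2 : ℝ) ≤ n := by exact_mod_cast hn2
  have hn0 : (0 : ℝ) < n := by linarith
  set K := ⌈32 * Real.log n⌉₊
  have hK1 : 32 * Real.log n ≤ K := Nat.le_ceil _
  have hK2 : K < 32 * Real.log n + 1 := Nat.ceil_lt_add_one (by linarith)
  have hnp : n * p ≤ 1.1 := by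
    rwa [mul_comm, ← le_div_iff₀ hn0]
  have hp1 : p ≤ 1 := by nlinarith
  have hKp : K * p ≤ 0.015 := by
    have : (K : ℝ) ≤ 33 / 2420 * n := by linarith
    calc K * p ≤ 33 / 2420 * n * p := by gcongr
      _ ≤ 0.015 := by linarith
  have hr : (15 / 16 : ℝ) ^ K ≤ 1 / n ^ 2 := by
    calc (15 / 16 : ℝ) ^ K ≤ Real.exp (-(1 / 16)) ^ K := by
          gcongr
          linarith [Real.one_sub_le_exp_neg (1 / 16)]
      _ ≤ Real.exp (-(2 * Real.log n)) := by
          rw [← Real.exp_nat_mul]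
          exact Real.exp_le_exp.2 (by linarith)
      _ = 1 / n ^ 2 := by
          rw [Real.exp_neg, two_mul, Real.exp_add, Real.exp_log hn0, one_div, sq]
  have hcut : ∀ v : Fin n, noCutProb p Finset.univ {v} ∅ K ≤ 2 * (1 / n ^ 2) := fun v => by
    refine (noCutProb_le (r := 15 / 16) (K := K) (n := n) hp0 hp1 (by norm_num)
      (fun b u hb hu => mul_add_pow_le hp0 hp1 hnp hKp hb hu) K _ _ _ (by simp) (by simp)
      (by simp)).trans ?_
    rw [Finset.card_singleton, pow_one]
    gcongr
  have hsum : ∑ v : Fin n, noCutProb p Finset.univ {v} ∅ K ≤ δ := by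
    calc _ ≤ ∑ v : Fin n, 2 * (1 / (n : ℝ) ^ 2) := Finset.sum_le_sum fun v _ => hcut v
      _ = 2 / n := by
        simp only [Finset.sum_const, Finset.card_univ, Fintype.card_fin, nsmul_eq_mul]
        field_simp
      _ ≤ δ := (div_le_iff₀ hn0).2 hδn
  rw [erProb_eq_bernoulliSum]
  refine (sub_le_sub_left hsum 1).trans ?_
  simp only [noCutProb]
  rw [← bernoulliSum_sum, sub_le_iff_le_add, ← bernoulliSum_add]
  refine bernoulliSum_one.ge.trans (bernoulliSum_mono hp0 hp1 fun F _ => ?_)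
  have hnonneg : ∀ v ∈ (Finset.univ : Finset (Fin n)),
      (0 : ℝ) ≤ if HasMatchingCut F Finset.univ {v} ∅ K then 0 else 1 := fun v _ => by
    split_ifs <;> norm_num
  split_ifs with hP
  · linarith [Finset.sum_nonneg hnonneg]
  rw [zero_add]
  by_contra! hlt
  refine hP fun v => ?_
  have hv : HasMatchingCut F Finset.univ {v} ∅ K := by
    by_contra hv
    have := Finset.single_le_sum hnonneg (Finset.mem_univ v)
    rw [if_neg hv] at this
    linarith
  obtain ⟨A, hvA, -, hAK, hA, hB, -⟩ := hv
  refine ⟨A, by simpa using hvA, ?_, fun a ha => ?_, fun b hb => ?_⟩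
  · have : (A.card : ℝ) ≤ K := by exact_mod_cast hAK
    linarith
  · refine le_trans ?_ (hA a ha)
    rw [← Set.ncard_coe_finset]
    refine Set.ncard_le_ncard ?_ (Finset.finite_toSet _)
    intro b hb
    simp_all
  · refine le_trans ?_ (hB b (by simpa using hb))
    rw [← Set.ncard_coe_finset]
    refine Set.ncard_le_ncard ?_ (Finset.finite_toSet _)
    intro a ha
    simp_all
end

section
/- Let G be a finite simple graph with nonempty vertex set in which every vertex has degree exactly 3. Suppose G contains no subgraph isomorphic to F1, the graph consisting of two triangles sharing exactly one edge (equivalently, K4 minus an edge), and no subgraph isomorphic to F2, the graph consisting of a 4-cycle u1u2u3u4 together with an additional vertex x adjacent to u1 and u3 (equivalently, the complete bipartite graph K_{2,3}). Then G is not globally rigid in ℝ. -/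
/-- `F1` is the graph consisting of two triangles sharing exactly one edge,
i.e. `K₄` minus an edge (here the edge `{0,1}` is missing). -/
def F1 : SimpleGraph (Fin 4) :=
  SimpleGraph.fromEdgeSet {s(0, 2), s(0, 3), s(1, 2), s(1, 3), s(2, 3)}

/-- `F2` is the complete bipartite graph `K_{2,3}`, i.e. a 4-cycle together with a
vertex adjacent to two opposite vertices of the cycle. -/
def F2 : SimpleGraph (Fin 2 ⊕ Fin 3) := completeBipartiteGraph (Fin 2) (Fin 3)

/-- `G` contains a subgraph isomorphic to `F`. -/
def HasSubgraphIso {W V : Type*} (F : SimpleGraph W) (G : SimpleGraph V) : Prop :=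
  ∃ φ : W → V, Function.Injective φ ∧ ∀ a b : W, F.Adj a b → G.Adj (φ a) (φ b)

/-- A matching cut `(S, Sᶜ)` that is not a complete join of `S` and `Sᶜ` yields two injective
embeddings with the same edge lengths which are not congruent. -/
theorem not_globallyRigid_of_matching_cut_s7 {V : Type*} [Finite V] (G : SimpleGraph V) (S : Set V)
    (hout : ∀ x ∈ S, ∀ y ∉ S, ∀ z ∉ S, G.Adj x y → G.Adj x z → y = z)
    (hin : ∀ x ∈ S, ∀ y ∈ S, ∀ z ∉ S, G.Adj x z → G.Adj y z → x = y)
    (hne : ∃ x ∈ S, ∃ y ∉ S, ¬ G.Adj x y) : ¬ GloballyRigid G := by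
  classical
  obtain ⟨N, ⟨e⟩⟩ := Finite.exists_equiv_fin V
  -- `p` contracts the edges of the cut
  obtain ⟨p, hp_cut, hp_alone, hp_out⟩ : ∃ p : V → V,
      (∀ x ∈ S, ∀ y ∉ S, G.Adj x y → p x = y) ∧
      (∀ x ∈ S, (∀ y ∉ S, ¬ G.Adj x y) → p x = x) ∧ (∀ x ∉ S, p x = x) := by
    refine ⟨fun x => if h : x ∈ S ∧ ∃ y ∉ S, G.Adj x y then h.2.choose else x, ?_, ?_, ?_⟩
    · intro x hx y hy hxy
      have h : x ∈ S ∧ ∃ y ∉ S, G.Adj x y := ⟨hx, y, hy, hxy⟩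
      simp only [dif_pos h]
      exact hout x hx _ h.2.choose_spec.1 y hy h.2.choose_spec.2 hxy
    · intro x _ h
      exact dif_neg fun h' => h'.2.elim fun y hy => h y hy.1 hy.2
    · intro x hx
      exact dif_neg fun h' => hx h'.1
  have hp_inj : ∀ x ∈ S, ∀ y ∈ S, p x = p y → x = y := by
    intro x hx y hy h
    by_cases h1 : ∃ z ∉ S, G.Adj x z <;> by_cases h2 : ∃ z ∉ S, G.Adj y z
    · obtain ⟨z, hz, hxz⟩ := h1
      obtain ⟨w, hw, hyw⟩ := h2
      rw [hp_cut x hx z hz hxz, hp_cut y hy w hw hyw] at h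
      subst h
      exact hin x hx y hy z hz hxz hyw
    · obtain ⟨z, hz, hxz⟩ := h1
      push Not at h2
      rw [hp_cut x hx z hz hxz, hp_alone y hy h2] at h
      exact absurd (h ▸ hy) hz
    · obtain ⟨w, hw, hyw⟩ := h2
      push Not at h1
      rw [hp_cut y hy w hw hyw, hp_alone x hx h1] at h
      exact absurd (h ▸ hx) hw
    · push Not at h1 h2
      rwa [hp_alone x hx h1, hp_alone y hy h2] at h
  set a : V → ℤ := fun x => (e (p x) : ℕ) with ha
  have ha_inj : ∀ x y, a x = a y → p x = p y := by
    intro x y h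
    simp only [ha, Nat.cast_inj] at h
    exact e.injective (Fin.ext h)
  set b : V → ℤ := fun x => if x ∈ S then 1 else 0 with hb
  have hab : ∀ x y, a x = a y → b x = b y → x = y := by
    intro x y h1 h2
    have h3 := ha_inj x y h1
    by_cases hx : x ∈ S <;> by_cases hy : y ∈ S
    · exact hp_inj x hx y hy h3
    · simp [hb, hx, hy] at h2
    · simp [hb, hx, hy] at h2
    · rwa [hp_out x hx, hp_out y hy] at h3
  have hb_mem : ∀ x, b x = 0 ∨ b x = 1 := by
    intro x
    by_cases hx : x ∈ S <;> simp [hb, hx]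
  have hedge : ∀ x y, G.Adj x y → a x = a y ∨ b x = b y := by
    intro x y hxy
    by_cases hx : x ∈ S <;> by_cases hy : y ∈ S
    · right; simp [hb, hx, hy]
    · left; simp only [ha, hp_cut x hx y hy hxy, hp_out y hy]
    · left; simp only [ha, hp_cut y hy x hx hxy.symm, hp_out x hx]
    · right; simp [hb, hx, hy]
  intro hrig
  have key := hrig (fun x => ((2 * a x + b x : ℤ) : ℝ)) (fun x => ((2 * a x - b x : ℤ) : ℝ))
    (by
      intro x y h
      have h' : 2 * a x + b x = 2 * a y + b y := Int.cast_injective (α := ℝ) h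
      have := hb_mem x
      have := hb_mem y
      exact hab x y (by omega) (by omega))
    (by
      intro x y h
      have h' : 2 * a x - b x = 2 * a y - b y := Int.cast_injective (α := ℝ) h
      have := hb_mem x
      have := hb_mem y
      exact hab x y (by omega) (by omega))
    (by
      intro x y hxy
      rw [abs_eq_abs]
      push_cast
      rcases hedge x y hxy with h | h
      · right; rw [h]; ring
      · left; rw [h]; ring)
  obtain ⟨x, hx, y, hy, hxy⟩ := hne
  have h := key x y
  have hbx : b x = 1 := by simp [hb, hx]
  have hby : b y = 0 := by simp [hb, hy]
  have haxy : a x = a y := by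
    rw [abs_eq_abs] at h
    simp only [hbx, hby] at h
    norm_cast at h
    omega
  have hpxy := ha_inj x y haxy
  rw [hp_out y hy] at hpxy
  by_cases h1 : ∃ z ∉ S, G.Adj x z
  · obtain ⟨z, hz, hxz⟩ := h1
    rw [hp_cut x hx z hz hxz] at hpxy
    exact hxy (hpxy ▸ hxz)
  · push Not at h1
    rw [hp_alone x hx h1] at hpxy
    exact hy (hpxy ▸ hx)

theorem hasSubgraphIso_F1 {V : Type*} {G : SimpleGraph V} {a b c d : V} (hab : a ≠ b)
    (hac : G.Adj a c) (had : G.Adj a d) (hbc : G.Adj b c) (hbd : G.Adj b d) (hcd : G.Adj c d) :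
    HasSubgraphIso F1 G := by
  have := hac.ne
  have := had.ne
  have := hbc.ne
  have := hbd.ne
  have := hcd.ne
  refine ⟨![a, b, c, d], ?_, ?_⟩
  · intro i j
    fin_cases i <;> fin_cases j <;> simp_all [eq_comm]
  · intro i j
    fin_cases i <;> fin_cases j <;> simp_all [F1, G.adj_comm]

theorem hasSubgraphIso_F2 {V : Type*} {G : SimpleGraph V} {a b x y z : V} (hab : a ≠ b)
    (hxy : x ≠ y) (hxz : x ≠ z) (hyz : y ≠ z) (hax : G.Adj a x) (hay : G.Adj a y)
    (haz : G.Adj a z) (hbx : G.Adj b x) (hby : G.Adj b y) (hbz : G.Adj b z) :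
    HasSubgraphIso F2 G := by
  have := hax.ne
  have := hay.ne
  have := haz.ne
  have := hbx.ne
  have := hby.ne
  have := hbz.ne
  refine ⟨Sum.elim ![a, b] ![x, y, z], ?_, ?_⟩
  · rintro (i | i) (j | j) <;> fin_cases i <;> fin_cases j <;> simp_all [eq_comm]
  · rintro (i | i) (j | j) <;> fin_cases i <;> fin_cases j <;> simp_all [F2, G.adj_comm]

/-- `c 0, …, c (n - 1)` are the consecutive vertices of a cycle of length `n` in `G`. -/
structure IsCycleSeq {V : Type*} (G : SimpleGraph V) (n : ℕ) (c : ℕ → V) : Prop where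
  three_le : 3 ≤ n
  inj : ∀ i j, i < n → j < n → c i = c j → i = j
  adj : ∀ i, i + 1 < n → G.Adj (c i) (c (i + 1))
  adj_last : G.Adj (c (n - 1)) (c 0)

theorem exists_isCycleSeq {V : Type*} [Finite V] [Nonempty V] (G : SimpleGraph V)
    (h : ∀ u v, ∃ w, G.Adj v w ∧ w ≠ u) : ∃ n c, IsCycleSeq G n c := by
  classical
  choose nxt hadj hne using h
  obtain ⟨v₀⟩ := ‹Nonempty V›
  -- an infinite walk without backtracking
  let s : ℕ → V × V := fun k => (fun q : V × V => (q.2, nxt q.1 q.2))^[k] (v₀, nxt v₀ v₀)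
  have hs : ∀ k, s (k + 1) = ((s k).2, nxt (s k).1 (s k).2) := fun k =>
    Function.iterate_succ_apply' _ _ _
  let x : ℕ → V := fun k => (s k).2
  have hx_adj : ∀ k, G.Adj (x k) (x (k + 1)) := by
    intro k
    simp only [x, hs]
    exact hadj _ _
  have hx_ne : ∀ k, x (k + 2) ≠ x k := by
    intro k
    simp only [x, hs]
    exact hne _ _
  have hex : ∃ d, 0 < d ∧ ∃ i, x (i + d) = x i := by
    obtain ⟨i, j, hij, h⟩ := Finite.exists_ne_map_eq_of_infinite x
    rcases lt_or_gt_of_ne hij with hlt | hlt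
    · exact ⟨j - i, by omega, i, by rw [Nat.add_sub_cancel' hlt.le, h]⟩
    · exact ⟨i - j, by omega, j, by rw [Nat.add_sub_cancel' hlt.le, h]⟩
  obtain ⟨hd, i, hi⟩ := Nat.find_spec hex
  have hmin := fun m (hm : m < Nat.find hex) => Nat.find_min hex hm
  generalize Nat.find hex = d at hd hi hmin
  have hd3 : 3 ≤ d := by
    by_contra! hlt
    interval_cases d
    · exact (hx_adj i).ne hi.symm
    · exact hx_ne i hi
  have hinj : ∀ j k, j < k → k < d → x (i + j) ≠ x (i + k) := by
    intro j k hjk hk heq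
    refine hmin (k - j) (by omega) ⟨by omega, i + j, ?_⟩
    rw [heq]
    congr 1
    omega
  refine ⟨d, fun k => x (i + k), hd3, ?_, fun k _ => hx_adj (i + k), ?_⟩
  · intro j k hj hk heq
    rcases lt_trichotomy j k with hlt | rfl | hlt
    · exact absurd heq (hinj j k hlt hk)
    · rfl
    · exact absurd heq.symm (hinj k j hlt hj)
  · have := hx_adj (i + (d - 1))
    rwa [show i + (d - 1) + 1 = i + d by omega, hi] at this

/-- A chord of a shortest cycle is one of its edges. -/
theorem IsCycleSeq.chord {V : Type*} {G : SimpleGraph V} {n : ℕ} {c : ℕ → V}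
    (hc : IsCycleSeq G n c) (hmin : ∀ m c', IsCycleSeq G m c' → n ≤ m) {i j : ℕ} (hij : i < j)
    (hj : j < n) (hadj : G.Adj (c i) (c j)) : j = i + 1 ∨ i = 0 ∧ j = n - 1 := by
  by_contra hcon
  have h := hmin (j - i + 1) (fun k => c (i + k))
    ⟨by omega, fun a b ha hb hab => by
        have := hc.inj _ _ (by omega) (by omega) hab
        omega,
      fun a ha => hc.adj (i + a) (by omega), by
        simpa [Nat.add_sub_cancel' hij.le] using hadj.symm⟩
  omega

/-- Two neighbours on a shortest cycle of a vertex off the cycle are far apart. -/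
theorem IsCycleSeq.le_of_common_neighbor {V : Type*} {G : SimpleGraph V} {n : ℕ} {c : ℕ → V}
    (hc : IsCycleSeq G n c) (hmin : ∀ m c', IsCycleSeq G m c' → n ≤ m) {i j : ℕ} (hij : i < j)
    (hj : j < n) {v : V} (hv : ∀ k < n, c k ≠ v) (hi : G.Adj (c i) v) (hjv : G.Adj (c j) v) :
    n ≤ j - i + 2 := by
  refine hmin _ (fun k => if k ≤ j - i then c (i + k) else v) ⟨by omega, ?_, ?_, ?_⟩
  · intro a b ha hb hab
    by_cases ha' : a ≤ j - i <;> by_cases hb' : b ≤ j - i <;> simp only [ha', hb', if_true,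
      if_false] at hab
    · have := hc.inj _ _ (by omega) (by omega) hab
      omega
    · exact absurd hab (hv _ (by omega))
    · exact absurd hab.symm (hv _ (by omega))
    · omega
  · intro a ha
    by_cases ha' : a + 1 ≤ j - i
    · simpa [ha', (Nat.le_succ a).trans ha', add_assoc] using hc.adj (i + a) (by omega)
    · obtain rfl : a = j - i := by omega
      simpa [Nat.add_sub_cancel' hij.le] using hjv
  · simpa using hi.symm

theorem isCycleSeq_four {V : Type*} {G : SimpleGraph V} {a b c d : V} (hac : a ≠ c) (hbd : b ≠ d)
    (hab : G.Adj a b) (hbc : G.Adj b c) (hcd : G.Adj c d) (hda : G.Adj d a) :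
    ∃ f, IsCycleSeq G 4 f := by
  have := hab.ne
  have := hbc.ne
  have := hcd.ne
  have := hda.ne
  refine ⟨fun k => if k = 0 then a else if k = 1 then b else if k = 2 then c else d,
    by norm_num, ?_, ?_, by simpa using hda⟩
  · intro i j hi hj
    interval_cases i <;> interval_cases j <;> simp_all [eq_comm]
  · intro i hi
    obtain rfl | rfl | rfl : i = 0 ∨ i = 1 ∨ i = 2 := by omega
    all_goals simpa

theorem isCycleSeq_three {V : Type*} {G : SimpleGraph V} {a b c : V}
    (hab : G.Adj a b) (hbc : G.Adj b c) (hca : G.Adj c a) : ∃ f, IsCycleSeq G 3 f := by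
  have := hab.ne
  have := hbc.ne
  have := hca.ne
  refine ⟨fun k => if k = 0 then a else if k = 1 then b else c,
    le_rfl, ?_, ?_, by simpa using hca⟩
  · intro i j hi hj
    interval_cases i <;> interval_cases j <;> simp_all [eq_comm]
  · intro i hi
    obtain rfl | rfl : i = 0 ∨ i = 1 := by omega
    all_goals simpa

/-- In a graph without `F1` and `F2`, a vertex off a shortest cycle has at most one neighbour on
the cycle. -/
theorem IsCycleSeq.not_common_neighbor {V : Type*} {G : SimpleGraph V} {n : ℕ} {c : ℕ → V}
    (hF1 : ¬ HasSubgraphIso F1 G) (hF2 : ¬ HasSubgraphIso F2 G)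
    (hc : IsCycleSeq G n c) (hmin : ∀ m c', IsCycleSeq G m c' → n ≤ m) {i j : ℕ} (hij : i < j)
    (hj : j < n) {v : V} (hv : ∀ k < n, c k ≠ v) (hi : G.Adj (c i) v) (hjv : G.Adj (c j) v) :
    False := by
  have hle := hc.le_of_common_neighbor hmin hij hj hv hi hjv
  have h3 := hc.three_le
  have hne : ∀ a b, a < n → b < n → a ≠ b → c a ≠ c b := fun a b ha hb hab h =>
    hab (hc.inj a b ha hb h)
  have hn : n ≤ 4 := by
    obtain ⟨rfl, rfl⟩ | ⟨rfl, rfl⟩ | ⟨rfl, rfl⟩ :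
        i = 0 ∧ j = n - 1 ∨ i = 0 ∧ j = n - 2 ∨ i = 1 ∧ j = n - 1 := by omega
    · obtain ⟨f, hf⟩ := isCycleSeq_three hc.adj_last hi hjv.symm
      exact (hmin _ _ hf).trans (by norm_num)
    · have hadj := hc.adj (n - 2) (by omega)
      rw [show n - 2 + 1 = n - 1 by omega] at hadj
      obtain ⟨f, hf⟩ := isCycleSeq_four (hne (n - 2) 0 (by omega) (by omega) (by omega))
        (hv (n - 1) (by omega)) hadj hc.adj_last hi hjv.symm
      exact hmin _ _ hf
    · obtain ⟨f, hf⟩ := isCycleSeq_four (hne (n - 1) 1 (by omega) (by omega) (by omega))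
        (hv 0 (by omega)) hc.adj_last (hc.adj 0 (by omega)) hi hjv.symm
      exact hmin _ _ hf
  obtain rfl | rfl : n = 3 ∨ n = 4 := by omega
  · have h01 := hc.adj 0 (by omega)
    have h12 := hc.adj 1 (by omega)
    have h20 := hc.adj_last
    simp only [zero_add, Nat.reduceAdd, Nat.reduceSub] at h01 h12 h20
    obtain ⟨rfl, rfl⟩ | ⟨rfl, rfl⟩ | ⟨rfl, rfl⟩ :
        i = 0 ∧ j = 1 ∨ i = 0 ∧ j = 2 ∨ i = 1 ∧ j = 2 := by omega
    · exact hF1 (hasSubgraphIso_F1 (hv 2 (by omega)) h20 h12.symm hi.symm hjv.symm h01)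
    · exact hF1 (hasSubgraphIso_F1 (hv 1 (by omega)) h01.symm h12 hi.symm hjv.symm h20.symm)
    · exact hF1 (hasSubgraphIso_F1 (hv 0 (by omega)) h01 h20.symm hi.symm hjv.symm h12)
  · have h01 := hc.adj 0 (by omega)
    have h12 := hc.adj 1 (by omega)
    have h23 := hc.adj 2 (by omega)
    have h30 := hc.adj_last
    simp only [zero_add, Nat.reduceAdd, Nat.reduceSub] at h01 h12 h23 h30
    have no_triangle : ∀ {x y z : V}, G.Adj x y → G.Adj y z → G.Adj z x → False := by
      intro x y z hxy hyz hzx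
      obtain ⟨f, hf⟩ := isCycleSeq_three hxy hyz hzx
      exact absurd (hmin _ _ hf) (by norm_num)
    obtain ⟨rfl, rfl⟩ | ⟨rfl, rfl⟩ | ⟨rfl, rfl⟩ :
        i = 0 ∧ j = 3 ∨ i = 0 ∧ j = 2 ∨ i = 1 ∧ j = 3 := by omega
    · exact no_triangle h30 hi hjv.symm
    · exact hF2 (hasSubgraphIso_F2 (hne 0 2 (by omega) (by omega) (by omega))
        (hne 1 3 (by omega) (by omega) (by omega)) (hv 1 (by omega)) (hv 3 (by omega))
        h01 h30.symm hi h12.symm h23 hjv)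
    · exact hF2 (hasSubgraphIso_F2 (hne 1 3 (by omega) (by omega) (by omega))
        (hne 0 2 (by omega) (by omega) (by omega)) (hv 0 (by omega)) (hv 2 (by omega))
        h01.symm h12 hi h30 h23.symm hjv)

/-- Every vertex of a cycle has two neighbours on the cycle. -/
theorem IsCycleSeq.exists_two_neighbors {V : Type*} {G : SimpleGraph V} {n : ℕ} {c : ℕ → V}
    (hc : IsCycleSeq G n c) {i : ℕ} (hi : i < n) :
    ∃ j k, j < n ∧ k < n ∧ c j ≠ c k ∧ G.Adj (c i) (c j) ∧ G.Adj (c i) (c k) := by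
  have h3 := hc.three_le
  have hne : ∀ a b, a < n → b < n → a ≠ b → c a ≠ c b := fun a b ha hb hab h =>
    hab (hc.inj a b ha hb h)
  have hsucc : ∀ k, 0 < k → k < n → G.Adj (c k) (c (k - 1)) := by
    intro k hk hkn
    have := hc.adj (k - 1) (by omega)
    rw [Nat.sub_add_cancel hk] at this
    exact this.symm
  rcases Nat.eq_zero_or_pos i with rfl | hpos
  · exact ⟨1, n - 1, by omega, by omega, hne _ _ (by omega) (by omega) (by omega),
      hc.adj 0 (by omega), hc.adj_last.symm⟩
  · by_cases hl : i + 1 < n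
    · exact ⟨i + 1, i - 1, hl, by omega, hne _ _ hl (by omega) (by omega), hc.adj i hl,
        hsucc i hpos hi⟩
    · obtain rfl : i = n - 1 := by omega
      exact ⟨0, n - 1 - 1, by omega, by omega, hne _ _ (by omega) (by omega) (by omega),
        hc.adj_last, hsucc _ hpos hi⟩

theorem stmt7 {V : Type*} [Fintype V] [Nonempty V] (G : SimpleGraph V)
    (hreg : ∀ v : V, (G.neighborSet v).ncard = 3)
    (hF1 : ¬ HasSubgraphIso F1 G) (hF2 : ¬ HasSubgraphIso F2 G) :
    ¬ GloballyRigid G := by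
  have hthree : ∀ v : V, ∀ a b : V, ∃ w, G.Adj v w ∧ w ≠ a ∧ w ≠ b := by
    intro v a b
    by_contra! hcon
    have hsub : G.neighborSet v ⊆ {a, b} := fun w hw => by
      by_cases hwa : w = a
      · exact Or.inl hwa
      · exact Or.inr (hcon w hw hwa)
    have := Set.ncard_le_ncard hsub
    have := Set.ncard_insert_le a {b}
    rw [Set.ncard_singleton] at this
    have := hreg v
    omega
  have hfour : ∀ v a b y z : V, G.Adj v a → G.Adj v b → G.Adj v y → G.Adj v z → a ≠ b →
      a ≠ y → b ≠ y → a ≠ z → b ≠ z → y = z := by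
    intro v a b y z ha hb hy hz hab hay hby haz hbz
    by_contra hyz
    have hsub : ({a, b, y, z} : Set V) ⊆ G.neighborSet v := by
      rintro w (rfl | rfl | rfl | rfl) <;> assumption
    have := Set.ncard_le_ncard hsub
    rw [hreg v, Set.ncard_insert_of_notMem (by simp [hab, hay, haz]),
      Set.ncard_insert_of_notMem (by simp [hby, hbz]), Set.ncard_pair hyz] at this
    omega
  have hcyc : ∃ n c, IsCycleSeq G n c := exists_isCycleSeq G fun u v =>
    (hthree v u u).imp fun w hw => ⟨hw.1, hw.2.1⟩
  classical
  obtain ⟨c, hc⟩ := Nat.find_spec hcyc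
  have hmin : ∀ m c', IsCycleSeq G m c' → Nat.find hcyc ≤ m := fun m c' h =>
    Nat.find_min' hcyc ⟨c', h⟩
  generalize Nat.find hcyc = n at hc hmin
  have h3 := hc.three_le
  have houter : ∀ i < n, ∀ y z, (∀ k < n, c k ≠ y) → (∀ k < n, c k ≠ z) → G.Adj (c i) y →
      G.Adj (c i) z → y = z := by
    intro i hi y z hy hz hiy hiz
    obtain ⟨j, k, hj, hk, hjk, hij, hik⟩ := hc.exists_two_neighbors hi
    exact hfour _ _ _ _ _ hij hik hiy hiz hjk (hy j hj) (hy k hk) (hz j hj) (hz k hk)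
  have hinner : ∀ i j, i < n → j < n → ∀ v, (∀ k < n, c k ≠ v) → G.Adj (c i) v →
      G.Adj (c j) v → i = j := by
    intro i j hi hj v hv hiv hjv
    rcases lt_trichotomy i j with hlt | rfl | hlt
    · exact (hc.not_common_neighbor hF1 hF2 hmin hlt hj hv hiv hjv).elim
    · rfl
    · exact (hc.not_common_neighbor hF1 hF2 hmin hlt hi hv hjv hiv).elim
  obtain ⟨y, hy, hy0⟩ : ∃ y, (∀ k < n, c k ≠ y) ∧ G.Adj (c 0) y := by
    obtain ⟨w, hw, hw1, hwl⟩ := hthree (c 0) (c 1) (c (n - 1))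
    refine ⟨w, ?_, hw⟩
    rintro k hk rfl
    rcases Nat.eq_zero_or_pos k with rfl | hpos
    · exact hw.ne rfl
    · rcases hc.chord hmin hpos hk hw with rfl | ⟨-, rfl⟩
      · exact hw1 rfl
      · exact hwl rfl
  refine not_globallyRigid_of_matching_cut_s7 G {v | ∃ k < n, c k = v} ?_ ?_
    ⟨c 1, ⟨1, by omega, rfl⟩, y, ?_, ?_⟩
  · rintro _ ⟨i, hi, rfl⟩ y hy z hz
    exact houter i hi y z (fun k hk h => hy ⟨k, hk, h⟩) (fun k hk h => hz ⟨k, hk, h⟩)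
  · rintro _ ⟨i, hi, rfl⟩ _ ⟨j, hj, rfl⟩ z hz h1 h2
    rw [hinner i j hi hj z (fun k hk h => hz ⟨k, hk, h⟩) h1 h2]
  · rintro ⟨k, hk, h⟩
    exact hy k hk h
  · intro h1
    exact absurd (hinner 0 1 (by omega) (by omega) y hy hy0 h1) (by norm_num)
end

section
/- There exists ε₀ > 0 such that for every ε with 0 < ε ≤ ε₀, every positive integer n, and every simple graph G on a vertex set V with |V| = n satisfying property (P3) — for every pair of disjoint sets X, Y ⊆ V with |X| ≥ ε·n and |Y| ≥ ε·n there exist x ∈ X and y ∈ Y adjacent in G — there exists a subset V' ⊆ V with |V'| ≥ (1 − ε)·n such that the induced subgraph G[V'] is globally rigid in ℝ. -/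
open Classical in
/-- The external neighbourhood of a set of vertices. -/
noncomputable def outerNeighbors {V : Type*} [Fintype V] (G : SimpleGraph V)
    (B : Finset V) : Finset V :=
  Finset.univ.filter fun u => u ∉ B ∧ ∃ v ∈ B, G.Adj v u

theorem mem_outerNeighbors {V : Type*} [Fintype V] {G : SimpleGraph V} {B : Finset V} {u : V} :
    u ∈ outerNeighbors G B ↔ u ∉ B ∧ ∃ v ∈ B, G.Adj v u := by
  simp [outerNeighbors]

/-- Any two disjoint sets of at least `K` vertices are joined by an edge. -/
def JoinsLargeSets {V : Type*} (G : SimpleGraph V) (K : ℕ) : Prop :=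
  ∀ X Y : Finset V, Disjoint X Y → K ≤ X.card → K ≤ Y.card → ∃ x ∈ X, ∃ y ∈ Y, G.Adj x y

open Classical in
/-- If all fibres of `a` are small, then some union of fibres has size close to any target. -/
theorem exists_union_of_fibers_card {U α : Type*} [Fintype U] (a : U → α) {s T : ℕ}
    (h0 : 0 < s) (hs : ∀ r, (Finset.univ.filter fun u => a u = r).card < s) (hT : T ≤ Fintype.card U) :
    ∃ S : Finset α, T ≤ (Finset.univ.filter fun u => a u ∈ S).card ∧
      (Finset.univ.filter fun u => a u ∈ S).card < T + s := by
  suffices h : ∀ S : Finset α, T ≤ (Finset.univ.filter fun u => a u ∈ S).card →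
      ∃ S : Finset α, T ≤ (Finset.univ.filter fun u => a u ∈ S).card ∧
        (Finset.univ.filter fun u => a u ∈ S).card < T + s by
    apply h (Finset.univ.image a)
    simpa using hT
  intro S
  induction S using Finset.induction_on with
  | empty =>
    exact fun h => ⟨∅, h, by simp; omega⟩
  | insert r S _ ih =>
    intro h
    by_cases hST : T ≤ (Finset.univ.filter fun u => a u ∈ S).card
    · exact ih hST
    · refine ⟨insert r S, h, ?_⟩
      have hsub : (Finset.univ.filter fun u => a u ∈ insert r S) ⊆
          (Finset.univ.filter fun u => a u = r) ∪ (Finset.univ.filter fun u => a u ∈ S) := by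
        intro u
        simp
      have h1 := (Finset.card_le_card hsub).trans (Finset.card_union_le _ _)
      have h2 := hs r
      omega

open Classical in
/-- If a line contains many points of a rook placement of an expanding graph, then it contains
all of them. -/
theorem eq_of_large_fiber {U α β : Type*} [Fintype U] {G : SimpleGraph U} {K : ℕ}
    (hG : JoinsLargeSets G K)
    (hexp : ∀ L : Finset U, L.Nonempty → L.card < 2 * K → L.card < (outerNeighbors G L).card)
    {a : U → α} {b : U → β} (hinj : ∀ u v, a u = a v → b u = b v → u = v)
    (hadj : ∀ u v, G.Adj u v → a u = a v ∨ b u = b v) {r : α}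
    (hr : 2 * K ≤ (Finset.univ.filter fun u => a u = r).card) (u : U) : a u = r := by
  set L := Finset.univ.filter fun u => a u ≠ r with hL
  have key : ∀ X Y : Finset U, (∀ x ∈ X, a x = r) → K ≤ X.card → K ≤ Y.card →
      (∀ y ∈ Y, a y ≠ r) → (∀ y ∈ Y, ∀ x ∈ X, b x ≠ b y) → False := by
    intro X Y hX hXK hYK hY hXY
    have hd : Disjoint X Y := Finset.disjoint_left.2 fun x hx hy => hY x hy (hX x hx)
    obtain ⟨x, hx, y, hy, h⟩ := hG X Y hd hXK hYK
    rcases hadj x y h with h | h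
    · exact hY y hy (h ▸ hX x hx)
    · exact hXY y hy x hx h
  have hLcard : L.card < 2 * K := by
    by_contra! hLK
    obtain ⟨X, hX, hXK⟩ := Finset.exists_subset_card_eq (show K ≤
      (Finset.univ.filter fun u => a u = r).card by omega)
    set X' := (Finset.univ.filter fun u => a u = r) \ X with hX'
    have hX'K : K ≤ X'.card := by
      rw [hX', Finset.card_sdiff_of_subset hX]
      omega
    have hXr : ∀ x ∈ X, a x = r := fun x hx => (Finset.mem_filter.1 (hX hx)).2
    have hX'r : ∀ x ∈ X', a x = r := fun x hx =>
      (Finset.mem_filter.1 (Finset.mem_sdiff.1 hx).1).2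
    have hLsub : L ⊆ (L.filter fun y => ∀ x ∈ X, b x ≠ b y) ∪
        (L.filter fun y => ∀ x ∈ X', b x ≠ b y) := by
      intro y hy
      by_contra hcon
      simp only [Finset.mem_union, Finset.mem_filter, hy, true_and, not_or] at hcon
      push Not at hcon
      obtain ⟨⟨x, hx, hxy⟩, x', hx', hxy'⟩ := hcon
      have : x = x' := hinj x x' ((hXr x hx).trans (hX'r x' hx').symm) (hxy.trans hxy'.symm)
      exact (Finset.mem_sdiff.1 hx').2 (this ▸ hx)
    have hcard := (Finset.card_le_card hLsub).trans (Finset.card_union_le _ _)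
    have hLr : ∀ y ∈ L, a y ≠ r := fun y hy => (Finset.mem_filter.1 hy).2
    rcases le_or_gt K (L.filter fun y => ∀ x ∈ X, b x ≠ b y).card with h | h
    · exact key X _ hXr hXK.ge h (fun y hy => hLr y (Finset.mem_filter.1 hy).1)
        (fun y hy => (Finset.mem_filter.1 hy).2)
    · exact key X' (L.filter fun y => ∀ x ∈ X', b x ≠ b y) hX'r hX'K (by omega)
        (fun y hy => hLr y (Finset.mem_filter.1 hy).1) (fun y hy => (Finset.mem_filter.1 hy).2)
  by_contra hu
  have hlt := hexp L ⟨u, by simp [hL, hu]⟩ hLcard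
  have hN : ∀ w ∈ outerNeighbors G L, a w = r ∧ ∃ v ∈ L, b v = b w := by
    intro w hw
    obtain ⟨hwL, v, hv, hvw⟩ := mem_outerNeighbors.1 hw
    have hwr : a w = r := by simpa [hL] using hwL
    refine ⟨hwr, v, hv, (hadj v w hvw).resolve_left fun h => ?_⟩
    exact (Finset.mem_filter.1 hv).2 (h.trans hwr)
  have hle : ((outerNeighbors G L).image b).card ≤ (L.image b).card := by
    apply Finset.card_le_card
    intro c hc
    obtain ⟨w, hw, rfl⟩ := Finset.mem_image.1 hc
    obtain ⟨v, hv, hvw⟩ := (hN w hw).2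
    exact Finset.mem_image.2 ⟨v, hv, hvw⟩
  rw [Finset.card_image_of_injOn fun w hw w' hw' h =>
    hinj w w' ((hN w hw).1.trans (hN w' hw').1.symm) h] at hle
  have := Finset.card_image_le (s := L) (f := b)
  omega

open Classical in
theorem rook_placement_collinear {U α β : Type*} [Fintype U] {G : SimpleGraph U} {K : ℕ}
    (hK : 0 < K) (hU : 9 * K ≤ Fintype.card U) (hG : JoinsLargeSets G K)
    (hexp : ∀ L : Finset U, L.Nonempty → L.card < 2 * K → L.card < (outerNeighbors G L).card)
    {a : U → α} {b : U → β} (hinj : ∀ u v, a u = a v → b u = b v → u = v)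
    (hadj : ∀ u v, G.Adj u v → a u = a v ∨ b u = b v) :
    (∃ r, ∀ u, a u = r) ∨ (∃ r, ∀ u, b u = r) := by
  by_cases ha : ∃ r, 2 * K ≤ (Finset.univ.filter fun u => a u = r).card
  · obtain ⟨r, hr⟩ := ha
    exact Or.inl ⟨r, eq_of_large_fiber hG hexp hinj hadj hr⟩
  by_cases hb : ∃ r, 2 * K ≤ (Finset.univ.filter fun u => b u = r).card
  · obtain ⟨r, hr⟩ := hb
    exact Or.inr ⟨r, eq_of_large_fiber hG hexp (fun u v h h' => hinj u v h' h)
      (fun u v h => (hadj u v h).symm) hr⟩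
  push Not at ha hb
  exfalso
  obtain ⟨S, hS, hS'⟩ := exists_union_of_fibers_card a (by omega) ha (T := 2 * K) (by omega)
  obtain ⟨T, hT, hT'⟩ := exists_union_of_fibers_card b (by omega) hb (T := 2 * K) (by omega)
  have key : ∀ X Y : Finset U,
      (∀ x ∈ X, ∀ y ∈ Y, ¬ (a x ∈ S ↔ a y ∈ S) ∧ ¬ (b x ∈ T ↔ b y ∈ T)) →
      X.card < K ∨ Y.card < K := by
    intro X Y hXY
    by_contra! hcon
    obtain ⟨x, hx, y, hy, h⟩ := hG X Y (Finset.disjoint_left.2 fun u hu hu' =>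
      (hXY u hu u hu').1 Iff.rfl) hcon.1 hcon.2
    rcases hadj x y h with h | h
    · exact (hXY x hx y hy).1 (by rw [h])
    · exact (hXY x hx y hy).2 (by rw [h])
  have k1 := key (Finset.univ.filter fun u => a u ∈ S ∧ b u ∈ T)
    (Finset.univ.filter fun u => a u ∉ S ∧ b u ∉ T) (by simp; tauto)
  have k2 := key (Finset.univ.filter fun u => a u ∈ S ∧ b u ∉ T)
    (Finset.univ.filter fun u => a u ∉ S ∧ b u ∈ T) (by simp; tauto)
  have e1 := Finset.card_filter_add_card_filter_not
    (s := Finset.univ.filter fun u => a u ∈ S) (fun u => b u ∈ T)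
  have e2 := Finset.card_filter_add_card_filter_not
    (s := Finset.univ.filter fun u => a u ∉ S) (fun u => b u ∈ T)
  have e3 := Finset.card_filter_add_card_filter_not
    (s := (Finset.univ : Finset U)) (fun u => a u ∈ S)
  have e4 := Finset.card_filter_add_card_filter_not
    (s := Finset.univ.filter fun u => b u ∈ T) (fun u => a u ∈ S)
  simp only [Finset.filter_filter, Finset.card_univ] at e1 e2 e3 e4
  simp only [and_comm (a := b _ ∈ T)] at e4
  omega

theorem globallyRigid_of_expansion {U : Type*} [Fintype U] {G : SimpleGraph U} {K : ℕ}
    (hK : 0 < K) (hU : 9 * K ≤ Fintype.card U) (hG : JoinsLargeSets G K)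
    (hexp : ∀ L : Finset U, L.Nonempty → L.card < 2 * K →
      L.card < (outerNeighbors G L).card) : GloballyRigid G := by
  intro f g hf _ hfg x y
  have h := rook_placement_collinear (a := fun u => f u - g u) (b := fun u => f u + g u)
    hK hU hG hexp (fun u v h h' => hf (by linarith)) (fun u v huv => by
      rcases abs_eq_abs.1 (hfg u v huv) with h | h
      · left; linarith
      · right; linarith)
  rcases h with ⟨r, hr⟩ | ⟨r, hr⟩
  · congr 1
    linarith [hr x, hr y]
  · rw [abs_eq_abs]
    right
    linarith [hr x, hr y]

open Classical in
/-- Removing a largest non-expanding set of bounded size leaves an expanding graph. -/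
theorem exists_expanding_compl {V : Type*} [Fintype V] {G : SimpleGraph V} {K : ℕ}
    (hV : 7 * K ≤ Fintype.card V) (hG : JoinsLargeSets G K) :
    ∃ B : Finset V, B.card < K ∧ ∀ L : Finset V, Disjoint L B → L.Nonempty → L.card < 2 * K →
      L.card < (outerNeighbors G L \ B).card := by
  have small : ∀ B : Finset V, B.card ≤ 3 * K → (outerNeighbors G B).card ≤ B.card →
      B.card < K := by
    intro B hB hN
    by_contra! hBK
    have h1 := Finset.card_compl_add_card (B ∪ outerNeighbors G B)
    have h2 := Finset.card_union_le B (outerNeighbors G B)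
    obtain ⟨x, hx, y, hy, h⟩ := hG B (B ∪ outerNeighbors G B)ᶜ
      (Finset.disjoint_left.2 fun x hx hx' => by simp [hx] at hx') hBK (by omega)
    simp only [Finset.mem_compl, Finset.mem_union, not_or, mem_outerNeighbors] at hy
    exact hy.2 ⟨hy.1, x, hx, h⟩
  obtain ⟨B, hB, hmax⟩ := Finset.exists_max_image
    (Finset.univ.filter fun B : Finset V => B.card ≤ 3 * K ∧
      (outerNeighbors G B).card ≤ B.card) Finset.card
    ⟨∅, Finset.mem_filter.2 ⟨Finset.mem_univ _, by simp, by simp [outerNeighbors]⟩⟩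
  simp only [Finset.mem_filter, Finset.mem_univ, true_and] at hB hmax
  have hBK := small B hB.1 hB.2
  refine ⟨B, hBK, fun L hd hne hL => ?_⟩
  by_contra! hcon
  have hcard := Finset.card_union_of_disjoint hd
  have hsub : outerNeighbors G (L ∪ B) ⊆ (outerNeighbors G L \ B) ∪ outerNeighbors G B := by
    intro u hu
    simp only [Finset.mem_union, Finset.mem_sdiff, mem_outerNeighbors] at hu ⊢
    grind
  have h1 := (Finset.card_le_card hsub).trans (Finset.card_union_le _ _)
  have h2 := hmax (L ∪ B) ⟨by omega, by omega⟩
  have := hne.card_pos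
  omega

theorem stmt8 : ∃ ε₀ : ℝ, 0 < ε₀ ∧
    ∀ ε : ℝ, 0 < ε → ε ≤ ε₀ →
    ∀ n : ℕ, 0 < n →
    ∀ (V : Type) [Fintype V], Fintype.card V = n →
    ∀ G : SimpleGraph V,
      (∀ X Y : Finset V, Disjoint X Y → ε * n ≤ X.card → ε * n ≤ Y.card →
        ∃ x ∈ X, ∃ y ∈ Y, G.Adj x y) →
      ∃ V' : Finset V, (1 - ε) * n ≤ V'.card ∧
        GloballyRigid (G.induce (V' : Set V)) := by
  classical
  refine ⟨1 / 20, by norm_num, ?_⟩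
  intro ε hε hε' n hn V _ hcard G hG
  have hn' : (0 : ℝ) < n := by exact_mod_cast hn
  have hεn : 0 < ε * n := mul_pos hε hn'
  rcases le_or_gt (ε * n) 1 with h1 | h1
  · refine ⟨Finset.univ, ?_, ?_⟩
    · rw [Finset.card_univ, hcard]
      linarith
    · intro f g _ _ hfg x y
      by_cases hxy : x = y
      · simp [hxy]
      · apply hfg
        have := hG {x.1} {y.1} 
          (Finset.disjoint_singleton.2 fun h => hxy (Subtype.ext h)) (by simpa) (by simpa)
        simpa using this
  set K := ⌈ε * n⌉₊
  have hK : 0 < K := Nat.ceil_pos.2 hεn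
  have hK10 : 10 * K ≤ n := by
    have h2 : (K : ℝ) < ε * n + 1 := Nat.ceil_lt_add_one hεn.le
    have h3 : ε * n ≤ 1 / 20 * n := by gcongr
    have h4 : (10 * K : ℝ) ≤ n := by linarith
    exact_mod_cast h4
  have hGK : JoinsLargeSets G K := fun X Y hd hX hY =>
    hG X Y hd (Nat.ceil_le.1 hX) (Nat.ceil_le.1 hY)
  obtain ⟨B, hBK, hB⟩ := exists_expanding_compl (by omega) hGK
  have hBc := Finset.card_compl_add_card B
  refine ⟨Bᶜ, ?_, globallyRigid_of_expansion hK ?_ ?_ ?_⟩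
  · have h2 : (B.card : ℝ) < ε * n := Nat.lt_ceil.1 hBK
    have h3 : ((Bᶜ).card : ℝ) + B.card = n := by
      rw [← hcard]
      exact_mod_cast hBc
    linarith
  · have : Fintype.card ((Bᶜ : Finset V) : Set V) = (Bᶜ).card := by
      rw [← Set.toFinset_card, Finset.toFinset_coe]
    omega
  · intro X Y hd hX hY
    obtain ⟨x, hx, y, hy, h⟩ := hGK (X.map (Function.Embedding.subtype _))
      (Y.map (Function.Embedding.subtype _)) ((Finset.disjoint_map _).2 hd) (by simpa) (by simpa)
    obtain ⟨x, hxX, rfl⟩ := Finset.mem_map.1 hx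
    obtain ⟨y, hyY, rfl⟩ := Finset.mem_map.1 hy
    exact ⟨x, hxX, y, hyY, h⟩
  · intro L hne hL
    have h := hB (L.map (Function.Embedding.subtype _))
      (Finset.disjoint_left.2 fun x hx hxB => by
        obtain ⟨x, -, rfl⟩ := Finset.mem_map.1 hx
        exact Finset.mem_compl.1 x.2 hxB) (hne.map) (by simpa)
    rw [Finset.card_map] at h
    refine h.trans_le ?_
    rw [← Finset.card_map (Function.Embedding.subtype _)]
    apply Finset.card_le_card
    intro u hu
    obtain ⟨hu, huB⟩ := Finset.mem_sdiff.1 hu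
    obtain ⟨huL, v, hv, hvu⟩ := mem_outerNeighbors.1 hu
    obtain ⟨v, hvL, rfl⟩ := Finset.mem_map.1 hv
    refine Finset.mem_map.2 ⟨⟨u, by simpa using huB⟩, mem_outerNeighbors.2 ⟨fun hc => ?_, v, hvL,
      hvu⟩, rfl⟩
    exact huL (Finset.mem_map.2 ⟨_, hc, rfl⟩)
end

section
/- Let G be a simple graph on a vertex set V with |V| = n. Suppose that (i) for every pair of disjoint sets X, Y ⊆ V with |X| ≥ n/100 and |Y| ≥ n/100 there exist x ∈ X and y ∈ Y adjacent in G, and (ii) for every U ⊆ V with n/2 < |U| < n there exists a vertex v ∈ V ∖ U with at least two neighbors in U. Then G is globally rigid in ℝ. -/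
open Finset in
open Classical in
/-- If `m * #A ≥ t > 0`, some finite set `T` of values of `k` captures at least `t / m` elements
of `A`, and drops below that threshold once a suitable value `r` is removed. -/
theorem exists_threshold_values {V κ : Type*} (A : Finset V) (k : V → κ) (m t : ℕ)
    (ht : 0 < t) (hA : t ≤ m * #A) :
    ∃ T : Finset κ, t ≤ m * #{x ∈ A | k x ∈ T} ∧
      ∃ r, m * #{x ∈ A | k x ∈ T} < t + m * #{x ∈ A | k x = r} := by
  have hex : ∃ T : Finset κ, t ≤ m * #{x ∈ A | k x ∈ T} := by
    refine ⟨A.image k, ?_⟩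
    rwa [filter_true_of_mem fun x hx => mem_image_of_mem k hx]
  obtain ⟨T, hmin⟩ := exists_minimal_of_wellFoundedLT _ hex
  have hT := hmin.prop
  refine ⟨T, hT, ?_⟩
  have hne : T.Nonempty := by
    by_contra h
    rw [not_nonempty_iff_eq_empty] at h
    rw [h] at hT
    simp only [notMem_empty, filter_false, card_empty, mul_zero] at hT
    omega
  obtain ⟨r, hr⟩ := hne
  refine ⟨r, ?_⟩
  have hlt : m * #{x ∈ A | k x ∈ T.erase r} < t := by
    by_contra h
    exact hmin.not_prop_of_lt (erase_ssubset hr) (not_lt.mp h)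
  have hsub : #{x ∈ A | k x ∈ T} ≤ #{x ∈ A | k x ∈ T.erase r} + #{x ∈ A | k x = r} := by
    refine (card_le_card ?_).trans (card_union_le _ _)
    intro x
    simp only [mem_filter, mem_union, mem_erase]
    tauto
  have := Nat.mul_le_mul_left m hsub
  rw [mul_add] at this
  omega

open Finset in
open Classical in
/-- If any two disjoint sets of at least a hundredth of the points contain points with a common
`a`-value or a common `b`-value, then some fibre of `a` or of `b` has more than half of all
points. -/
theorem exists_majority_fiber {V α β : Type*} [Fintype V] (a : V → α) (b : V → β)
    (hpos : 0 < Fintype.card V)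
    (h : ∀ X Y : Finset V, Disjoint X Y → Fintype.card V ≤ 100 * #X →
      Fintype.card V ≤ 100 * #Y → ∃ x ∈ X, ∃ y ∈ Y, a x = a y ∨ b x = b y) :
    (∃ r, Fintype.card V < 2 * #{x | a x = r}) ∨ ∃ r, Fintype.card V < 2 * #{x | b x = r} := by
  by_contra! hcon
  obtain ⟨ha, hb⟩ := hcon
  obtain ⟨T, hT, r, hr⟩ := exists_threshold_values univ a 4 (Fintype.card V) hpos
    (by rw [card_univ]; omega)
  have hra := ha r
  set A₁ : Finset V := {x | a x ∈ T} with hA₁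
  set A₂ : Finset V := {x | ¬ a x ∈ T} with hA₂
  have hA : #A₁ + #A₂ = Fintype.card V := card_filter_add_card_filter_not _
  have hsep (S : Finset β) :
      (Fintype.card V ≤ 100 * #{x ∈ A₁ | b x ∈ S} →
        100 * #{x ∈ A₂ | ¬ b x ∈ S} < Fintype.card V) ∧
      (Fintype.card V ≤ 100 * #{x ∈ A₂ | b x ∈ S} →
        100 * #{x ∈ A₁ | ¬ b x ∈ S} < Fintype.card V) := by
    constructor <;> intro h₁ <;> by_contra! h₂
    all_goals
      obtain ⟨x, hx, y, hy, hxy⟩ := h _ _ (by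
        rw [disjoint_left]
        intro x
        simp only [mem_filter]
        tauto) h₁ h₂
      simp only [hA₁, hA₂, mem_filter, mem_univ, true_and] at hx hy
      rcases hxy with e | e <;> rw [e] at hx <;> tauto
  have hsplit (A : Finset V) (S : Finset β) :
      #{x ∈ A | b x ∈ S} + #{x ∈ A | ¬ b x ∈ S} = #A := card_filter_add_card_filter_not _
  obtain ⟨S, hS, s, hs⟩ := exists_threshold_values A₁ b 100 (Fintype.card V) hpos (by omega)
  have h₁ := hsep S
  have h₂ := hsplit A₁ S
  have h₃ := hsplit A₂ S
  have h₄ := hsep {s}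
  have h₅ := hsplit A₁ {s}
  have h₆ := hsplit A₂ {s}
  simp only [mem_singleton] at h₄ h₅ h₆
  have h₇ : #{x ∈ A₁ | b x = s} + #{x ∈ A₂ | b x = s} = #{x | b x = s} := by
    rw [← card_filter_add_card_filter_not (s := {x | b x = s}) (fun x => a x ∈ T),
      hA₁, hA₂, filter_comm, filter_comm (s := univ) (p := fun x => ¬ a x ∈ T)]
  have h₈ := hb s
  omega

open Finset in
open Classical in
/-- Suppose `a` and `b` jointly separate points, adjacent vertices agree in `a` or in `b`, and
every proper vertex set with more than half of the vertices has two neighbours of some outside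
vertex. Then `a` is constant as soon as it has a fibre with more than half of the vertices. -/
theorem eq_of_majority_fiber {V α β : Type*} [Fintype V] (G : SimpleGraph V)
    (h2 : ∀ U : Finset V, Fintype.card V < 2 * #U → #U < Fintype.card V →
      ∃ v : V, v ∉ U ∧ 2 ≤ {u : V | u ∈ U ∧ G.Adj v u}.ncard)
    (a : V → α) (b : V → β) (hinj : ∀ x y, a x = a y → b x = b y → x = y)
    (hadj : ∀ x y, G.Adj x y → a x = a y ∨ b x = b y)
    (r : α) (hr : Fintype.card V < 2 * #{x | a x = r}) (x : V) : a x = r := by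
  by_contra hx
  have hlt : #{x | a x = r} < Fintype.card V :=
    card_lt_univ_of_notMem (x := x) (by simpa using hx)
  obtain ⟨v, hv, hcard⟩ := h2 _ hr hlt
  obtain ⟨u, ⟨hu, huv⟩, w, ⟨hw, hwv⟩, hne⟩ :=
    (Set.one_lt_ncard (Set.toFinite _)).mp hcard
  simp only [mem_filter, mem_univ, true_and] at hv hu hw
  have hbu : b v = b u := (hadj v u huv).resolve_left fun e => hv (e.trans hu)
  have hbw : b v = b w := (hadj v w hwv).resolve_left fun e => hv (e.trans hw)
  exact hne (hinj u w (hu.trans hw.symm) (hbu.symm.trans hbw))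

theorem stmt9 {V : Type*} [Fintype V] (n : ℕ) (hcard : Fintype.card V = n)
    (G : SimpleGraph V)
    (h1 : ∀ X Y : Finset V, Disjoint X Y →
      (n : ℝ) / 100 ≤ X.card → (n : ℝ) / 100 ≤ Y.card →
      ∃ x ∈ X, ∃ y ∈ Y, G.Adj x y)
    (h2 : ∀ U : Finset V, (n : ℝ) / 2 < U.card → U.card < n →
      ∃ v : V, v ∉ U ∧ 2 ≤ {u : V | u ∈ U ∧ G.Adj v u}.ncard) :
    GloballyRigid G := by
  subst hcard
  intro f g hf _ hfg x y
  have hadj (x y : V) (h : G.Adj x y) : f x - g x = f y - g y ∨ f x + g x = f y + g y := by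
    rcases abs_eq_abs.mp (hfg x y h) with e | e
    · left; linarith
    · right; linarith
  have h2' (U : Finset V) (hU : Fintype.card V < 2 * U.card) (hU' : U.card < Fintype.card V) :
      ∃ v : V, v ∉ U ∧ 2 ≤ {u : V | u ∈ U ∧ G.Adj v u}.ncard := by
    refine h2 U ?_ hU'
    have : (Fintype.card V : ℝ) < 2 * U.card := by exact_mod_cast hU
    linarith
  have hlarge (X : Finset V) (hX : Fintype.card V ≤ 100 * X.card) :
      (Fintype.card V : ℝ) / 100 ≤ X.card := by
    have : (Fintype.card V : ℝ) ≤ 100 * X.card := by exact_mod_cast hX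
    linarith
  rcases exists_majority_fiber (fun x => f x - g x) (fun x => f x + g x)
      (Fintype.card_pos_iff.mpr ⟨x⟩) (fun X Y hd hX hY => by
        obtain ⟨x, hx, y, hy, hxy⟩ := h1 X Y hd (hlarge X hX) (hlarge Y hY)
        exact ⟨x, hx, y, hy, hadj x y hxy⟩) with ⟨r, hr⟩ | ⟨r, hr⟩
  · have key := eq_of_majority_fiber G h2' (fun x => f x - g x) (fun x => f x + g x)
      (fun x y h h' => hf (by linarith)) hadj r hr
    have hx := key x
    have hy := key y
    exact abs_eq_abs.mpr (Or.inl (by linarith))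
  · have key := eq_of_majority_fiber G h2' (fun x => f x + g x) (fun x => f x - g x)
      (fun x y h h' => hf (by linarith)) (fun x y h => (hadj x y h).symm) r hr
    have hx := key x
    have hy := key y
    exact abs_eq_abs.mpr (Or.inr (by linarith))
end

section
/- Let G be a simple graph on a finite vertex set V and let s be a positive integer such that for every pair of disjoint sets X, Y ⊆ V with |X| ≥ s and |Y| ≥ s there exist x ∈ X and y ∈ Y adjacent in G. Let U ⊆ V satisfy |U| > 2s and |V ∖ U| ≥ s. Then there exists a vertex v ∈ V ∖ U having at least two neighbors in U. -/
theorem stmt13 {V : Type*} [Fintype V] (G : SimpleGraph V) (s : ℕ) (hs : 0 < s)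
    (h : ∀ X Y : Finset V, Disjoint X Y → s ≤ X.card → s ≤ Y.card →
      ∃ x ∈ X, ∃ y ∈ Y, G.Adj x y)
    (U : Finset V) (hU : 2 * s < U.card)
    (hUc : s ≤ Fintype.card V - U.card) :
    ∃ v : V, v ∉ U ∧ 2 ≤ {u : V | u ∈ U ∧ G.Adj v u}.ncard := by
  classical
  by_contra! hfew
  obtain ⟨Y, hYU, hY⟩ := Finset.exists_subset_card_eq (Finset.card_compl U ▸ hUc)
  let N : Finset V := Y.biUnion fun v => U.filter (G.Adj v)
  have hN : N.card ≤ s := by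
    have hdeg : ∀ v ∈ Y, (U.filter (G.Adj v)).card ≤ 1 := fun v hv => by
      have hv' := hfew v (Finset.mem_compl.mp (hYU hv))
      have hcoe : {u : V | u ∈ U ∧ G.Adj v u} = (U.filter (G.Adj v) : Finset V) := by
        ext; simp
      rw [hcoe, Set.ncard_coe_finset] at hv'
      omega
    simpa [hY] using Finset.card_biUnion_le_card_mul Y _ 1 hdeg
  have hX : s ≤ (U \ N).card := by
    have := Finset.le_card_sdiff N U
    omega
  have hdisj : Disjoint (U \ N) Y :=
    Finset.disjoint_left.mpr fun _ hx hy =>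
      Finset.mem_compl.mp (hYU hy) (Finset.mem_sdiff.mp hx).1
  obtain ⟨x, hx, y, hy, hxy⟩ := h (U \ N) Y hdisj hX hY.ge
  obtain ⟨hxU, hxN⟩ := Finset.mem_sdiff.mp hx
  exact hxN (Finset.mem_biUnion.mpr ⟨y, hy, Finset.mem_filter.mpr ⟨hxU, hxy.symm⟩⟩)
end

section
/- Let G be a simple graph on a finite vertex set V and let k be a positive integer. Suppose that for every vertex v ∈ V there exists a set A_v ⊆ V with v ∈ A_v and |A_v| ≤ k such that every vertex of A_v has at most one neighbor in V ∖ A_v and every vertex of V ∖ A_v has at most one neighbor in A_v. Then for every subset V' ⊆ V with |V'| ≥ k + 2 and |V'| ≥ 3, the induced subgraph G[V'] is not globally rigid in ℝ. -/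
/-- A finite graph with a matching cut `(A, Aᶜ)` that misses some pair in `A × Aᶜ` is not globally
rigid in `ℝ`: translating `Aᶜ` preserves the edge lengths of a suitable embedding. -/
theorem not_globallyRigid_of_matching_cut_s14 {W : Type*} [Finite W] (G : SimpleGraph W) (A : Set W)
    (hA : ∀ a ∈ A, ∀ b ∉ A, ∀ b' ∉ A, G.Adj a b → G.Adj a b' → b = b')
    (hB : ∀ b ∉ A, ∀ a ∈ A, ∀ a' ∈ A, G.Adj b a → G.Adj b a' → a = a')
    {a₀ b₀ : W} (ha₀ : a₀ ∈ A) (hb₀ : b₀ ∉ A) (hab : ¬ G.Adj a₀ b₀) :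
    ¬ GloballyRigid G := by
  classical
  obtain ⟨e, he⟩ := Countable.exists_injective_nat W
  have hq : ∀ x, ∃ n : ℤ, (x ∈ A → n = 4 * e x) ∧
      (x ∉ A → (∃ a ∈ A, G.Adj x a ∧ n = 4 * e a) ∨
        ((∀ a ∈ A, ¬ G.Adj x a) ∧ n = 4 * e x + 1)) := by
    intro x
    by_cases hx : x ∈ A
    · exact ⟨4 * e x, fun _ => rfl, fun h => absurd hx h⟩
    · by_cases hm : ∃ a ∈ A, G.Adj x a
      · obtain ⟨a, ha, hxa⟩ := hm
        exact ⟨4 * e a, fun h => absurd h hx, fun _ => Or.inl ⟨a, ha, hxa, rfl⟩⟩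
      · push Not at hm
        exact ⟨4 * e x + 1, fun h => absurd h hx, fun _ => Or.inr ⟨hm, rfl⟩⟩
  choose q hqA hqB using hq
  have hcross : ∀ a ∈ A, ∀ b ∉ A, q a = q b ↔ G.Adj a b := by
    intro a ha b hb
    have h1 := hqA a ha
    constructor
    · intro h
      rcases hqB b hb with ⟨a', ha', hba', h2⟩ | ⟨-, h2⟩
      · obtain rfl : a = a' := he (by omega)
        exact hba'.symm
      · omega
    · intro h
      rcases hqB b hb with ⟨a', ha', hba', h2⟩ | ⟨h2, -⟩
      · obtain rfl := hB b hb a ha a' ha' h.symm hba'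
        omega
      · exact absurd h.symm (h2 a ha)
  have hinj : ∀ s : ℤ, s = 2 ∨ s = -2 →
      Function.Injective fun x => ((q x + if x ∈ A then 0 else s : ℤ) : ℝ) := by
    intro s hs x y hxy
    have hxy' : (q x + if x ∈ A then 0 else s) = q y + if y ∈ A then 0 else s :=
      Int.cast_injective hxy
    by_cases hx : x ∈ A <;> by_cases hy : y ∈ A <;> simp only [hx, hy, if_true, if_false] at hxy'
    · have := hqA x hx
      have := hqA y hy
      exact he (by omega)
    · have := hqA x hx
      rcases hqB y hy with ⟨a, -, -, h⟩ | ⟨-, h⟩ <;> omega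
    · have := hqA y hy
      rcases hqB x hx with ⟨a, -, -, h⟩ | ⟨-, h⟩ <;> omega
    · rcases hqB x hx with ⟨a, ha, hxa, h⟩ | ⟨-, h⟩ <;>
        rcases hqB y hy with ⟨a', -, hya, h'⟩ | ⟨-, h'⟩
      · obtain rfl : a = a' := he (by omega)
        exact hA a ha x hx y hy hxa.symm hya.symm
      · omega
      · omega
      · exact he (by omega)
  intro hrig
  have hdist := hrig _ _ (hinj 2 (Or.inl rfl)) (hinj (-2) (Or.inr rfl)) ?_ a₀ b₀
  · have hne := (hcross a₀ ha₀ b₀ hb₀).not.2 hab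
    simp only [ha₀, hb₀, if_true, if_false] at hdist
    rw [← Int.cast_sub, ← Int.cast_sub, ← Int.cast_abs, ← Int.cast_abs, Int.cast_inj,
      abs_eq_abs] at hdist
    omega
  · intro x y hadj
    rw [← Int.cast_sub, ← Int.cast_sub, ← Int.cast_abs, ← Int.cast_abs, Int.cast_inj,
      abs_eq_abs]
    by_cases hx : x ∈ A <;> by_cases hy : y ∈ A <;> simp only [hx, hy, if_true, if_false]
    · exact Or.inl trivial
    · have := (hcross x hx y hy).2 hadj
      omega
    · have := (hcross y hy x hx).2 hadj.symm
      omega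
    · exact Or.inl (by ring)

theorem stmt14 {V : Type*} [Fintype V] (G : SimpleGraph V) (k : ℕ) (hk : 0 < k)
    (h : ∀ v : V, ∃ A : Finset V, v ∈ A ∧ A.card ≤ k ∧
      (∀ a ∈ A, {b : V | b ∉ A ∧ G.Adj a b}.ncard ≤ 1) ∧
      (∀ b : V, b ∉ A → {a : V | a ∈ A ∧ G.Adj b a}.ncard ≤ 1)) :
    ∀ V' : Finset V, k + 2 ≤ V'.card → 3 ≤ V'.card →
      ¬ GloballyRigid (G.induce (V' : Set V)) := by
  intro V' hcard _
  obtain ⟨v, hv⟩ : V'.Nonempty := Finset.card_pos.1 (by omega)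
  obtain ⟨A, hvA, hAk, hA, hB⟩ := h v
  have hA' : ∀ a ∈ A, ∀ b ∉ A, ∀ b' ∉ A, G.Adj a b → G.Adj a b' → b = b' :=
    fun a ha b hb b' hb' h1 h2 =>
      (Set.ncard_le_one (Set.toFinite _)).1 (hA a ha) b ⟨hb, h1⟩ b' ⟨hb', h2⟩
  have hB' : ∀ b ∉ A, ∀ a ∈ A, ∀ a' ∈ A, G.Adj b a → G.Adj b a' → a = a' :=
    fun b hb a ha a' ha' h1 h2 =>
      (Set.ncard_le_one (Set.toFinite _)).1 (hB b hb) a ⟨ha, h1⟩ a' ⟨ha', h2⟩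
  classical
  obtain ⟨b, hb, c, hc, hbc⟩ : ∃ b ∈ V' \ A, ∃ c ∈ V' \ A, b ≠ c :=
    Finset.one_lt_card.1 (by have := Finset.le_card_sdiff A V'; omega)
  rw [Finset.mem_sdiff] at hb hc
  obtain ⟨w, hwV, hwA, hvw⟩ : ∃ w ∈ V', w ∉ A ∧ ¬ G.Adj v w := by
    by_cases hvb : G.Adj v b
    · exact ⟨c, hc.1, hc.2, fun hvc => hbc (hA' v hvA b hb.2 c hc.2 hvb hvc)⟩
    · exact ⟨b, hb.1, hb.2, hvb⟩
  exact not_globallyRigid_of_matching_cut_s14 (G.induce (V' : Set V)) {x | x.1 ∈ A}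
    (fun a ha b hb b' hb' h1 h2 => Subtype.ext (hA' a ha b hb b' hb' h1 h2))
    (fun b hb a ha a' ha' h1 h2 => Subtype.ext (hB' b hb a ha a' ha' h1 h2))
    (a₀ := ⟨v, hv⟩) (b₀ := ⟨w, hwV⟩) hvA hwA hvw
end

section
/- For every δ > 0 there exists N such that for every even n ≥ N the following holds: among all simple graphs on the vertex set Fin n in which every vertex has degree exactly 3, the number of graphs that are not globally rigid in ℝ is at least (1 − δ) times the total number of such 3-regular graphs. (In other words, a uniformly random 3-regular graph on n vertices is with high probability not globally rigid in ℝ.) -/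
namespace SimpleGraph

variable {V : Type*} {G : SimpleGraph V}

/-- The edges between `A` and its complement form a matching, and neither side is empty. -/
structure IsMatchingCut (G : SimpleGraph V) (A : Set V) : Prop where
  nonempty : A.Nonempty
  compl_nonempty : Aᶜ.Nonempty
  eq_of_adj_left : ∀ x ∈ A, ∀ y ∉ A, ∀ z ∉ A, G.Adj x y → G.Adj x z → y = z
  eq_of_adj_right : ∀ x ∈ A, ∀ y ∈ A, ∀ z ∉ A, G.Adj x z → G.Adj y z → x = y

/-- Slide the two sides of the cut apart, having given the ends of each cut edge the same
position, and then reflect one coordinate. -/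
theorem IsMatchingCut.not_globallyRigid [Finite V] {A : Set V} (hA : G.IsMatchingCut A)
    (hnt : A.Nontrivial) : ¬ GloballyRigid G := by
  classical
  obtain ⟨K, ⟨e⟩⟩ := Finite.exists_equiv_fin V
  have hinj : ∀ x y, ((e x : ℕ) : ℝ) = (e y : ℕ) → x = y := fun x y h =>
    e.injective (Fin.ext (by exact_mod_cast h))
  have hlt : ∀ x, ((e x : ℕ) : ℝ) < K := fun x => by exact_mod_cast (e x).isLt
  have hnn : ∀ x, (0 : ℝ) ≤ ((e x : ℕ) : ℝ) := fun x => Nat.cast_nonneg _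
  obtain ⟨b, hbA, hbm, hb0⟩ : ∃ b : V → ℝ, (∀ x ∈ A, b x = (e x : ℕ)) ∧
      (∀ x ∈ A, ∀ y ∉ A, G.Adj x y → b y = (e x : ℕ)) ∧
      (∀ y ∉ A, (¬ ∃ x ∈ A, G.Adj x y) → b y = (e y : ℕ) + K) := by
    refine ⟨fun v => if v ∈ A then ((e v : ℕ) : ℝ) else
      if h : ∃ u ∈ A, G.Adj u v then ((e h.choose : ℕ) : ℝ) else (e v : ℕ) + K, ?_, ?_, ?_⟩
    · intro x hx; simp [hx]
    · intro x hx y hy hxy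
      have h : ∃ u ∈ A, G.Adj u y := ⟨x, hx, hxy⟩
      have := hA.eq_of_adj_right _ h.choose_spec.1 _ hx _ hy h.choose_spec.2 hxy
      simp only [hy, if_false, dif_pos h, this]
    · intro y hy h
      simp only [hy, if_false, dif_neg h]
  have hbnn : ∀ x, 0 ≤ b x ∧ b x < 2 * K := by
    intro x
    by_cases hx : x ∈ A
    · rw [hbA x hx]; constructor <;> linarith [hlt x, hnn x]
    by_cases h : ∃ u ∈ A, G.Adj u x
    · obtain ⟨u, hu, hux⟩ := h
      rw [hbm u hu x hx hux]; constructor <;> linarith [hlt u, hnn u]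
    · rw [hb0 x hx h]; constructor <;> linarith [hlt x, hnn x]
  have hbinj : ∀ x y, (x ∈ A ↔ y ∈ A) → b x = b y → x = y := by
    intro x y hxy h
    by_cases hx : x ∈ A
    · rw [hbA x hx, hbA y (hxy.1 hx)] at h
      exact hinj _ _ h
    have hy : y ∉ A := fun hy => hx (hxy.2 hy)
    by_cases h1 : ∃ u ∈ A, G.Adj u x <;> by_cases h2 : ∃ u ∈ A, G.Adj u y
    · obtain ⟨u, hu, hux⟩ := h1
      obtain ⟨w, hw, hwy⟩ := h2
      rw [hbm u hu x hx hux, hbm w hw y hy hwy] at h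
      obtain rfl := hinj _ _ h
      exact hA.eq_of_adj_left u hu x hx y hy hux hwy
    · obtain ⟨u, hu, hux⟩ := h1
      rw [hbm u hu x hx hux, hb0 y hy h2] at h
      linarith [hlt u, hnn y]
    · obtain ⟨u, hu, huy⟩ := h2
      rw [hbm u hu y hy huy, hb0 x hx h1] at h
      linarith [hlt u, hnn x]
    · rw [hb0 x hx h1, hb0 y hy h2] at h
      exact hinj _ _ (by linarith)
  let a : V → ℝ := fun x => if x ∈ A then 2 * K else 0
  have haA : ∀ x ∈ A, a x = 2 * K := fun x hx => if_pos hx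
  have haB : ∀ x ∉ A, a x = 0 := fun x hx => if_neg hx
  have hinjf : Function.Injective (fun x => a x + b x) := by
    intro x y h
    simp only at h
    have := hbnn x
    have := hbnn y
    by_cases hx : x ∈ A <;> by_cases hy : y ∈ A <;>
      simp only [haA, haB, hx, hy, not_false_eq_true] at h
    · exact hbinj x y (by tauto) (by linarith)
    · linarith
    · linarith
    · exact hbinj x y (by tauto) (by linarith)
  have hinjg : Function.Injective (fun x => a x - b x) := by
    intro x y h
    simp only at h
    have := hbnn x
    have := hbnn y
    by_cases hx : x ∈ A <;> by_cases hy : y ∈ A <;>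
      simp only [haA, haB, hx, hy, not_false_eq_true] at h
    · exact hbinj x y (by tauto) (by linarith)
    · linarith
    · linarith
    · exact hbinj x y (by tauto) (by linarith)
  intro hrigid
  have key := hrigid _ _ hinjf hinjg (by
    intro x y hxy
    rw [abs_eq_abs]
    by_cases hx : x ∈ A <;> by_cases hy : y ∈ A <;>
      simp only [haA, haB, hx, hy, not_false_eq_true]
    · right; ring
    · left; rw [hbA x hx, hbm x hx y hy hxy]; ring
    · left; rw [hbA y hy, hbm y hy x hx hxy.symm]; ring
    · right; ring)
  obtain ⟨y, hy⟩ := hA.compl_nonempty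
  obtain ⟨x₁, hx₁, x₂, hx₂, hne⟩ := hnt
  have hall : ∀ x ∈ A, b x = b y := by
    intro x hx
    have h := key x y
    simp only [haA x hx, haB y hy] at h
    have := hlt x
    have := hnn x
    rcases abs_eq_abs.1 h with h | h <;> linarith
  exact hne (hbinj _ _ (by tauto) ((hall _ hx₁).trans (hall _ hx₂).symm))

theorem Walk.IsCycle.exists_isPath_two_mul_length_le {u x y : V} {c : G.Walk u u}
    (hc : c.IsCycle) (hx : x ∈ c.support) (hy : y ∈ c.support) :
    ∃ p : G.Walk x y, p.IsPath ∧ p.edges ⊆ c.edges ∧ 2 * p.length ≤ c.length := by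
  classical
  by_cases hxy : x = y
  · subst hxy
    exact ⟨.nil, by simp⟩
  have hc' := hc.rotate hx
  have hy' : y ∈ (c.rotate x hx).support := by
    simpa using hy
  have hlen : (c.rotate x hx).length = c.length := by simp
  have hedges : (c.rotate x hx).edges ⊆ c.edges := fun e he =>
    (c.rotate_edges x hx).mem_iff.1 he
  have hspec := (c.rotate x hx).take_spec hy'
  have hsum := congrArg Walk.length hspec
  rw [Walk.length_append, hlen] at hsum
  by_cases h : 2 * ((c.rotate x hx).takeUntil y hy').length ≤ c.length
  · exact ⟨_, hc'.isPath_takeUntil hy',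
      fun e he => hedges (Walk.edges_takeUntil_subset_edges _ hy' he), h⟩
  · refine ⟨((c.rotate x hx).dropUntil y hy').reverse, ?_, ?_, ?_⟩
    · rw [← hspec] at hc'
      exact (hc'.isPath_of_append_right (Walk.not_nil_of_ne hxy)).reverse
    · intro e he
      rw [Walk.edges_reverse, List.mem_reverse] at he
      exact hedges (Walk.edges_dropUntil_subset_edges _ hy' he)
    · rw [Walk.length_reverse]; omega

theorem Walk.IsPath.girth_le_of_adj {x y : V} {p : G.Walk x y} (hp : p.IsPath) (h : G.Adj y x)
    (he : s(y, x) ∉ p.edges) : G.girth ≤ p.length + 1 :=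
  girth_le_length ((Walk.cons_isCycle_iff p h).2 ⟨hp, he⟩)

theorem Walk.IsCycle.card_support_toFinset [DecidableEq V] {u : V} {c : G.Walk u u}
    (hc : c.IsCycle) :
    c.support.toFinset.card = c.length := by
  have h : c.support.toFinset = c.support.tail.toFinset := by
    ext x
    rw [List.mem_toFinset, List.mem_toFinset, Walk.mem_support_iff]
    exact ⟨fun h => h.elim (fun h => h ▸ c.end_mem_tail_support hc.not_nil) id, Or.inr⟩
  rw [h, List.toFinset_card_of_nodup hc.support_nodup]
  simp

variable [Fintype V] [DecidableRel G.Adj]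

theorem not_isAcyclic_of_two_le_degree [Nonempty V] (h : ∀ v, 2 ≤ G.degree v) :
    ¬ G.IsAcyclic := by
  intro hG
  obtain ⟨u, v, p, hp, hmax⟩ := Walk.exists_isPath_forall_isPath_length_le_length G
  have hcard : 1 < (G.neighborFinset u).card := h u
  obtain ⟨w, hw, hne⟩ := Finset.exists_mem_ne hcard p.snd
  rw [mem_neighborFinset] at hw
  by_cases hs : w ∈ p.support
  · exact hne (hG.eq_snd_of_adj_start hp hw hs)
  · have := hmax _ _ (Walk.cons hw.symm p) ((Walk.cons_isPath_iff _ _).2 ⟨hp, hs⟩)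
    simp at this

variable [DecidableEq V]

/-- A set spanning minimum degree at least two, whose outer vertices have at most one neighbour
in it, is one side of a matching cut of a cubic graph. -/
theorem isMatchingCut_of_two_le_card_inter (h3 : G.IsRegularOfDegree 3) {A : Finset V}
    (hne : A.Nonempty) (hlt : A ≠ Finset.univ)
    (hin : ∀ x ∈ A, 2 ≤ (G.neighborFinset x ∩ A).card)
    (hout : ∀ x ∉ A, (G.neighborFinset x ∩ A).card ≤ 1) : G.IsMatchingCut (A : Set V) where
  nonempty := hne
  compl_nonempty := by
    obtain ⟨x, hx⟩ := not_forall.1 (mt Finset.eq_univ_iff_forall.2 hlt)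
    exact ⟨x, by simpa using hx⟩
  eq_of_adj_left x hx y hy z hz hxy hxz := by
    have h1 := Finset.card_inter_add_card_sdiff (G.neighborFinset x) A
    have h2 : (G.neighborFinset x).card = 3 := h3 x
    have h4 := hin x hx
    exact Finset.card_le_one.1 (by omega : (G.neighborFinset x \ A).card ≤ 1) y
      (by simpa using ⟨hxy, hy⟩) z (by simpa using ⟨hxz, hz⟩)
  eq_of_adj_right x hx y hy z hz hxz hyz :=
    Finset.card_le_one.1 (hout z hz) x (by simpa using ⟨hxz.symm, hx⟩) y
      (by simpa using ⟨hyz.symm, hy⟩)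

theorem Walk.IsCycle.two_le_card_inter {u x : V} {c : G.Walk u u} (hc : c.IsCycle)
    (hx : x ∈ c.support) : 2 ≤ (G.neighborFinset x ∩ c.support.toFinset).card := by
  rw [← hc.ncard_neighborSet_toSubgraph_eq_two hx, ← Set.ncard_coe_finset]
  refine Set.ncard_le_ncard (fun y hy => ?_) (Finset.finite_toSet _)
  have hy' : c.toSubgraph.Adj x y := hy
  simpa using ⟨hy'.adj_sub, c.mem_verts_toSubgraph.1 hy'.snd_mem⟩

/-- Adding outer vertices with at least two neighbours in the set terminates before exhausting
the graph, if the set is small and spans enough edges. -/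
theorem exists_isMatchingCut_of_four_mul_card_le (h3 : G.IsRegularOfDegree 3) {A : Finset V}
    {k : ℕ} (hk : k < Fintype.card V) (hne : A.Nonempty)
    (hin : ∀ x ∈ A, 2 ≤ (G.neighborFinset x ∩ A).card)
    (hA : 4 * A.card ≤ k + ∑ x ∈ A, (G.neighborFinset x ∩ A).card) :
    ∃ B : Finset V, A ⊆ B ∧ G.IsMatchingCut (B : Set V) := by
  let P : Finset V → Prop := fun B => A ⊆ B ∧ (∀ x ∈ B, 2 ≤ (G.neighborFinset x ∩ B).card) ∧
    4 * B.card ≤ k + ∑ x ∈ B, (G.neighborFinset x ∩ B).card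
  obtain ⟨B, hB⟩ := (Set.toFinite {B | P B}).exists_maximal ⟨A, subset_rfl, hin, hA⟩
  obtain ⟨⟨hAB, hinB, hcard⟩, hmax⟩ := hB
  refine ⟨B, hAB, isMatchingCut_of_two_le_card_inter h3 (hne.mono hAB) ?_ hinB ?_⟩
  · rintro rfl
    have : ∀ x, G.degree x = 3 := h3
    simp [this] at hcard
    omega
  · intro v hv
    by_contra! hv2
    have hmono : ∀ x, (G.neighborFinset x ∩ B) ⊆ (G.neighborFinset x ∩ insert v B) := fun x =>
      Finset.inter_subset_inter subset_rfl (Finset.subset_insert v B)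
    refine hv (hmax (y := insert v B) ⟨hAB.trans (Finset.subset_insert v B), ?_, ?_⟩
      (Finset.subset_insert v B) (Finset.mem_insert_self v B))
    · intro x hx
      refine le_trans ?_ (Finset.card_le_card (hmono x))
      rcases Finset.mem_insert.1 hx with rfl | hx
      · exact hv2
      · exact hinB x hx
    · have hstep : ∀ x ∈ B, (G.neighborFinset x ∩ insert v B).card =
          (G.neighborFinset x ∩ B).card + if G.Adj v x then 1 else 0 := by
        intro x _
        by_cases hvx : G.Adj v x
        · rw [Finset.inter_insert_of_mem (by simpa using hvx.symm),
            Finset.card_insert_of_notMem (by simp [hv]), if_pos hvx]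
        · rw [Finset.inter_insert_of_notMem (by simpa [G.adj_comm] using hvx), if_neg hvx, add_zero]
      have hsum : ∑ x ∈ B, (if G.Adj v x then 1 else 0) = (G.neighborFinset v ∩ B).card := by
        rw [← Finset.card_filter, Finset.inter_comm]
        congr 1
        ext; simp
      have hvv := Finset.card_le_card (hmono v)
      rw [Finset.card_insert_of_notMem hv, Finset.sum_insert hv, Finset.sum_congr rfl hstep,
        Finset.sum_add_distrib, hsum]
      omega

/-- If the girth is at least five, a shortest cycle is separated from the other vertices by a
matching cut. -/
theorem Walk.IsCycle.isMatchingCut (h3 : G.IsRegularOfDegree 3) {u : V}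
    {c : G.Walk u u} (hc : c.IsCycle) (hlen : G.girth = c.length) (h5 : 5 ≤ G.girth) :
    G.IsMatchingCut (c.support.toFinset : Set V) := by
  refine isMatchingCut_of_two_le_card_inter h3 ⟨u, by simp⟩ ?_
    (fun x hx => hc.two_le_card_inter (by simpa using hx)) ?_
  · intro huniv
    have hall : ∀ x, x ∈ c.support := fun x => by
      rw [← List.mem_toFinset, huniv]; exact Finset.mem_univ x
    obtain ⟨y, hy, hyc⟩ := Set.exists_mem_notMem_of_ncard_lt_ncard
      (s := c.toSubgraph.neighborSet u) (t := G.neighborSet u) (by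
        rw [hc.ncard_neighborSet_toSubgraph_eq_two c.start_mem_support,
          ← coe_neighborFinset, Set.ncard_coe_finset, card_neighborFinset_eq_degree, h3 u]
        norm_num)
    obtain ⟨p, hp, hpe, hpl⟩ := hc.exists_isPath_two_mul_length_le (hall y) (hall u)
    have := hp.girth_le_of_adj hy fun h => hyc (Walk.adj_toSubgraph_iff_mem_edges.2 (hpe h))
    omega
  · intro v hv
    by_contra! h
    obtain ⟨x, hx, y, hy, hxy⟩ := Finset.one_lt_card.1 h
    simp only [Finset.mem_inter, mem_neighborFinset, List.mem_toFinset] at hx hy hv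
    obtain ⟨p, hp, hpe, hpl⟩ := hc.exists_isPath_two_mul_length_le hx.2 hy.2
    have hvp : ∀ w, s(v, w) ∉ p.edges := fun w hw => hv (c.fst_mem_support_of_mem_edges (hpe hw))
    have hvs : v ∉ p.support := by
      intro hvs
      have hnil : ¬ p.Nil := Walk.not_nil_of_ne hxy
      obtain ⟨e, he, hve⟩ := (Walk.mem_support_iff_exists_mem_edges_of_not_nil hnil).1 hvs
      obtain ⟨w, rfl⟩ := hve
      exact hvp w he
    have := ((Walk.cons_isPath_iff hx.1 p).2 ⟨hp, hvs⟩).girth_le_of_adj hy.1.symm (by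
      rw [Walk.edges_cons, List.mem_cons, Sym2.eq_swap]
      rintro (h | h)
      · rcases Sym2.eq_iff.1 h with ⟨-, h⟩ | ⟨h, -⟩
        exacts [hxy h.symm, hx.1.ne h]
      · exact hvp y h)
    rw [Walk.length_cons] at this
    omega

theorem IsRegularOfDegree.not_globallyRigid (h3 : G.IsRegularOfDegree 3)
    (hn : 9 ≤ Fintype.card V) : ¬ GloballyRigid G := by
  have : Nonempty V := Fintype.card_pos_iff.1 (by omega)
  obtain ⟨u, c, hc, hlen⟩ := exists_girth_eq_length.2
    (not_isAcyclic_of_two_le_degree fun v => by rw [h3 v]; norm_num)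
  have hcard := hc.card_support_toFinset
  have h3c := hc.three_le_length
  have hin : ∀ x ∈ c.support.toFinset, 2 ≤ (G.neighborFinset x ∩ c.support.toFinset).card :=
    fun x hx => hc.two_le_card_inter (by simpa using hx)
  obtain ⟨B, hcB, hB⟩ : ∃ B : Finset V, c.support.toFinset ⊆ B ∧ G.IsMatchingCut (B : Set V) := by
    by_cases h5 : 5 ≤ G.girth
    · exact ⟨_, subset_rfl, hc.isMatchingCut h3 hlen h5⟩
    · refine exists_isMatchingCut_of_four_mul_card_le h3 (k := 8) hn ⟨u, by simp⟩ hin ?_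
      have := Finset.card_nsmul_le_sum _ _ _ hin
      rw [smul_eq_mul] at this
      omega
  refine hB.not_globallyRigid ?_
  have := Finset.card_le_card hcB
  exact Finset.one_lt_card_iff_nontrivial.1 (by omega)

end SimpleGraph

theorem stmt16 : ∀ δ : ℝ, 0 < δ → ∃ N : ℕ, ∀ n : ℕ, N ≤ n → Even n →
    (1 - δ) * (Nat.card {G : SimpleGraph (Fin n) //
        ∀ v : Fin n, (G.neighborSet v).ncard = 3} : ℝ) ≤
      (Nat.card {G : SimpleGraph (Fin n) //
        (∀ v : Fin n, (G.neighborSet v).ncard = 3) ∧ ¬ GloballyRigid G} : ℝ) := by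
  classical
  intro δ hδ
  refine ⟨9, fun n hn _ => ?_⟩
  have hcard : Nat.card {G : SimpleGraph (Fin n) // ∀ v : Fin n, (G.neighborSet v).ncard = 3} =
      Nat.card {G : SimpleGraph (Fin n) //
        (∀ v : Fin n, (G.neighborSet v).ncard = 3) ∧ ¬ GloballyRigid G} := by
    refine Nat.card_congr (Equiv.subtypeEquivRight fun G => (and_iff_left_of_imp fun h => ?_).symm)
    refine SimpleGraph.IsRegularOfDegree.not_globallyRigid (G := G) (fun v => ?_) (by simpa using hn)
    rw [← h v, ← SimpleGraph.coe_neighborFinset, Set.ncard_coe_finset,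
      SimpleGraph.card_neighborFinset_eq_degree]
  rw [← hcard]
  exact mul_le_of_le_one_left (Nat.cast_nonneg _) (by linarith)
end
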